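/- Let μ ∈ (0,1) and let c < c₁(μ), where c₁(μ) is the first critical value. Then either there exists a periodic collision orbit with the primary E and energy c, or there exist infinitely many consecutive collision orbits with E and energy c, i.e. the set of pairs (τ, q) with τ > 0 and q : (0,τ) → 𝒦′_c a consecutive collision orbit with E and energy c is infinite. -/

import Mathlib

open Set Filter

/-- Euclidean norm on `ℝ × ℝ`. -/
noncomputable def nrm (v : ℝ × ℝ) : ℝ := Real.sqrt (v.1 ^ 2 + v.2 ^ 2)

/-- Effective potential of the PCR3BP with mass ratio `μ`; the primary `O = (0,0)`
has mass `1 - μ` and the primary `E = (1,0)` has mass `μ`. -/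
noncomputable def V (μ : ℝ) (q : ℝ × ℝ) : ℝ :=
  -(((q.1 - μ) ^ 2 + q.2 ^ 2) / 2) - μ / nrm (q.1 - 1, q.2) - (1 - μ) / nrm q

/-- Critical points of the effective potential. -/
def critSet (μ : ℝ) : Set (ℝ × ℝ) :=
  {q | q ≠ (0, 0) ∧ q ≠ (1, 0) ∧ fderiv ℝ (V μ) q = 0}

/-- The first critical value `c₁(μ)`: the minimum of `V` over its critical points. -/
noncomputable def firstCriticalValue (μ : ℝ) : ℝ := sInf (V μ '' critSet μ)

/-- The Hill region at energy `c`. -/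
def Hill (μ c : ℝ) : Set (ℝ × ℝ) := {q | q ≠ (0, 0) ∧ q ≠ (1, 0) ∧ V μ q ≤ c}

/-- `𝒦′_c`: the connected component of the Hill region whose closure contains `E = (1,0)`. -/
def KSetE (μ c : ℝ) : Set (ℝ × ℝ) :=
  {q | q ∈ Hill μ c ∧ (1, 0) ∈ closure (connectedComponentIn (Hill μ c) q)}

/-- A consecutive collision orbit with `E` and energy `c`: a `C²` solution
`q : (0,τ) → 𝒦′_c` of `q̈₁ - 2q̇₂ = -∂V/∂q₁`, `q̈₂ + 2q̇₁ = -∂V/∂q₂` with energy `c`,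
tending to `E` at both ends. -/
def IsCCOE (μ c : ℝ) (τ : ℝ) (q : ℝ → ℝ × ℝ) : Prop :=
  0 < τ ∧ ∃ q' q'' : ℝ → ℝ × ℝ,
    (∀ t ∈ Ioo (0 : ℝ) τ, HasDerivAt q (q' t) t) ∧
    (∀ t ∈ Ioo (0 : ℝ) τ, HasDerivAt q' (q'' t) t) ∧
    ContinuousOn q'' (Ioo (0 : ℝ) τ) ∧
    (∀ t ∈ Ioo (0 : ℝ) τ, q t ∈ KSetE μ c) ∧
    (∀ t ∈ Ioo (0 : ℝ) τ,
      (q'' t).1 - 2 * (q' t).2 = -((fderiv ℝ (V μ) (q t)) (1, 0)) ∧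
      (q'' t).2 + 2 * (q' t).1 = -((fderiv ℝ (V μ) (q t)) (0, 1))) ∧
    (∀ t ∈ Ioo (0 : ℝ) τ, nrm (q' t) ^ 2 / 2 + V μ (q t) = c) ∧
    Tendsto q (nhdsWithin 0 (Ioi 0)) (nhds (1, 0)) ∧
    Tendsto q (nhdsWithin τ (Iio τ)) (nhds (1, 0))

/-- A periodic collision orbit with `E` and energy `c`: a continuous `T`-periodic map
`q : ℝ → 𝒦′_c ∪ {E}` whose collision set `Z = q⁻¹({E})` is nonempty and discrete,
which is a `C²` solution with energy `c` on `ℝ \ Z`, and which has a well-defined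
collision direction `lim (q(t)-E)/‖q(t)-E‖` at each collision time. -/
def IsPCOE (μ c : ℝ) (q : ℝ → ℝ × ℝ) : Prop :=
  Continuous q ∧
  (∃ T > (0 : ℝ), ∀ t, q (t + T) = q t) ∧
  (∀ t, q t ∈ KSetE μ c ∪ {(1, 0)}) ∧
  (q ⁻¹' {(1, 0)}).Nonempty ∧
  (∀ t₀ ∈ q ⁻¹' {(1, 0)}, ∃ ε > (0 : ℝ),
    ∀ t ∈ q ⁻¹' {(1, 0)}, |t - t₀| < ε → t = t₀) ∧
  (∃ q' q'' : ℝ → ℝ × ℝ,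
    (∀ t, q t ≠ (1, 0) → HasDerivAt q (q' t) t ∧ HasDerivAt q' (q'' t) t) ∧
    ContinuousOn q'' {t | q t ≠ (1, 0)} ∧
    (∀ t, q t ≠ (1, 0) →
      (q'' t).1 - 2 * (q' t).2 = -((fderiv ℝ (V μ) (q t)) (1, 0)) ∧
      (q'' t).2 + 2 * (q' t).1 = -((fderiv ℝ (V μ) (q t)) (0, 1)) ∧
      nrm (q' t) ^ 2 / 2 + V μ (q t) = c)) ∧
  (∀ t₀, q t₀ = (1, 0) → ∃ v : ℝ × ℝ,
    Tendsto (fun t => (nrm (q t - (1, 0)))⁻¹ • (q t - (1, 0)))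
      (nhdsWithin t₀ {t₀}ᶜ) (nhds v))

theorem even_finrank_of_isEmpty_algHom_real {A : Type} [CommRing A] [Algebra ℝ A] [Module.Finite ℝ A]
    (hA : IsEmpty (A →ₐ[ℝ] ℝ)) (n : ℕ) : ∀ (M : Type) [AddCommGroup M] [Module ℝ M] [Module A M]
    [IsScalarTower ℝ A M] [Module.Finite ℝ M], Module.finrank ℝ M = n → Even n := by
  induction n using Nat.strong_induction_on with
  | _ n ih =>
  intro M _ _ _ _ _ hn
  rcases subsingleton_or_nontrivial M with h | h
  · have := Module.finrank_zero_of_subsingleton (R := ℝ) (M := M)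
    rw [this] at hn; subst hn; exact Even.zero
  · have : IsArtinian A M := isArtinian_of_tower ℝ inferInstance
    obtain ⟨N, hN⟩ := IsAtomic.exists_atom (Submodule A M)
    have hs : IsSimpleModule A N := isSimpleModule_iff_isAtom.mpr hN
    obtain ⟨I, hI, ⟨e⟩⟩ := isSimpleModule_iff_quot_maximal.mp hs
    let : Field (A ⧸ I) := Ideal.Quotient.field I
    have h2 : Module.finrank ℝ (A ⧸ I) = 2 := by
      have : Module.Finite ℝ (A ⧸ I) := inferInstance
      rcases Real.nonempty_algEquiv_or (A ⧸ I) with ⟨⟨f⟩⟩ | ⟨⟨f⟩⟩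
      · exact (hA.false ((f : (A ⧸ I) →ₐ[ℝ] ℝ).comp (Ideal.Quotient.mkₐ ℝ I))).elim
      · rw [f.toLinearEquiv.finrank_eq, Complex.finrank_real_complex]
    have hN2 : Module.finrank ℝ N = 2 := by
      rw [(e.restrictScalars ℝ).finrank_eq, h2]
    have : Module.Finite ℝ N := inferInstanceAs (Module.Finite ℝ (N.restrictScalars ℝ))
    have hq : Module.finrank ℝ (M ⧸ N) + Module.finrank ℝ N = n := by
      rw [← hn]
      exact Submodule.finrank_quotient_add_finrank (N.restrictScalars ℝ)
    have := ih (Module.finrank ℝ (M ⧸ N)) (by omega) (M ⧸ N) rfl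
    rw [← hq, hN2]
    exact this.add even_two

theorem nonempty_algHom_real_of_odd_finrank {A : Type} [CommRing A] [Algebra ℝ A] [Module.Finite ℝ A]
    (h : Odd (Module.finrank ℝ A)) : Nonempty (A →ₐ[ℝ] ℝ) := by
  by_contra hA
  rw [not_nonempty_iff] at hA
  exact (Nat.not_even_iff_odd.mpr h) (even_finrank_of_isEmpty_algHom_real hA _ A rfl)

section PowerBasis
open MvPolynomial

/-- The product `∏ fᵢ ^ (αᵢ / d) * Xᵢ ^ (αᵢ % d)`, which is the monomial `X ^ α` if `fᵢ = Xᵢ ^ d`. -/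
noncomputable def powProd {R : Type} [CommRing R] {n : ℕ} (d : ℕ) (f : Fin n → MvPolynomial (Fin n) R)
    (α : Fin n →₀ ℕ) : MvPolynomial (Fin n) R :=
  ∏ i, (f i ^ (α i / d) * X i ^ (α i % d))

theorem monomial_eq_prod_X {R : Type} [CommRing R] {n : ℕ} (α : Fin n →₀ ℕ) :
    (monomial α (1 : R)) = ∏ i, X i ^ α i := by
  rw [monomial_eq, C_1, one_mul, Finsupp.prod_fintype]
  simp

theorem powProd_X_pow {R : Type} [CommRing R] {n d : ℕ} (α : Fin n →₀ ℕ) :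
    powProd d (fun i => (X i : MvPolynomial (Fin n) R) ^ d) α = monomial α 1 := by
  rw [monomial_eq_prod_X, powProd]
  refine Finset.prod_congr rfl fun i _ => ?_
  rw [← pow_mul, ← pow_add, Nat.div_add_mod]

theorem powProd_of_lt {R : Type} [CommRing R] {n d : ℕ} (f : Fin n → MvPolynomial (Fin n) R)
    {α : Fin n →₀ ℕ} (h : ∀ i, α i < d) : powProd d f α = monomial α 1 := by
  rw [monomial_eq_prod_X, powProd]
  refine Finset.prod_congr rfl fun i _ => ?_
  rw [Nat.div_eq_of_lt (h i), Nat.mod_eq_of_lt (h i), pow_zero, one_mul]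

theorem totalDegree_powProd_le {n d : ℕ} {f : Fin n → MvPolynomial (Fin n) ℝ}
    (hf : ∀ i, (f i).totalDegree ≤ d) (α : Fin n →₀ ℕ) :
    (powProd d f α).totalDegree ≤ α.degree := by
  rw [Finsupp.degree_eq_sum]
  refine (totalDegree_finsetProd _ _).trans (Finset.sum_le_sum fun i _ => ?_)
  refine (totalDegree_mul _ _).trans ?_
  have h1 := (totalDegree_pow (f i) (α i / d)).trans (Nat.mul_le_mul_left _ (hf i))
  have h2 := totalDegree_X_pow (R := ℝ) i (α i % d)
  have h3 := Nat.div_add_mod (α i) d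
  rw [mul_comm] at h3
  omega

theorem map_powProd {R S : Type} [CommRing R] [CommRing S] {n d : ℕ} (φ : R →+* S)
    (f : Fin n → MvPolynomial (Fin n) R) (α : Fin n →₀ ℕ) :
    map φ (powProd d f α) = powProd d (fun i => map φ (f i)) α := by
  simp [powProd, map_prod]

theorem mul_powProd {R : Type} [CommRing R] {n d : ℕ} (hd : 0 < d)
    (f : Fin n → MvPolynomial (Fin n) R) (α : Fin n →₀ ℕ) (i : Fin n) :
    f i * powProd d f α = powProd d f (α + Finsupp.single i d) := by
  unfold powProd
  rw [← Finset.mul_prod_erase _ _ (Finset.mem_univ i), ← Finset.mul_prod_erase _ _ (Finset.mem_univ i)]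
  have h : ∀ j ∈ Finset.univ.erase i, (f j ^ ((α + Finsupp.single i d) j / d) *
      (X j : MvPolynomial (Fin n) R) ^ ((α + Finsupp.single i d) j % d)) =
      f j ^ (α j / d) * X j ^ (α j % d) := by
    intro j hj
    have : j ≠ i := Finset.ne_of_mem_erase hj
    simp [this.symm]
  rw [Finset.prod_congr rfl h]
  simp only [Finsupp.add_apply, Finsupp.single_eq_same, Nat.add_div_right _ hd, Nat.add_mod_right,
    pow_succ]
  ring

/-- The linear endomorphism of the polynomial ring sending `X ^ α` to `powProd d f α`. -/
noncomputable def powMap {n : ℕ} (d : ℕ) (f : Fin n → MvPolynomial (Fin n) ℝ) :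
    MvPolynomial (Fin n) ℝ →ₗ[ℝ] MvPolynomial (Fin n) ℝ :=
  (basisMonomials (Fin n) ℝ).constr ℝ (powProd d f)

theorem powMap_monomial {n : ℕ} (d : ℕ) (f : Fin n → MvPolynomial (Fin n) ℝ) (α : Fin n →₀ ℕ)
    (r : ℝ) : powMap d f (monomial α r) = r • powProd d f α := by
  have : (monomial α r : MvPolynomial (Fin n) ℝ) = r • basisMonomials (Fin n) ℝ α := by
    simp [smul_monomial]
  rw [this, map_smul, powMap, Module.Basis.constr_basis]

theorem mul_powMap {n d : ℕ} (hd : 0 < d) (f : Fin n → MvPolynomial (Fin n) ℝ)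
    (p : MvPolynomial (Fin n) ℝ) (i : Fin n) : f i * powMap d f p = powMap d f (X i ^ d * p) := by
  induction p using MvPolynomial.induction_on' with
  | monomial α r =>
    rw [powMap_monomial, X_pow_eq_monomial, monomial_mul, one_mul, powMap_monomial, mul_smul_comm,
      mul_powProd hd, add_comm]
  | add p q hp hq => rw [map_add, mul_add, hp, hq, mul_add, map_add]

theorem totalDegree_powMap_le {n d : ℕ} {f : Fin n → MvPolynomial (Fin n) ℝ}
    (hf : ∀ i, (f i).totalDegree ≤ d) (p : MvPolynomial (Fin n) ℝ) :
    (powMap d f p).totalDegree ≤ p.totalDegree := by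
  conv_lhs => rw [p.as_sum, map_sum]
  refine totalDegree_finsetSum_le fun α hα => ?_
  rw [powMap_monomial]
  refine (totalDegree_smul_le _ _).trans ((totalDegree_powProd_le hf α).trans ?_)
  have := le_totalDegree hα
  rwa [Finsupp.sum_fintype _ _ (by simp), ← Finsupp.degree_eq_sum] at this

theorem bijOn_powMap_of_det_ne_zero {n d D : ℕ} {f : Fin n → MvPolynomial (Fin n) ℝ}
    (hf : ∀ i, (f i).totalDegree ≤ d) [Fintype {α : Fin n →₀ ℕ // α.degree ≤ D}]
    [DecidableEq {α : Fin n →₀ ℕ // α.degree ≤ D}]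
    (hdet : (Matrix.of fun α β : {α : Fin n →₀ ℕ // α.degree ≤ D} =>
      coeff α.1 (powProd d f β.1)).det ≠ 0) :
    (∀ p : MvPolynomial (Fin n) ℝ, p.totalDegree ≤ D → powMap d f p = 0 → p = 0) ∧
    (∀ q : MvPolynomial (Fin n) ℝ, q.totalDegree ≤ D → ∃ p, powMap d f p = q) := by
  set M := (Matrix.of fun α β : {α : Fin n →₀ ℕ // α.degree ≤ D} =>
      coeff α.1 (powProd d f β.1)) with hM
  have key : ∀ c : {α : Fin n →₀ ℕ // α.degree ≤ D} → ℝ, ∀ α : {α : Fin n →₀ ℕ // α.degree ≤ D},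
      coeff α.1 (powMap d f (∑ β, monomial β.1 (c β))) = (M.mulVec c) α := by
    intro c α
    simp [map_sum, powMap_monomial, coeff_sum, Matrix.mulVec, dotProduct, hM, mul_comm]
  have hdeg : ∀ c : {α : Fin n →₀ ℕ // α.degree ≤ D} → ℝ,
      (∑ β, monomial β.1 (c β) : MvPolynomial (Fin n) ℝ).totalDegree ≤ D := by
    intro c
    refine totalDegree_finsetSum_le fun β _ => (totalDegree_monomial_le _ _).trans ?_
    have := β.2
    rwa [Finsupp.degree_eq_sum, ← Finsupp.sum_fintype _ (fun _ e => e) (by simp)] at this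
  have hbig : ∀ p : MvPolynomial (Fin n) ℝ, p.totalDegree ≤ D → ∀ α : Fin n →₀ ℕ, D < α.degree →
      coeff α p = 0 := by
    intro p hp α hα
    refine coeff_eq_zero_of_totalDegree_lt ?_
    have : α.degree = ∑ i ∈ α.support, α i := rfl
    omega
  have hrep : ∀ p : MvPolynomial (Fin n) ℝ, p.totalDegree ≤ D →
      p = ∑ β : {α : Fin n →₀ ℕ // α.degree ≤ D}, monomial β.1 (coeff β.1 p) := by
    intro p hp
    ext α
    by_cases hα : α.degree ≤ D
    · rw [coeff_sum, Finset.sum_eq_single ⟨α, hα⟩]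
      · simp
      · intro b _ hb
        rw [coeff_monomial, if_neg]
        intro h; exact hb (Subtype.ext h)
      · simp
    · push Not at hα
      rw [hbig p hp α hα, hbig _ (hdeg _) α hα]
  constructor
  · intro p hp h0
    have h1 : M.mulVec (fun β => coeff β.1 p) = 0 := by
      ext α
      rw [← key, ← hrep p hp, h0]; simp
    have h2 : (fun β : {α : Fin n →₀ ℕ // α.degree ≤ D} => coeff β.1 p) = 0 := by
      by_contra hne
      exact hdet (Matrix.exists_mulVec_eq_zero_iff.mp ⟨_, hne, h1⟩)
    rw [hrep p hp]
    refine Finset.sum_eq_zero fun β _ => ?_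
    rw [show coeff β.1 p = 0 from congrFun h2 β, monomial_zero]
  · intro q hq
    obtain ⟨c, hc⟩ : ∃ c, M.mulVec c = fun α => coeff α.1 q := by
      have hu : IsUnit M.det := isUnit_iff_ne_zero.mpr hdet
      exact ⟨M⁻¹.mulVec fun α => coeff α.1 q, by
        rw [Matrix.mulVec_mulVec, Matrix.mul_nonsing_inv _ hu, Matrix.one_mulVec]⟩
    refine ⟨∑ β, monomial β.1 (c β), ?_⟩
    ext α
    by_cases hα : α.degree ≤ D
    · rw [key c ⟨α, hα⟩, hc]
    · push Not at hα
      rw [hbig q hq α hα, hbig _ ((totalDegree_powMap_le hf _).trans (hdeg c)) α hα]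

theorem countable_setOf_not_bijective_powMap {n d : ℕ}
    {g : Fin n → MvPolynomial (Fin n) ℝ} (hg : ∀ i, (g i).totalDegree ≤ d) :
    {s : ℝ | ¬ Function.Bijective (powMap d fun i => X i ^ d + C s * g i)}.Countable := by
  classical
  have hfin : ∀ D : ℕ, Finite {α : Fin n →₀ ℕ // α.degree ≤ D} := fun D =>
    (Finsupp.finite_of_degree_le D).to_subtype
  let _ : ∀ D : ℕ, Fintype {α : Fin n →₀ ℕ // α.degree ≤ D} := fun D => Fintype.ofFinite _
  let fT : Fin n → MvPolynomial (Fin n) (Polynomial ℝ) := fun i =>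
    X i ^ d + C Polynomial.X * map Polynomial.C (g i)
  have hmap : ∀ s : ℝ, (fun i => map (Polynomial.evalRingHom s) (fT i)) =
      fun i => X i ^ d + C s * g i := by
    intro s; funext i
    have : (Polynomial.evalRingHom s).comp Polynomial.C = RingHom.id ℝ := by ext; simp
    have h : map (Polynomial.evalRingHom s) (map Polynomial.C (g i)) = g i := by
      rw [MvPolynomial.map_map, this, MvPolynomial.map_id]
    simp [fT, h]
  let P : ℕ → Polynomial ℝ := fun D => (Matrix.of fun α β : {α : Fin n →₀ ℕ // α.degree ≤ D} =>
      coeff α.1 (powProd d fT β.1)).det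
  have hP : ∀ D s, (P D).eval s = (Matrix.of fun α β : {α : Fin n →₀ ℕ // α.degree ≤ D} =>
      coeff α.1 (powProd d (fun i => X i ^ d + C s * g i) β.1)).det := by
    intro D s
    rw [← hmap s, ← Polynomial.coe_evalRingHom, RingHom.map_det]
    congr 1
    ext α β
    simp only [RingHom.mapMatrix_apply, Matrix.map_apply, Matrix.of_apply]
    rw [← map_powProd, coeff_map]
  have hP0 : ∀ D, P D ≠ 0 := by
    intro D h
    have h1 := hP D 0
    rw [h, Polynomial.eval_zero] at h1
    have : (Matrix.of fun α β : {α : Fin n →₀ ℕ // α.degree ≤ D} =>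
      coeff α.1 (powProd d (fun i => X i ^ d + C (0 : ℝ) * g i) β.1)) = 1 := by
      ext α β
      simp only [map_zero, zero_mul, add_zero, powProd_X_pow, Matrix.of_apply, coeff_monomial,
        Matrix.one_apply, Subtype.ext_iff]
      simp [eq_comm]
    rw [this, Matrix.det_one] at h1
    exact zero_ne_one h1
  refine Set.Countable.mono (s₂ := ⋃ D, {s | (P D).IsRoot s}) ?_
    (Set.countable_iUnion fun D => (Polynomial.finite_setOfPred_isRoot (hP0 D)).countable)
  intro s hs
  by_contra hcon
  simp only [mem_iUnion, Set.mem_ofPred_eq, not_exists, Polynomial.IsRoot.def] at hcon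
  apply hs
  have hf : ∀ i, (X i ^ d + C s * g i : MvPolynomial (Fin n) ℝ).totalDegree ≤ d := by
    intro i
    refine (totalDegree_add _ _).trans (max_le (totalDegree_X_pow _ _).le ?_)
    refine (totalDegree_mul _ _).trans ?_
    rw [totalDegree_C, zero_add]; exact hg i
  have hb := fun D => bijOn_powMap_of_det_ne_zero (D := D) hf (by rw [← hP]; exact hcon D)
  constructor
  · rw [← LinearMap.ker_eq_bot, LinearMap.ker_eq_bot']
    intro p hp
    exact (hb p.totalDegree).1 p le_rfl hp
  · intro q
    exact (hb q.totalDegree).2 q le_rfl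

/-- A system `Xᵢ ^ d + lower order terms`, with `d` odd, has a real zero as soon as the
products `powProd d f α` form a basis of the polynomial ring. -/
theorem exists_common_zero_of_bijective_powMap {n d : ℕ} (hd : Odd d)
    {f : Fin n → MvPolynomial (Fin n) ℝ} (hf : Function.Bijective (powMap d f)) :
    ∃ a : Fin n → ℝ, ∀ i, eval a (f i) = 0 := by
  classical
  have hd0 : 0 < d := hd.pos
  let I : Ideal (MvPolynomial (Fin n) ℝ) := Ideal.span (range f)
  have hlow : ∀ p : MvPolynomial (Fin n) ℝ, (∀ α : Fin n →₀ ℕ, (∃ i, d ≤ α i) → coeff α p = 0) →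
      powMap d f p = p := by
    intro p hp
    conv_lhs => rw [p.as_sum, map_sum]
    conv_rhs => rw [p.as_sum]
    refine Finset.sum_congr rfl fun α hα => ?_
    rw [powMap_monomial, powProd_of_lt, smul_monomial, smul_eq_mul, mul_one]
    intro i
    by_contra h
    exact (mem_support_iff.mp hα) (hp α ⟨i, not_lt.mp h⟩)
  have hIN : ∀ q ∈ I, ∃ p, powMap d f p = q ∧ ∀ α : Fin n →₀ ℕ, (∀ i, α i < d) → coeff α p = 0 := by
    intro q hq
    obtain ⟨a, rfl⟩ := Ideal.mem_span_range_iff_exists_fun.mp hq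
    choose p hp using fun i => hf.2 (a i)
    refine ⟨∑ i, X i ^ d * p i, ?_, ?_⟩
    · rw [map_sum]
      refine Finset.sum_congr rfl fun i _ => ?_
      rw [← mul_powMap hd0, hp, mul_comm]
    · intro α hα
      rw [coeff_sum]
      refine Finset.sum_eq_zero fun i _ => ?_
      rw [X_pow_eq_monomial, coeff_monomial_mul', if_neg]
      intro h
      have := h i
      rw [Finsupp.single_eq_same] at this
      exact absurd (hα i) (not_lt.mpr this)
  have hNI : ∀ p : MvPolynomial (Fin n) ℝ, (∀ α : Fin n →₀ ℕ, (∀ i, α i < d) → coeff α p = 0) →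
      powMap d f p ∈ I := by
    intro p hp
    rw [p.as_sum, map_sum]
    refine Ideal.sum_mem _ fun α hα => ?_
    obtain ⟨i, hi⟩ : ∃ i, d ≤ α i := by
      by_contra! h
      exact (mem_support_iff.mp hα) (hp α h)
    have hα' : α = (α - Finsupp.single i d) + Finsupp.single i d := by
      ext j
      simp only [Finsupp.add_apply, Finsupp.tsub_apply, Finsupp.single_apply]
      split_ifs with h
      · subst h; omega
      · simp
    rw [powMap_monomial, hα', ← mul_powProd hd0, ← mul_smul_comm]
    exact I.mul_mem_right _ (Ideal.subset_span ⟨i, rfl⟩)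
  let lift : (Fin n → Fin d) → (Fin n →₀ ℕ) := fun α => Finsupp.equivFunOnFinite.symm fun i => (α i : ℕ)
  have hlift : ∀ α i, lift α i = (α i : ℕ) := fun α i => rfl
  have hinj : Function.Injective lift := by
    intro α β h
    funext i
    exact Fin.ext (by rw [← hlift, ← hlift, h])
  let L : ((Fin n → Fin d) → ℝ) →ₗ[ℝ] (MvPolynomial (Fin n) ℝ ⧸ I) :=
    (Ideal.Quotient.mkₐ ℝ I).toLinearMap ∘ₗ
      Fintype.linearCombination ℝ (fun α => monomial (lift α) (1 : ℝ))
  have hcL : ∀ (c : (Fin n → Fin d) → ℝ) (α : Fin n →₀ ℕ), (∃ i, d ≤ α i) →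
      coeff α (∑ β, c β • monomial (lift β) (1 : ℝ)) = 0 := by
    rintro c α ⟨i, hi⟩
    rw [coeff_sum]
    refine Finset.sum_eq_zero fun β _ => ?_
    rw [coeff_smul, coeff_monomial, if_neg, smul_zero]
    rintro rfl
    have := (β i).2
    rw [hlift] at hi
    omega
  have hcL' : ∀ (c : (Fin n → Fin d) → ℝ) (α : Fin n → Fin d),
      coeff (lift α) (∑ β, c β • monomial (lift β) (1 : ℝ)) = c α := by
    intro c α
    rw [coeff_sum, Finset.sum_eq_single α]
    · simp
    · intro β _ hβ
      rw [coeff_smul, coeff_monomial, if_neg fun h => hβ (hinj h), smul_zero]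
    · simp
  have hLa : ∀ c, L c = Ideal.Quotient.mk I (∑ β, c β • monomial (lift β) (1 : ℝ)) := fun c => rfl
  have hL : Function.Bijective L := by
    constructor
    · rw [← LinearMap.ker_eq_bot, LinearMap.ker_eq_bot']
      intro c hc
      rw [hLa, Ideal.Quotient.eq_zero_iff_mem] at hc
      obtain ⟨p, hp, hp'⟩ := hIN _ hc
      rw [← hlow _ (hcL c)] at hp
      have := hf.1 hp
      funext α
      rw [← hcL' c α, ← this]
      exact hp' _ fun i => (α i).2
    · intro x
      obtain ⟨q, rfl⟩ := Ideal.Quotient.mk_surjective x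
      obtain ⟨p, rfl⟩ := hf.2 q
      refine ⟨fun α => coeff (lift α) p, ?_⟩
      rw [hLa, Ideal.Quotient.mk_eq_mk_iff_sub_mem, ← hlow _ (hcL _), ← map_sub]
      refine hNI _ fun α hα => ?_
      have : α = lift fun i => ⟨α i, hα i⟩ := by ext i; rfl
      rw [this, coeff_sub, hcL', sub_self]
  let e := LinearEquiv.ofBijective L hL
  have : Module.Finite ℝ (MvPolynomial (Fin n) ℝ ⧸ I) := Module.Finite.equiv e
  have hodd : Odd (Module.finrank ℝ (MvPolynomial (Fin n) ℝ ⧸ I)) := by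
    rw [← e.finrank_eq, Module.finrank_fintype_fun_eq_card, Fintype.card_fun, Fintype.card_fin,
      Fintype.card_fin]
    exact hd.pow
  obtain ⟨φ⟩ := nonempty_algHom_real_of_odd_finrank hodd
  let ψ : MvPolynomial (Fin n) ℝ →ₐ[ℝ] ℝ := φ.comp (Ideal.Quotient.mkₐ ℝ I)
  refine ⟨fun i => ψ (X i), fun i => ?_⟩
  have h1 : aeval (fun i => ψ (X i)) (f i) = ψ (f i) := by
    conv_rhs => rw [MvPolynomial.aeval_unique ψ]
    rfl
  rw [aeval_eq_eval] at h1
  change (eval fun i => ψ (X i)) (f i) = _ at h1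
  rw [h1]
  have : Ideal.Quotient.mk I (f i) = 0 :=
    Ideal.Quotient.eq_zero_iff_mem.mpr (Ideal.subset_span ⟨i, rfl⟩)
  simp [ψ, this]

end PowerBasis

section BorsukUlam
open MvPolynomial

theorem exists_homogenized_oddPart {n : ℕ} (p : MvPolynomial (Fin (n + 1)) ℝ) :
    ∃ D : ℕ, ∀ d, Odd d → D ≤ d → ∃ g : MvPolynomial (Fin n) ℝ, g.totalDegree ≤ d ∧
      ∀ (a : Fin n → ℝ) (r : ℝ), 0 < r → r ^ 2 = 1 + ∑ i, a i ^ 2 →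
        eval a g = r ^ d * ((eval (r⁻¹ • (Fin.cons 1 a : Fin (n + 1) → ℝ)) p -
          eval (-(r⁻¹ • (Fin.cons 1 a : Fin (n + 1) → ℝ))) p) / 2) := by
  induction p using MvPolynomial.induction_on' with
  | add p q hp hq =>
    obtain ⟨D, hD⟩ := hp
    obtain ⟨D', hD'⟩ := hq
    refine ⟨max D D', fun d hd hDd => ?_⟩
    obtain ⟨g, hg, hg'⟩ := hD d hd (le_trans (le_max_left _ _) hDd)
    obtain ⟨k, hk, hk'⟩ := hD' d hd (le_trans (le_max_right _ _) hDd)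
    refine ⟨g + k, (totalDegree_add _ _).trans (max_le hg hk), fun a r hr h => ?_⟩
    rw [eval_add, hg' a r hr h, hk' a r hr h, eval_add, eval_add]
    ring
  | monomial α c =>
    refine ⟨α.degree, fun d hd hDd => ?_⟩
    have hev : ∀ y : Fin (n + 1) → ℝ, eval y (monomial α c) = c * ∏ i, y i ^ α i := by
      intro y
      rw [eval_monomial, Finsupp.prod_fintype]
      simp
    rcases Nat.even_or_odd α.degree with he | ho
    · refine ⟨0, by simp, fun a r hr h => ?_⟩
      rw [hev, hev]
      have : ∏ i, (-(r⁻¹ • (Fin.cons 1 a : Fin (n + 1) → ℝ))) i ^ α i =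
          ∏ i, (r⁻¹ • (Fin.cons 1 a : Fin (n + 1) → ℝ)) i ^ α i := by
        have : ∀ i, (-(r⁻¹ • (Fin.cons 1 a : Fin (n + 1) → ℝ))) i ^ α i =
            (-1) ^ α i * (r⁻¹ • (Fin.cons 1 a : Fin (n + 1) → ℝ)) i ^ α i := by
          intro i; rw [← mul_pow]; simp
        rw [Finset.prod_congr rfl fun i _ => this i, Finset.prod_mul_distrib,
          Finset.prod_pow_eq_pow_sum, ← Finsupp.degree_eq_sum, he.neg_one_pow, one_mul]
      rw [this]; simp
    · obtain ⟨m, hm⟩ : ∃ m, d = α.degree + 2 * m := by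
        obtain ⟨u, hu⟩ := ho
        obtain ⟨v, hv⟩ := hd
        exact ⟨v - u, by omega⟩
      refine ⟨C c * (1 + ∑ i, X i ^ 2) ^ m * ∏ i : Fin n, X i ^ α i.succ, ?_, fun a r hr h => ?_⟩
      · refine (totalDegree_mul _ _).trans ?_
        have h1 : (∏ i : Fin n, (X i : MvPolynomial (Fin n) ℝ) ^ α i.succ).totalDegree ≤ α.degree := by
          refine (totalDegree_finsetProd _ _).trans ?_
          rw [Finsupp.degree_eq_sum, Fin.sum_univ_succ]
          refine le_trans (Finset.sum_le_sum fun i _ => (totalDegree_X_pow i _).le) ?_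
          exact Nat.le_add_left _ _
        have h2 : (1 + ∑ i, X i ^ 2 : MvPolynomial (Fin n) ℝ).totalDegree ≤ 2 := by
          refine (totalDegree_add _ _).trans (max_le (by simp) ?_)
          exact totalDegree_finsetSum_le fun i _ => (totalDegree_X_pow i _).le
        have h3 : (C c * (1 + ∑ i, X i ^ 2) ^ m : MvPolynomial (Fin n) ℝ).totalDegree ≤ 2 * m := by
          refine (totalDegree_mul _ _).trans ?_
          rw [totalDegree_C, zero_add]
          refine (totalDegree_pow _ _).trans ?_
          rw [mul_comm]; exact Nat.mul_le_mul_right _ h2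
        omega
      · rw [hev, hev]
        have h1 : ∏ i, (r⁻¹ • (Fin.cons 1 a : Fin (n + 1) → ℝ)) i ^ α i =
            (r⁻¹) ^ α.degree * ∏ i : Fin n, a i ^ α i.succ := by
          simp only [Pi.smul_apply, smul_eq_mul, mul_pow]
          rw [Finset.prod_mul_distrib, Finset.prod_pow_eq_pow_sum, ← Finsupp.degree_eq_sum,
            Fin.prod_univ_succ]
          simp
        have h2 : ∏ i, (-(r⁻¹ • (Fin.cons 1 a : Fin (n + 1) → ℝ))) i ^ α i =
            -((r⁻¹) ^ α.degree * ∏ i : Fin n, a i ^ α i.succ) := by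
          have : ∀ i, (-(r⁻¹ • (Fin.cons 1 a : Fin (n + 1) → ℝ))) i ^ α i =
              (-1) ^ α i * (r⁻¹ • (Fin.cons 1 a : Fin (n + 1) → ℝ)) i ^ α i := by
            intro i; rw [← mul_pow]; simp
          rw [Finset.prod_congr rfl fun i _ => this i, Finset.prod_mul_distrib,
            Finset.prod_pow_eq_pow_sum, ← Finsupp.degree_eq_sum, ho.neg_one_pow, h1]
          ring
        rw [h1, h2]
        simp only [map_mul, map_add, map_pow, map_sum, map_prod, eval_X, eval_C, map_one]
        rw [← h, hm, pow_add, pow_mul, inv_pow]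
        field_simp
        ring

theorem exists_small_value_of_polynomials {n : ℕ} (p : Fin n → MvPolynomial (Fin (n + 1)) ℝ) {ε : ℝ}
    (hε : 0 < ε) : ∃ x : Fin (n + 1) → ℝ, ∑ i, x i ^ 2 = 1 ∧
      ∀ i, |(eval x (p i) - eval (-x) (p i)) / 2| < ε := by
  choose D hD using fun i => exists_homogenized_oddPart (p i)
  let d := 2 * (∑ i, D i) + 1
  have hdD : ∀ i, D i ≤ d := fun i => by
    have := Finset.single_le_sum (f := D) (fun i _ => Nat.zero_le _) (Finset.mem_univ i)
    omega
  have hd : Odd d := ⟨_, rfl⟩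
  choose g hg hg' using fun i => hD i d hd (hdD i)
  obtain ⟨s, hs, hsε⟩ : ∃ s : ℝ, Function.Bijective (powMap d fun i => X i ^ d + C s * g i) ∧
      ε⁻¹ < s := by
    by_contra! h
    have hsub : Ioi ε⁻¹ ⊆ {s : ℝ | ¬ Function.Bijective (powMap d fun i => X i ^ d + C s * g i)} := by
      intro s hs hb
      exact absurd (h s hb) (not_le.mpr hs)
    have hc := ((countable_setOf_not_bijective_powMap hg).mono hsub).measure_zero MeasureTheory.volume
    simp at hc
  obtain ⟨a, ha⟩ := exists_common_zero_of_bijective_powMap hd hs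
  have hpos : 0 < 1 + ∑ i, a i ^ 2 := by
    have := Finset.sum_nonneg (s := Finset.univ) fun i _ => sq_nonneg (a i)
    linarith
  set r := √(1 + ∑ i, a i ^ 2) with hr
  have hr0 : 0 < r := Real.sqrt_pos.mpr hpos
  have hr2 : r ^ 2 = 1 + ∑ i, a i ^ 2 := Real.sq_sqrt hpos.le
  refine ⟨r⁻¹ • (Fin.cons 1 a : Fin (n + 1) → ℝ), ?_, fun i => ?_⟩
  · simp only [Pi.smul_apply, smul_eq_mul, mul_pow]
    rw [← Finset.mul_sum, Fin.sum_univ_succ]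
    simp only [Fin.cons_zero, Fin.cons_succ, one_pow, ← hr2]
    field_simp
  · have h1 := ha i
    simp only [map_mul, map_add, map_pow, eval_X, eval_C, hg' i a r hr0 hr2] at h1
    set w := (eval (r⁻¹ • (Fin.cons 1 a : Fin (n + 1) → ℝ)) (p i) -
          eval (-(r⁻¹ • (Fin.cons 1 a : Fin (n + 1) → ℝ))) (p i)) / 2
    have hs0 : 0 < s := lt_trans (inv_pos.mpr hε) hsε
    have hw : w = -(a i / r) ^ d / s := by
      field_simp
      rw [div_pow]
      field_simp
      linarith
    have har : |a i / r| ≤ 1 := by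
      rw [abs_div, abs_of_pos hr0, div_le_one hr0]
      refine Real.abs_le_sqrt ?_
      have := Finset.single_le_sum (f := fun i => a i ^ 2) (fun i _ => sq_nonneg _) (Finset.mem_univ i)
      linarith
    rw [hw, abs_div, abs_neg, abs_pow, abs_of_pos hs0, div_lt_iff₀ hs0]
    have h2 : |a i / r| ^ d ≤ 1 := pow_le_one₀ (abs_nonneg _) har
    have h3 : 1 < s * ε := (inv_lt_iff_one_lt_mul₀ hε).mp hsε
    linarith

theorem exists_zero_of_odd_of_sum_sq_eq_one {n : ℕ} (φ : (Fin (n + 1) → ℝ) → Fin n → ℝ)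
    (hφ : ContinuousOn φ {x | ∑ i, x i ^ 2 = 1})
    (hodd : ∀ x, ∑ i, x i ^ 2 = 1 → φ (-x) = -φ x) : ∃ x, ∑ i, x i ^ 2 = 1 ∧ φ x = 0 := by
  let K : Set (Fin (n + 1) → ℝ) := {x | ∑ i, x i ^ 2 = 1}
  have hKc : IsCompact K := by
    refine Metric.isCompact_of_isClosed_isBounded ?_ ?_
    · exact isClosed_eq (by fun_prop) continuous_const
    · refine (Metric.isBounded_closedBall (x := 0) (r := 1)).subset fun x hx => ?_
      rw [mem_closedBall_zero_iff, pi_norm_le_iff_of_nonneg zero_le_one]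
      intro i
      have := Finset.single_le_sum (f := fun i => x i ^ 2) (fun i _ => sq_nonneg _) (Finset.mem_univ i)
      have hx' : ∑ i, x i ^ 2 = 1 := hx
      rw [Real.norm_eq_abs]
      exact abs_le_one_iff_mul_self_le_one.mpr (by nlinarith)
  have : CompactSpace K := isCompact_iff_compactSpace.mp hKc
  by_contra! hne
  obtain ⟨x₀, hx₀⟩ : K.Nonempty := ⟨Pi.single 0 1, by
    change ∑ i, _ = _
    rw [Finset.sum_eq_single 0] <;> simp +contextual⟩
  obtain ⟨y, hy, hmin⟩ := hKc.exists_isMinOn ⟨x₀, hx₀⟩ hφ.norm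
  set ε := ‖φ y‖ with hε
  have hε0 : 0 < ε := norm_pos_iff.mpr (hne y hy)
  let A : Subalgebra ℝ C(K, ℝ) :=
    (aeval (R := ℝ) fun i => (⟨fun x : K => x.1 i, (continuous_apply i).comp continuous_subtype_val⟩ : C(K, ℝ))).range
  have hev : ∀ (p : MvPolynomial (Fin (n + 1)) ℝ) (x : K), (aeval (R := ℝ) fun i =>
      (⟨fun x : K => x.1 i, (continuous_apply i).comp continuous_subtype_val⟩ : C(K, ℝ))) p x =
      eval x.1 p := by
    intro p x
    induction p using MvPolynomial.induction_on with
    | C a => simp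
    | add p q hp hq => rw [map_add, map_add, ContinuousMap.add_apply, hp, hq]
    | mul_X p i hp => rw [map_mul, map_mul, ContinuousMap.mul_apply, hp]; simp
  have hA : A.SeparatesPoints := by
    intro x z hxz
    obtain ⟨i, hi⟩ := Function.ne_iff.mp (fun h => hxz (Subtype.ext h))
    exact ⟨_, ⟨_, ⟨X i, rfl⟩, rfl⟩, by simpa using hi⟩
  have happ : ∀ i, ∃ p : MvPolynomial (Fin (n + 1)) ℝ, ∀ x ∈ K, |eval x p - φ x i| < ε / 2 := by
    intro i
    obtain ⟨⟨f, p, hp⟩, hf⟩ := ContinuousMap.exists_mem_subalgebra_near_continuous_of_separatesPoints A hA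
      (fun x : K => φ x i) (by
        have := continuousOn_iff_continuous_domRestrict.mp hφ
        exact (continuous_apply i).comp this) (ε / 2) (by positivity)
    refine ⟨p, fun x hx => ?_⟩
    have h1 := hf ⟨x, hx⟩
    have h2 : f ⟨x, hx⟩ = eval x p := by
      rw [← hp]
      exact hev p ⟨x, hx⟩
    simpa [h2] using h1
  choose p hp using happ
  obtain ⟨x, hx, hxp⟩ := exists_small_value_of_polynomials p (half_pos hε0)
  have hx' : -x ∈ K := by
    change ∑ i, _ = _
    simpa using hx
  have hlt : ‖φ x‖ < ε := by
    rw [pi_norm_lt_iff hε0]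
    intro i
    have h1 := hp i x hx
    have h2 := hp i (-x) hx'
    rw [hodd x hx, Pi.neg_apply] at h2
    have h3 := hxp i
    rw [Real.norm_eq_abs]
    rw [abs_lt] at *
    constructor <;> linarith [h1.1, h1.2, h2.1, h2.2, h3.1, h3.2]
  exact absurd (hmin hx) (not_le.mpr hlt)

/-- **Borsuk–Ulam**: a continuous odd map from the unit sphere to a space of smaller
dimension has a zero. -/
theorem exists_zero_of_odd_of_finrank_lt {F G : Type*} [NormedAddCommGroup F] [InnerProductSpace ℝ F]
    [FiniteDimensional ℝ F] [NormedAddCommGroup G] [NormedSpace ℝ G]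
    [FiniteDimensional ℝ G] (h : Module.finrank ℝ G < Module.finrank ℝ F) (φ : F → G)
    (hφ : ContinuousOn φ (Metric.sphere 0 1)) (hodd : ∀ x ∈ Metric.sphere (0 : F) 1, φ (-x) = -φ x) :
    ∃ x ∈ Metric.sphere (0 : F) 1, φ x = 0 := by
  obtain ⟨n, hn⟩ : ∃ n, Module.finrank ℝ F = n + 1 := ⟨Module.finrank ℝ F - 1, by omega⟩
  let b : OrthonormalBasis (Fin (n + 1)) ℝ F := (stdOrthonormalBasis ℝ F).reindex (finCongr hn)
  obtain ⟨J, hJ⟩ : ∃ J : G →L[ℝ] (Fin n → ℝ), Function.Injective J := by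
    obtain ⟨J, hJ⟩ := (finrank_le_iff_exists_linearMap (R := ℝ) (M := G) (M' := Fin n → ℝ)).mp
      (by rw [Module.finrank_fin_fun]; omega)
    exact ⟨J.toContinuousLinearMap, hJ⟩
  let e : (Fin (n + 1) → ℝ) → F := fun x => b.repr.symm (WithLp.toLp 2 x)
  have he : Continuous e := by fun_prop
  have hes : ∀ x, ∑ i, x i ^ 2 = 1 → e x ∈ Metric.sphere (0 : F) 1 := by
    intro x hx
    rw [mem_sphere_zero_iff_norm, LinearIsometryEquiv.norm_map, EuclideanSpace.norm_eq]
    simp [hx]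
  obtain ⟨x, hx, hx0⟩ := exists_zero_of_odd_of_sum_sq_eq_one (fun x => J (φ (e x)))
    (J.continuous.comp_continuousOn (hφ.comp he.continuousOn hes)) (by
      intro x hx
      have : e (-x) = - e x := by simp [e]
      rw [this, hodd _ (hes x hx), map_neg])
  exact ⟨e x, hes x hx, hJ (by rw [hx0, map_zero])⟩

end BorsukUlam

section MinimaxPrinciple

variable {E : Type*} [NormedAddCommGroup E] [InnerProductSpace ℝ E]

theorem inner_eq_zero_of_smul_invariant {R : E → ℝ} {g : E → E}
    (hg : ∀ x, x ≠ 0 → HasFDerivAt R (innerSL ℝ (g x)) x)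
    (hR : ∀ (s : ℝ) (x : E), s ≠ 0 → R (s • x) = R x) {x : E} (hx : x ≠ 0) : inner ℝ (g x) x = 0 := by
  have h1 : HasDerivAt (fun s : ℝ => R (s • x)) (innerSL ℝ (g x) x) 1 := by
    have h2 : HasDerivAt (fun s : ℝ => s • x) x 1 := by
      simpa using (hasDerivAt_id (1 : ℝ)).smul_const x
    have h3 : HasFDerivAt R (innerSL ℝ (g x)) ((1 : ℝ) • x) := by rw [one_smul]; exact hg x hx
    exact h3.comp_hasDerivAt 1 h2
  have h2 : HasDerivAt (fun s : ℝ => R (s • x)) 0 1 := by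
    refine (hasDerivAt_const (1 : ℝ) (R x)).congr_of_eventuallyEq ?_
    filter_upwards [isOpen_ne.mem_nhds (one_ne_zero (α := ℝ))] with s hs using hR s x hs
  simpa using h1.unique h2

theorem gradient_odd_of_smul_invariant {R : E → ℝ} {g : E → E}
    (hg : ∀ x, x ≠ 0 → HasFDerivAt R (innerSL ℝ (g x)) x)
    (hR : ∀ (s : ℝ) (x : E), s ≠ 0 → R (s • x) = R x) {x : E} (hx : x ≠ 0) : g (-x) = -g x := by
  have h1 : HasFDerivAt (fun y => R (-y)) (-(innerSL ℝ (g (-x)))) x := by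
    have := (hg (-x) (neg_ne_zero.mpr hx)).comp x (hasFDerivAt_id x).neg
    simpa [Function.comp_def] using this
  have h2 : (fun y => R (-y)) = R := by
    funext y
    have := hR (-1) y (by norm_num)
    rwa [neg_one_smul] at this
  rw [h2] at h1
  have h3 := (hg x hx).unique h1
  refine ext_inner_right ℝ fun v => ?_
  have := DFunLike.congr_fun h3 v
  simp only [innerSL_apply_apply, neg_apply] at this
  rw [inner_neg_left, this, neg_neg]

variable [FiniteDimensional ℝ E]

/-- Pushing along the gradient of a scale-invariant function whose gradient is bounded below
on a range of values. -/
theorem exists_odd_ascent_map {R : E → ℝ} {g : E → E}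
    (hg : ∀ x, x ≠ 0 → HasFDerivAt R (innerSL ℝ (g x)) x) (hgc : ContinuousOn g {0}ᶜ)
    (hR : ∀ (s : ℝ) (x : E), s ≠ 0 → R (s • x) = R x) {c C η κ : ℝ} (hη : 0 < η) (hκ : 0 < κ)
    (hgκ : ∀ x ∈ Metric.sphere (0 : E) 1, c ≤ R x → R x ≤ C + η → κ ≤ ‖g x‖) :
    ∃ (Φ : E → E) (δ : ℝ), 0 < δ ∧ ContinuousOn Φ (Metric.sphere 0 1) ∧
      MapsTo Φ (Metric.sphere 0 1) (Metric.sphere 0 1) ∧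
      (∀ x ∈ Metric.sphere (0 : E) 1, Φ (-x) = -Φ x) ∧
      ∀ x ∈ Metric.sphere (0 : E) 1, c ≤ R x → min (R x + δ) (C + η / 2) ≤ R (Φ x) := by
  have hS0 : ∀ x ∈ Metric.sphere (0 : E) 1, x ≠ 0 := fun x hx => by
    rintro rfl; simp at hx
  have hgS : ContinuousOn g (Metric.sphere 0 1) := hgc.mono hS0
  have hne : ∀ x ∈ Metric.sphere (0 : E) 1, ∀ t : ℝ, x + t • g x ≠ 0 := by
    intro x hx t h0
    have h1 : inner ℝ (x + t • g x) x = 1 := by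
      rw [inner_add_left, inner_smul_left, inner_eq_zero_of_smul_invariant hg hR (hS0 x hx),
        real_inner_self_eq_norm_sq, mem_sphere_zero_iff_norm.mp hx]
      simp
    rw [h0, inner_zero_left] at h1
    exact zero_ne_one h1
  have hF : ContinuousOn (fun p : E × ℝ => g (p.1 + p.2 • g p.1))
      (Metric.sphere 0 1 ×ˢ Icc (0 : ℝ) 1) := by
    have h1 : ContinuousOn (fun p : E × ℝ => g p.1) (Metric.sphere 0 1 ×ˢ Icc (0 : ℝ) 1) :=
      hgS.comp continuousOn_fst fun p hp => hp.1
    refine hgc.comp (continuousOn_fst.add (continuousOn_snd.smul h1)) fun p hp => ?_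
    exact hne _ hp.1 _
  have hU := ((isCompact_sphere (0 : E) 1).prod isCompact_Icc).uniformContinuousOn_of_continuous hF
  obtain ⟨δ₀, hδ₀, hδ⟩ := Metric.uniformContinuousOn_iff.mp hU (κ / 2) (half_pos hκ)
  obtain ⟨ε, hε0, hε1, hε2, hε3⟩ : ∃ ε > 0, ε ≤ 1 ∧ ε < δ₀ ∧ ε * κ ^ 2 ≤ 8 * η := by
    refine ⟨min (min 1 (δ₀ / 2)) (8 * η / κ ^ 2), by positivity, ?_, ?_, ?_⟩
    · exact (min_le_left _ _).trans (min_le_left _ _)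
    · exact lt_of_le_of_lt ((min_le_left _ _).trans (min_le_right _ _)) (by linarith)
    · have : min (min 1 (δ₀ / 2)) (8 * η / κ ^ 2) ≤ 8 * η / κ ^ 2 := min_le_right _ _
      rwa [le_div_iff₀ (by positivity)] at this
  have hrise : ∀ x ∈ Metric.sphere (0 : E) 1,
      R x + ε * (‖g x‖ ^ 2 - κ / 2 * ‖g x‖) ≤ R (x + ε • g x) := by
    intro x hx
    have hd : ∀ t : ℝ, HasDerivAt (fun t : ℝ => R (x + t • g x))
        (inner ℝ (g (x + t • g x)) (g x)) t := by
      intro t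
      have h2 : HasDerivAt (fun s : ℝ => x + s • g x) (g x) t := by
        simpa using ((hasDerivAt_id t).smul_const (g x)).const_add x
      exact (hg _ (hne x hx t)).comp_hasDerivAt t h2
    obtain ⟨t, ht, htε⟩ := exists_hasDerivAt_eq_slope (fun t : ℝ => R (x + t • g x)) _ hε0
      (fun t _ => (hd t).continuousAt.continuousWithinAt) (fun t _ => hd t)
    have h3 : ‖g (x + t • g x) - g x‖ ≤ κ / 2 := by
      have := hδ (x, t) ⟨hx, ht.1.le, ht.2.le.trans hε1⟩ (x, 0) ⟨hx, by simp⟩ (by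
        rw [Prod.dist_eq, dist_self, Real.dist_eq, sub_zero, abs_of_pos ht.1]
        exact max_lt hδ₀ (ht.2.trans hε2))
      simp only [zero_smul, add_zero, dist_eq_norm] at this
      exact this.le
    have h4 : ‖g x‖ ^ 2 - κ / 2 * ‖g x‖ ≤ inner ℝ (g (x + t • g x)) (g x) := by
      have h5 : inner ℝ (g (x + t • g x)) (g x) = ‖g x‖ ^ 2 + inner ℝ (g (x + t • g x) - g x) (g x) := by
        rw [inner_sub_left, real_inner_self_eq_norm_sq]; ring
      have h6 := (abs_le.mp (abs_real_inner_le_norm (g (x + t • g x) - g x) (g x))).1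
      have := mul_le_mul_of_nonneg_right h3 (norm_nonneg (g x))
      rw [h5]; linarith
    rw [htε, zero_smul, add_zero, sub_zero, le_div_iff₀ hε0] at h4
    linarith
  refine ⟨fun x => ‖x + ε • g x‖⁻¹ • (x + ε • g x), ε * κ ^ 2 / 2, by positivity, ?_, ?_, ?_, ?_⟩
  · have h1 : ContinuousOn (fun x => x + ε • g x) (Metric.sphere 0 1) :=
      continuousOn_id.add (hgS.const_smul ε)
    exact (h1.norm.inv₀ fun x hx => norm_ne_zero_iff.mpr (hne x hx ε)).smul h1
  · intro x hx
    rw [mem_sphere_zero_iff_norm, norm_smul, norm_inv, norm_norm,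
      inv_mul_cancel₀ (norm_ne_zero_iff.mpr (hne x hx ε))]
  · intro x hx
    have : -x + ε • g (-x) = -(x + ε • g x) := by
      rw [gradient_odd_of_smul_invariant hg hR (hS0 x hx), smul_neg, neg_add]
    simp only [this, norm_neg, smul_neg]
  · intro x hx hcx
    change _ ≤ R (‖x + ε • g x‖⁻¹ • (x + ε • g x))
    rw [hR _ _ (inv_ne_zero (norm_ne_zero_iff.mpr (hne x hx ε)))]
    have h1 := hrise x hx
    rcases le_or_gt (R x) (C + η) with h | h
    · refine (min_le_left _ _).trans (le_trans ?_ h1)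
      have := hgκ x hx hcx h
      have h2 : κ ^ 2 / 2 ≤ ‖g x‖ ^ 2 - κ / 2 * ‖g x‖ := by nlinarith
      have := mul_le_mul_of_nonneg_left h2 hε0.le
      linarith
    · refine (min_le_right _ _).trans (le_trans ?_ h1)
      have h2 : -(κ ^ 2 / 16) ≤ ‖g x‖ ^ 2 - κ / 2 * ‖g x‖ := by nlinarith [sq_nonneg (‖g x‖ - κ / 4)]
      have := mul_le_mul_of_nonneg_left h2 hε0.le
      linarith

/-- A minimax principle for scale-invariant functions on a Euclidean space. -/
theorem exists_critical_point_between {R : E → ℝ} {g : E → E}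
    (hg : ∀ x, x ≠ 0 → HasFDerivAt R (innerSL ℝ (g x)) x) (hgc : ContinuousOn g {0}ᶜ)
    (hR : ∀ (s : ℝ) (x : E), s ≠ 0 → R (s • x) = R x) {P Q : Submodule ℝ E}
    (hPQ : Module.finrank ℝ E < Module.finrank ℝ P + Module.finrank ℝ Q) {c C : ℝ}
    (hP : ∀ x ∈ P, x ≠ 0 → c ≤ R x) (hQ : ∀ x ∈ Q, x ≠ 0 → R x ≤ C) :
    ∃ x, x ≠ 0 ∧ g x = 0 ∧ c ≤ R x ∧ R x ≤ C := by
  by_contra! hno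
  have hS0 : ∀ x ∈ Metric.sphere (0 : E) 1, x ≠ 0 := fun x hx => by
    rintro rfl; simp at hx
  have hRc : ContinuousOn R (Metric.sphere 0 1) := fun x hx =>
    (hg x (hS0 x hx)).continuousAt.continuousWithinAt
  have hdim : Module.finrank ℝ Qᗮ < Module.finrank ℝ P := by
    have := Submodule.finrank_add_finrank_orthogonal Q
    omega
  obtain ⟨m, hm, hmin⟩ : ∃ m > 0, ∀ x ∈ Metric.sphere (0 : E) 1, c ≤ R x →
      m ≤ ‖g x‖ + max 0 (R x - C) := by
    let K := Metric.sphere (0 : E) 1 ∩ R ⁻¹' (Ici c)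
    have hK : IsCompact K := by
      refine (isCompact_sphere (0 : E) 1).of_isClosed_subset ?_ inter_subset_left
      exact hRc.preimage_isClosed_of_isClosed Metric.isClosed_sphere isClosed_Ici
    rcases K.eq_empty_or_nonempty with h | h
    · refine ⟨1, one_pos, fun x hx hcx => ?_⟩
      have : x ∈ K := ⟨hx, hcx⟩
      rw [h] at this
      exact this.elim
    · have hcont : ContinuousOn (fun x => ‖g x‖ + max 0 (R x - C)) K :=
        ((hgc.mono hS0).norm.add (continuousOn_const.sup (hRc.sub continuousOn_const))).mono
          inter_subset_left
      obtain ⟨y, hy, hymin⟩ := hK.exists_isMinOn h hcont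
      refine ⟨_, ?_, fun x hx hcx => hymin ⟨hx, hcx⟩⟩
      by_contra hle
      have h1 := norm_nonneg (g y)
      have h2 := le_max_left 0 (R y - C)
      have h3 : g y = 0 := norm_eq_zero.mp (by linarith)
      have h4 := hno y (hS0 y hy.1) h3 hy.2
      have h5 := le_max_right 0 (R y - C)
      linarith
  obtain ⟨Φ, δ, hδ, hΦc, hΦm, hΦo, hΦ⟩ := exists_odd_ascent_map hg hgc hR (c := c) (C := C)
    (η := m / 2) (κ := m / 2) (by positivity) (by positivity) (by
      intro x hx h1 h2
      have := hmin x hx h1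
      have : max 0 (R x - C) ≤ m / 2 := max_le (by positivity) (by linarith)
      linarith)
  have hcC : c ≤ C + m / 2 / 2 := by
    by_contra! h
    have hpos : 0 < Module.finrank ℝ ↥(P ⊓ Q) := by
      have := Submodule.finrank_sup_add_finrank_inf_eq P Q
      have := Submodule.finrank_le (P ⊔ Q)
      omega
    have : Nontrivial ↥(P ⊓ Q) := Module.nontrivial_of_finrank_pos hpos
    obtain ⟨x, hx⟩ := exists_ne (0 : ↥(P ⊓ Q))
    have hx' : (x : E) ≠ 0 := fun h => hx (Subtype.ext h)
    have h1 := hP x x.2.1 hx'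
    have h2 := hQ x x.2.2 hx'
    linarith
  have hmaps : ∀ n : ℕ, MapsTo Φ^[n] (Metric.sphere 0 1) (Metric.sphere 0 1) := fun n => hΦm.iterate n
  have hcont : ∀ n : ℕ, ContinuousOn Φ^[n] (Metric.sphere 0 1) := by
    intro n
    induction n with
    | zero => exact continuousOn_id
    | succ n ih =>
      rw [Function.iterate_succ']
      exact hΦc.comp ih (hmaps n)
  have hodd : ∀ n : ℕ, ∀ x ∈ Metric.sphere (0 : E) 1, Φ^[n] (-x) = -Φ^[n] x := by
    intro n x hx
    induction n with
    | zero => rfl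
    | succ n ih => rw [Function.iterate_succ_apply', Function.iterate_succ_apply', ih, hΦo _ (hmaps n hx)]
  have hval : ∀ n : ℕ, ∀ x ∈ Metric.sphere (0 : E) 1, c ≤ R x →
      min (c + n * δ) (C + m / 2 / 2) ≤ R (Φ^[n] x) ∧ c ≤ R (Φ^[n] x) := by
    intro n x hx hcx
    induction n with
    | zero => simp [hcx]
    | succ n ih =>
      have h1 := hΦ _ (hmaps n hx) ih.2
      rw [← Function.iterate_succ_apply' Φ] at h1
      constructor
      · refine le_trans ?_ h1
        rcases le_total (c + n * δ) (C + m / 2 / 2) with h | h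
        · rw [min_eq_left h] at ih
          push_cast
          exact min_le_min_right _ (by linarith [ih.1])
        · rw [min_eq_right h] at ih
          refine (min_le_right _ _).trans (le_min (by linarith [ih.1]) le_rfl)
      · exact le_trans (le_min (by linarith [ih.2]) hcC) h1
  obtain ⟨n, hn⟩ : ∃ n : ℕ, C + m / 2 / 2 ≤ c + n * δ := by
    obtain ⟨n, hn⟩ := exists_nat_ge ((C + m / 2 / 2 - c) / δ)
    rw [div_le_iff₀ hδ] at hn
    exact ⟨n, by linarith⟩
  have hPS : ∀ x : P, x ∈ Metric.sphere (0 : P) 1 → (x : E) ∈ Metric.sphere (0 : E) 1 := by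
    intro x hx
    rw [mem_sphere_zero_iff_norm] at hx ⊢
    exact hx
  obtain ⟨x, hx, hx0⟩ := exists_zero_of_odd_of_finrank_lt hdim
    (fun x : P => Qᗮ.orthogonalProjectionOnto (Φ^[n] x))
    ((Qᗮ.orthogonalProjectionOnto.continuous.comp_continuousOn
      ((hcont n).comp continuous_subtype_val.continuousOn hPS)))
    (by
      intro x hx
      have := hodd n x (hPS x hx)
      rw [Submodule.coe_neg, this, map_neg])
  have hxS := hPS x hx
  have hmem : Φ^[n] x ∈ Q := by
    rw [Submodule.orthogonalProjectionOnto_eq_zero_iff, Submodule.orthogonal_orthogonal] at hx0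
    exact hx0
  have h1 := hQ _ hmem (hS0 _ (hmaps n hxS))
  have h2 := (hval n x hxS (hP x x.2 (hS0 _ hxS))).1
  rw [min_eq_right hn] at h2
  linarith

end MinimaxPrinciple

section TrigonometricModes

/-- The curve `t ↦ exp (iπkt)` in the `i`-th coordinate plane of `ℂ²`. -/
noncomputable def trigMode (k : ℤ) (i : Fin 2) (t : ℝ) : EuclideanSpace ℂ (Fin 2) :=
  EuclideanSpace.single i (Complex.exp ((Real.pi * k * t : ℝ) * Complex.I))

theorem continuous_trigMode (k : ℤ) (i : Fin 2) : Continuous (trigMode k i) := by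
  have h : (trigMode k i) = fun t => Complex.exp ((Real.pi * k * t : ℝ) * Complex.I) •
      (EuclideanSpace.single i (1 : ℂ)) := by
    funext t; ext j; simp [trigMode]
  rw [h]; fun_prop

theorem inner_trigMode (x : EuclideanSpace ℂ (Fin 2)) (k : ℤ) (i : Fin 2) (t : ℝ) :
    inner ℝ x (trigMode k i t) =
      (x i).re * Real.cos (Real.pi * k * t) + (x i).im * Real.sin (Real.pi * k * t) := by
  rw [PiLp.inner_apply, Finset.sum_eq_single i]
  · have h : trigMode k i t i = Complex.exp ((Real.pi * k * t : ℝ) * Complex.I) := by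
      simp [trigMode]
    rw [h, Complex.inner, Complex.mul_re, Complex.conj_re, Complex.conj_im,
      Complex.exp_ofReal_mul_I_re, Complex.exp_ofReal_mul_I_im]
    ring
  · intro j _ hj
    simp [trigMode, hj]
  · simp

theorem integral_inner_trigMode (k l : ℤ) (i j : Fin 2) :
    ∫ t in (0 : ℝ)..1, inner ℝ (trigMode k i t) (trigMode l j t) = if (k, i) = (l, j) then 1 else 0 := by
  by_cases hij : i = j
  · subst hij
    have h1 : ∀ t, inner ℝ (trigMode k i t) (trigMode l i t) = Real.cos ((Real.pi * (k - l)) * t) := by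
      intro t
      rw [inner_trigMode]
      simp only [trigMode, PiLp.single_apply, if_true]
      rw [Complex.exp_ofReal_mul_I_re, Complex.exp_ofReal_mul_I_im, ← Real.cos_sub]
      congr 1; ring
    simp_rw [h1]
    by_cases hkl : k = l
    · subst hkl; simp
    · have h2 : Real.pi * ((k : ℝ) - l) ≠ 0 :=
        mul_ne_zero Real.pi_ne_zero (sub_ne_zero.mpr (by exact_mod_cast hkl))
      rw [intervalIntegral.integral_comp_mul_left (fun x => Real.cos x) h2, integral_cos]
      have : Real.sin (Real.pi * ((k : ℝ) - l) * 1) = 0 := by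
        have := Real.sin_int_mul_pi (k - l)
        push_cast at this
        rw [mul_one, mul_comm]; exact this
      rw [this]; simp [hkl]
  · have h1 : ∀ t, inner ℝ (trigMode k i t) (trigMode l j t) = 0 := by
      intro t
      rw [inner_trigMode]
      simp [trigMode, Ne.symm hij]
    simp [h1, hij]

/-- The evaluation at time `t` of the trigonometric polynomial with given coefficients. -/
noncomputable def trigEval (ι : Finset ℤ) (t : ℝ) :
    EuclideanSpace ℝ (ι × Fin 2) →L[ℝ] EuclideanSpace ℂ (Fin 2) :=
  ∑ j : ι × Fin 2, (EuclideanSpace.proj j : EuclideanSpace ℝ (ι × Fin 2) →L[ℝ] ℝ).smulRight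
    (trigMode j.1 j.2 t)

theorem trigEval_apply (ι : Finset ℤ) (t : ℝ) (c : EuclideanSpace ℝ (ι × Fin 2)) :
    trigEval ι t c = ∑ j, c j • trigMode j.1 j.2 t := by
  simp [trigEval, sum_apply]

theorem continuous_trigEval (ι : Finset ℤ) : Continuous (trigEval ι) := by
  unfold trigEval
  refine continuous_finsetSum _ fun j _ => ?_
  exact (ContinuousLinearMap.smulRightL ℝ _ _ _).continuous.comp (continuous_trigMode _ _)

theorem continuous_trigEval_apply (ι : Finset ℤ) (c : EuclideanSpace ℝ (ι × Fin 2)) :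
    Continuous fun t => trigEval ι t c := (continuous_trigEval ι).clm_apply continuous_const

theorem integral_inner_trigEval_trigMode (ι : Finset ℤ) (c : EuclideanSpace ℝ (ι × Fin 2))
    (j : ι × Fin 2) : ∫ t in (0 : ℝ)..1, inner ℝ (trigEval ι t c) (trigMode j.1 j.2 t) = c j := by
  have h : ∀ t, inner ℝ (trigEval ι t c) (trigMode j.1 j.2 t) =
      ∑ l, c l * inner ℝ (trigMode l.1 l.2 t) (trigMode j.1 j.2 t) := by
    intro t
    rw [trigEval_apply, sum_inner]
    exact Finset.sum_congr rfl fun l _ => by rw [real_inner_smul_left]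
  simp_rw [h]
  rw [intervalIntegral.integral_finsetSum]
  · simp_rw [intervalIntegral.integral_const_mul, integral_inner_trigMode]
    rw [Finset.sum_eq_single j]
    · simp
    · intro l _ hl
      rw [if_neg, mul_zero]
      rintro h
      rw [Prod.mk.injEq] at h
      exact hl (Prod.ext (Subtype.ext h.1) h.2)
    · simp
  · intro l _
    exact (((continuous_trigMode _ _).inner (continuous_trigMode _ _)).const_mul _).intervalIntegrable _ _

theorem integral_inner_trigEval_right (ι : Finset ℤ) (c : EuclideanSpace ℝ (ι × Fin 2))
    {y : ℝ → EuclideanSpace ℂ (Fin 2)} (hy : Continuous y) :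
    ∫ t in (0 : ℝ)..1, inner ℝ (y t) (trigEval ι t c) =
      ∑ j, c j * ∫ t in (0 : ℝ)..1, inner ℝ (y t) (trigMode j.1 j.2 t) := by
  simp_rw [trigEval_apply, inner_sum, real_inner_smul_right]
  rw [intervalIntegral.integral_finsetSum]
  · simp_rw [intervalIntegral.integral_const_mul]
  · intro l _
    exact ((hy.inner (continuous_trigMode _ _)).const_mul _).intervalIntegrable _ _

theorem integral_norm_sq_trigEval (ι : Finset ℤ) (c : EuclideanSpace ℝ (ι × Fin 2)) :
    ∫ t in (0 : ℝ)..1, ‖trigEval ι t c‖ ^ 2 = ‖c‖ ^ 2 := by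
  simp_rw [← real_inner_self_eq_norm_sq]
  rw [integral_inner_trigEval_right ι c (continuous_trigEval_apply ι c)]
  simp_rw [integral_inner_trigEval_trigMode]
  rw [real_inner_self_eq_norm_sq, EuclideanSpace.norm_sq_eq]
  exact Finset.sum_congr rfl fun j _ => by rw [Real.norm_eq_abs, sq_abs, sq]

/-- Multiplication of the coefficients by the frequencies `πk`. -/
noncomputable def freqMul (ι : Finset ℤ) :
    EuclideanSpace ℝ (ι × Fin 2) →L[ℝ] EuclideanSpace ℝ (ι × Fin 2) :=
  LinearMap.toContinuousLinearMap
    { toFun := fun c => WithLp.toLp 2 fun j => Real.pi * (j.1 : ℤ) * c j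
      map_add' := fun c d => by ext j; simp [mul_add]
      map_smul' := fun r c => by ext j; simp; ring }

theorem freqMul_apply (ι : Finset ℤ) (c : EuclideanSpace ℝ (ι × Fin 2)) (j : ι × Fin 2) :
    freqMul ι c j = Real.pi * (j.1 : ℤ) * c j := rfl

theorem inner_freqMul (ι : Finset ℤ) (c d : EuclideanSpace ℝ (ι × Fin 2)) :
    inner ℝ (freqMul ι c) d = inner ℝ c (freqMul ι d) := by
  simp only [PiLp.inner_apply, freqMul_apply]
  refine Finset.sum_congr rfl fun j _ => ?_
  simp; ring

theorem hasDerivAt_trigEval (ι : Finset ℤ) (c : EuclideanSpace ℝ (ι × Fin 2)) (t : ℝ) :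
    HasDerivAt (fun t => trigEval ι t c) (Complex.I • trigEval ι t (freqMul ι c)) t := by
  simp_rw [trigEval_apply]
  rw [Finset.smul_sum]
  refine HasDerivAt.fun_sum fun j _ => ?_
  have h1 : HasDerivAt (fun t : ℝ => Complex.exp ((Real.pi * (j.1 : ℤ) * t : ℝ) * Complex.I))
      (Complex.exp ((Real.pi * (j.1 : ℤ) * t : ℝ) * Complex.I) *
        ((Real.pi * (j.1 : ℤ) : ℝ) * Complex.I)) t := by
    refine HasDerivAt.cexp ?_
    refine HasDerivAt.mul_const ?_ _
    have := ((hasDerivAt_id t).const_mul (Real.pi * (j.1 : ℤ))).ofReal_comp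
    simpa using this
  have h2 : ∀ t, trigMode j.1 j.2 t = Complex.exp ((Real.pi * (j.1 : ℤ) * t : ℝ) * Complex.I) •
      (EuclideanSpace.single j.2 (1 : ℂ)) := by
    intro t; ext l; simp [trigMode]
  simp_rw [h2]
  have h3 := (h1.smul_const (EuclideanSpace.single j.2 (1 : ℂ))).const_smul (c j)
  refine h3.congr_deriv ?_
  ext l
  simp only [freqMul_apply, PiLp.smul_apply, smul_eq_mul, Complex.real_smul]
  push_cast
  ring

end TrigonometricModes

section GalerkinApproximation

theorem continuous_adjoint {E F : Type*} [NormedAddCommGroup E] [InnerProductSpace ℝ E]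
    [CompleteSpace E] [NormedAddCommGroup F] [InnerProductSpace ℝ F] [CompleteSpace F] :
    Continuous fun L : E →L[ℝ] F => L.adjoint := by
  let A : (E →L[ℝ] F) ≃ₗᵢ[ℝ] (F →L[ℝ] E) := ContinuousLinearMap.adjoint
  exact A.continuous

theorem hasFDerivAt_integral_comp_clm {E F : Type*} [NormedAddCommGroup E] [InnerProductSpace ℝ E]
    [FiniteDimensional ℝ E] [NormedAddCommGroup F] [InnerProductSpace ℝ F] [FiniteDimensional ℝ F]
    {h : F → ℝ} {G : F → F} (hh : ∀ x, HasFDerivAt h (innerSL ℝ (G x)) x) (hG : Continuous G)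
    {L : ℝ → E →L[ℝ] F} (hL : Continuous L) (c : E) :
    HasFDerivAt (fun c => ∫ t in (0 : ℝ)..1, h (L t c))
      (innerSL ℝ (∫ t in (0 : ℝ)..1, (L t).adjoint (G (L t c)))) c := by
  have hu : Continuous fun p : E × ℝ => (L p.2).adjoint (G (L p.2 p.1)) := by
    have h1 : Continuous fun p : E × ℝ => L p.2 := hL.comp continuous_snd
    have h2 : Continuous fun p : E × ℝ => L p.2 p.1 := h1.clm_apply continuous_fst
    have h3 : Continuous fun p : E × ℝ => (L p.2).adjoint :=
      continuous_adjoint.comp h1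
    have h4 : Continuous fun p : E × ℝ => G (L p.2 p.1) := hG.comp h2
    exact h3.clm_apply h4
  have hhc : Continuous h := continuous_iff_continuousAt.mpr fun x => (hh x).continuousAt
  have hcu : ∀ c : E, Continuous fun t => (L t).adjoint (G (L t c)) := by
    intro c
    have h3 : Continuous fun t => (L t).adjoint := continuous_adjoint.comp hL
    have h4 : Continuous fun t => G (L t c) := hG.comp (hL.clm_apply continuous_const)
    exact h3.clm_apply h4
  obtain ⟨B, hB⟩ := ((isCompact_closedBall c 1).prod
    (isCompact_Icc (a := (0 : ℝ)) (b := 1))).exists_bound_of_continuousOn hu.continuousOn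
  have h1 := intervalIntegral.hasFDerivAt_integral_of_dominated_of_fderiv_le (𝕜 := ℝ)
    (μ := MeasureTheory.volume) (a := 0) (b := 1) (bound := fun _ => B)
    (F := fun (c : E) (t : ℝ) => h (L t c))
    (F' := fun c t => innerSL ℝ ((L t).adjoint (G (L t c)))) (x₀ := c)
    (Metric.closedBall_mem_nhds c one_pos)
    (Eventually.of_forall fun d => ((hhc.comp (hL.clm_apply continuous_const))).aestronglyMeasurable)
    ((hhc.comp (hL.clm_apply continuous_const)).intervalIntegrable _ _)
    (((innerSL ℝ).continuous.comp (hcu c)).aestronglyMeasurable)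
    (Eventually.of_forall fun t ht d hd => by
      rw [innerSL_apply_norm]
      rw [uIoc_of_le zero_le_one] at ht
      exact hB (d, t) ⟨hd, ht.1.le, ht.2⟩)
    (by simp)
    (Eventually.of_forall fun t ht d hd => by
      have := (hh (L t d)).comp d (L t).hasFDerivAt
      refine this.congr_fderiv ?_
      ext v
      simp [ContinuousLinearMap.adjoint_inner_left])
  refine h1.congr_fderiv ?_
  rw [ContinuousLinearMap.intervalIntegral_comp_comm]
  exact (hcu c).intervalIntegrable _ _

theorem exists_trigEval_critical {h : EuclideanSpace ℂ (Fin 2) → ℝ}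
    {G : EuclideanSpace ℂ (Fin 2) → EuclideanSpace ℂ (Fin 2)}
    (hh : ∀ x, HasFDerivAt h (innerSL ℝ (G x)) x) (hG : Continuous G)
    (hhom : ∀ (s : ℝ) x, h (s • x) = s ^ 2 * h x) (hGhom : ∀ (s : ℝ) x, G (s • x) = s • G x)
    {a b : ℝ} (ha : 0 < a) (hb : 0 < b)
    (hah : ∀ x, a * ‖x‖ ^ 2 ≤ h x) (hbh : ∀ x, h x ≤ b * ‖x‖ ^ 2) {m : ℕ} {ι : Finset ℤ}
    (hm : (m : ℤ) ∈ ι) :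
    ∃ (lam : ℝ) (c : EuclideanSpace ℝ (ι × Fin 2)), Real.pi * m / (2 * b) ≤ lam ∧
      lam ≤ Real.pi * m / (2 * a) ∧ ‖c‖ = 1 ∧ ∀ j : ι × Fin 2,
        freqMul ι c j = lam * ∫ t in (0 : ℝ)..1, inner ℝ (G (trigEval ι t c)) (trigMode j.1 j.2 t) := by
  have hhc : Continuous h := continuous_iff_continuousAt.mpr fun x => (hh x).continuousAt
  let D := freqMul ι
  let f : EuclideanSpace ℝ (ι × Fin 2) → ℝ := fun c => inner ℝ (D c) c / 2
  let H : EuclideanSpace ℝ (ι × Fin 2) → ℝ := fun c => ∫ t in (0 : ℝ)..1, h (trigEval ι t c)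
  let gH : EuclideanSpace ℝ (ι × Fin 2) → EuclideanSpace ℝ (ι × Fin 2) := fun c => ∫ t in (0 : ℝ)..1, (trigEval ι t).adjoint (G (trigEval ι t c))
  have hint : ∀ c, IntervalIntegrable (fun t => h (trigEval ι t c)) MeasureTheory.volume 0 1 :=
    fun c => (hhc.comp (continuous_trigEval_apply ι c)).intervalIntegrable _ _
  have hint2 : ∀ (s : ℝ) c, IntervalIntegrable (fun t => s * ‖trigEval ι t c‖ ^ 2)
      MeasureTheory.volume 0 1 :=
    fun s c => (((continuous_trigEval_apply ι c).norm.pow 2).const_mul s).intervalIntegrable _ _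
  have hHa : ∀ c, a * ‖c‖ ^ 2 ≤ H c := by
    intro c
    rw [← integral_norm_sq_trigEval, ← intervalIntegral.integral_const_mul]
    exact intervalIntegral.integral_mono_on zero_le_one (hint2 a c) (hint c) fun t _ => hah _
  have hHb : ∀ c, H c ≤ b * ‖c‖ ^ 2 := by
    intro c
    rw [← integral_norm_sq_trigEval, ← intervalIntegral.integral_const_mul]
    exact intervalIntegral.integral_mono_on zero_le_one (hint c) (hint2 b c) fun t _ => hbh _
  have hHpos : ∀ c, c ≠ 0 → 0 < H c := fun c hc =>
    lt_of_lt_of_le (mul_pos ha (pow_pos (norm_pos_iff.mpr hc) 2)) (hHa c)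
  have hHd : ∀ c, HasFDerivAt H (innerSL ℝ (gH c)) c := fun c =>
    hasFDerivAt_integral_comp_clm hh hG (continuous_trigEval ι) c
  have hgHc : Continuous gH := by
    have h1 : Continuous fun p : EuclideanSpace ℝ (ι × Fin 2) × ℝ => trigEval ι p.2 := (continuous_trigEval ι).comp continuous_snd
    have h2 : Continuous fun p : EuclideanSpace ℝ (ι × Fin 2) × ℝ => trigEval ι p.2 p.1 := h1.clm_apply continuous_fst
    have h3 : Continuous fun p : EuclideanSpace ℝ (ι × Fin 2) × ℝ => (trigEval ι p.2).adjoint :=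
      continuous_adjoint.comp h1
    exact intervalIntegral.continuous_parametric_intervalIntegral_of_continuous'
      (h3.clm_apply (hG.comp h2)) 0 1
  have hfd : ∀ c, HasFDerivAt f (innerSL ℝ (D c)) c := by
    intro c
    have h1 := (D.hasFDerivAt (x := c)).inner ℝ (hasFDerivAt_id c)
    have h2 := h1.mul_const (1 / 2)
    have h3 : f = fun c => inner ℝ (D c) (id c) * (1 / 2) := by
      funext c; simp [f]; ring
    rw [h3]
    refine h2.congr_fderiv ?_
    ext v
    simp only [smul_apply, innerSL_apply_apply, smul_eq_mul, ContinuousLinearMap.comp_apply,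
      fderivInnerCLM_apply, ContinuousLinearMap.prod_apply, ContinuousLinearMap.id_apply, id]
    rw [show inner ℝ (D v) c = inner ℝ (D c) v by rw [real_inner_comm, ← inner_freqMul]]
    ring
  let R : EuclideanSpace ℝ (ι × Fin 2) → ℝ := fun c => f c / H c
  let g : EuclideanSpace ℝ (ι × Fin 2) → EuclideanSpace ℝ (ι × Fin 2) := fun c => (H c)⁻¹ • (D c - R c • gH c)
  have hgd : ∀ c, c ≠ 0 → HasFDerivAt R (innerSL ℝ (g c)) c := by
    intro c hc
    have hne := (hHpos c hc).ne'
    refine ((hfd c).mul ((hasDerivAt_inv hne).comp_hasFDerivAt c (hHd c))).congr_fderiv ?_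
    ext v
    simp only [g, R, smul_apply, add_apply, innerSL_apply_apply, real_inner_smul_left, inner_sub_left,
      smul_eq_mul, Function.comp_apply]
    field_simp
    ring
  have hgc : ContinuousOn g {0}ᶜ := by
    have hfc : Continuous f := continuous_iff_continuousAt.mpr fun c => (hfd c).continuousAt
    have hHc : Continuous H := continuous_iff_continuousAt.mpr fun c => (hHd c).continuousAt
    have hRc : ContinuousOn R {0}ᶜ := hfc.continuousOn.div hHc.continuousOn fun c hc => (hHpos c hc).ne'
    exact (hHc.continuousOn.inv₀ fun c hc => (hHpos c hc).ne').smul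
      (D.continuous.continuousOn.sub (hRc.smul hgHc.continuousOn))
  have hR : ∀ (s : ℝ) (c : EuclideanSpace ℝ (ι × Fin 2)), s ≠ 0 → R (s • c) = R c := by
    intro s c hs
    have h1 : f (s • c) = s ^ 2 * f c := by
      simp only [f, map_smul, real_inner_smul_left, real_inner_smul_right]; ring
    have h2 : H (s • c) = s ^ 2 * H c := by
      simp only [H, map_smul, hhom, intervalIntegral.integral_const_mul]
    simp only [R, h1, h2]
    rw [mul_div_mul_left _ _ (pow_ne_zero 2 hs)]
  have hfsum : ∀ c : EuclideanSpace ℝ (ι × Fin 2), f c = ∑ j, Real.pi * (j.1 : ℤ) * c j ^ 2 / 2 := by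
    intro c
    simp only [f, PiLp.inner_apply, D, freqMul_apply]
    rw [Finset.sum_div]
    refine Finset.sum_congr rfl fun j _ => ?_
    simp; ring
  have hnsum : ∀ c : EuclideanSpace ℝ (ι × Fin 2), ‖c‖ ^ 2 = ∑ j, c j ^ 2 := by
    intro c; rw [EuclideanSpace.norm_sq_eq]; simp
  let P : Submodule ℝ (EuclideanSpace ℝ (ι × Fin 2)) :=
    { carrier := {c | ∀ j : ι × Fin 2, (j.1 : ℤ) < m → c j = 0}
      add_mem' := fun {c d} hc hd j hj => by simp [hc j hj, hd j hj]
      zero_mem' := fun j _ => rfl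
      smul_mem' := fun s c hc j hj => by simp [hc j hj] }
  let Q : Submodule ℝ (EuclideanSpace ℝ (ι × Fin 2)) :=
    { carrier := {c | ∀ j : ι × Fin 2, (m : ℤ) < j.1 → c j = 0}
      add_mem' := fun {c d} hc hd j hj => by simp [hc j hj, hd j hj]
      zero_mem' := fun j _ => rfl
      smul_mem' := fun s c hc j hj => by simp [hc j hj] }
  have hPQ : Module.finrank ℝ (EuclideanSpace ℝ (ι × Fin 2)) < Module.finrank ℝ P + Module.finrank ℝ Q := by
    have hsup : P ⊔ Q = ⊤ := by
      rw [eq_top_iff]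
      rintro c -
      rw [Submodule.mem_sup]
      refine ⟨WithLp.toLp 2 fun j => if (j.1 : ℤ) < m then 0 else c j, fun j hj => by simp [hj],
        WithLp.toLp 2 fun j => if (j.1 : ℤ) < m then c j else 0, fun j hj => by simp [not_lt.mpr hj.le], ?_⟩
      ext j
      by_cases hj : (j.1 : ℤ) < m <;> simp [hj]
    have hinf : 0 < Module.finrank ℝ ↥(P ⊓ Q) := by
      have hmem : (EuclideanSpace.single (⟨m, hm⟩, 0) 1 : EuclideanSpace ℝ (ι × Fin 2)) ∈ P ⊓ Q := by
        constructor <;> intro j hj <;>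
        · rw [PiLp.single_apply, if_neg]
          rintro rfl
          exact lt_irrefl _ hj
      have : Nontrivial ↥(P ⊓ Q) := by
        refine ⟨⟨_, hmem⟩, 0, fun h => ?_⟩
        have := congrArg (fun x : ↥(P ⊓ Q) => (x : EuclideanSpace ℝ (ι × Fin 2)) (⟨m, hm⟩, 0)) h
        simp at this
      exact Module.finrank_pos
    have := Submodule.finrank_sup_add_finrank_inf_eq P Q
    rw [hsup, finrank_top] at this
    omega
  have hpi := Real.pi_pos
  have hm0 : (0 : ℝ) ≤ m := Nat.cast_nonneg m
  obtain ⟨c, hc0, hgc0, hc1, hc2⟩ := exists_critical_point_between hgd hgc hR hPQ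
    (c := Real.pi * m / (2 * b)) (C := Real.pi * m / (2 * a))
    (by
      intro c hc hc0
      rw [le_div_iff₀ (hHpos c hc0)]
      have h1 : Real.pi * m / 2 * ‖c‖ ^ 2 ≤ f c := by
        rw [hfsum, hnsum, Finset.mul_sum]
        refine Finset.sum_le_sum fun j _ => ?_
        by_cases hj : (j.1 : ℤ) < m
        · rw [hc j hj]; simp
        · have : (m : ℝ) ≤ ((j.1 : ℤ) : ℝ) := by exact_mod_cast not_lt.mp hj
          have := mul_le_mul_of_nonneg_left this (mul_nonneg hpi.le (sq_nonneg (c j)))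
          linarith
      refine le_trans (mul_le_mul_of_nonneg_left (hHb c) (by positivity)) (le_trans (le_of_eq ?_) h1)
      field_simp)
    (by
      intro c hc hc0
      rw [div_le_iff₀ (hHpos c hc0)]
      have h1 : f c ≤ Real.pi * m / 2 * ‖c‖ ^ 2 := by
        rw [hfsum, hnsum, Finset.mul_sum]
        refine Finset.sum_le_sum fun j _ => ?_
        by_cases hj : (m : ℤ) < j.1
        · rw [hc j hj]; simp
        · have : ((j.1 : ℤ) : ℝ) ≤ (m : ℝ) := by exact_mod_cast not_lt.mp hj
          have := mul_le_mul_of_nonneg_left this (mul_nonneg hpi.le (sq_nonneg (c j)))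
          linarith
      refine le_trans h1 (le_trans (le_of_eq ?_) (mul_le_mul_of_nonneg_left (hHa c) (by positivity)))
      field_simp)
  have hcrit : D c = R c • gH c := by
    have := (smul_eq_zero.mp hgc0).resolve_left (inv_ne_zero (hHpos c hc0).ne')
    exact sub_eq_zero.mp this
  have hsingle : ∀ (j : ι × Fin 2) t, trigEval ι t (EuclideanSpace.single j 1) = trigMode j.1 j.2 t := by
    intro j t
    rw [trigEval_apply, Finset.sum_eq_single j]
    · simp
    · intro l _ hl; simp [hl]
    · simp
  have hcomp : ∀ j, gH c j = ∫ t in (0 : ℝ)..1, inner ℝ (G (trigEval ι t c)) (trigMode j.1 j.2 t) := by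
    intro j
    have h1 : gH c j = inner ℝ (gH c) (EuclideanSpace.single j 1) := by
      rw [EuclideanSpace.inner_single_right]; simp
    have hu : Continuous fun t => (trigEval ι t).adjoint (G (trigEval ι t c)) := by
      have h3 : Continuous fun t => (trigEval ι t).adjoint :=
        continuous_adjoint.comp
          (continuous_trigEval ι)
      exact h3.clm_apply (hG.comp (continuous_trigEval_apply ι c))
    have h2 := (innerSL ℝ (EuclideanSpace.single j (1 : ℝ) : EuclideanSpace ℝ (ι × Fin 2))).intervalIntegral_comp_comm
      (hu.intervalIntegrable (μ := MeasureTheory.volume) 0 1)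
    rw [h1, real_inner_comm]
    refine h2.symm.trans (intervalIntegral.integral_congr fun t _ => ?_)
    simp only [innerSL_apply_apply]
    rw [ContinuousLinearMap.adjoint_inner_right, hsingle, real_inner_comm]
  have hn : ‖c‖⁻¹ ≠ 0 := inv_ne_zero (norm_ne_zero_iff.mpr hc0)
  refine ⟨R c, ‖c‖⁻¹ • c, hc1, hc2, norm_smul_inv_norm hc0, fun j => ?_⟩
  rw [map_smul, PiLp.smul_apply, smul_eq_mul]
  simp_rw [map_smul, hGhom, real_inner_smul_left]
  rw [intervalIntegral.integral_const_mul, ← hcomp]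
  change ‖c‖⁻¹ * D c j = _
  rw [hcrit, PiLp.smul_apply, smul_eq_mul]
  ring

end GalerkinApproximation

section Compactness

theorem norm_sub_le_sqrt_of_integral_sq_deriv_le {F : Type*} [NormedAddCommGroup F]
    [NormedSpace ℝ F] [CompleteSpace F] {x p : ℝ → F} (hx : ∀ t, HasDerivAt x (p t) t)
    (hp : Continuous p) {B : ℝ} (hB : ∫ t in (0 : ℝ)..1, ‖p t‖ ^ 2 ≤ B) {s t : ℝ} (hs : 0 ≤ s)
    (hst : s ≤ t) (ht : t ≤ 1) : ‖x t - x s‖ ≤ (B + 1) / 2 * Real.sqrt (t - s) := by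
  rcases hst.eq_or_lt with rfl | hlt
  · simp
  have hd : 0 < Real.sqrt (t - s) := Real.sqrt_pos.mpr (sub_pos.mpr hlt)
  have hdd : Real.sqrt (t - s) ^ 2 = t - s := Real.sq_sqrt (sub_pos.mpr hlt).le
  set d := Real.sqrt (t - s)
  rw [← intervalIntegral.integral_eq_sub_of_hasDerivAt (fun u _ => hx u) (hp.intervalIntegrable _ _)]
  have hcont : Continuous fun u => d / 2 * ‖p u‖ ^ 2 := (hp.norm.pow 2).const_mul _
  have h1 : ‖∫ u in s..t, p u‖ ≤ ∫ u in s..t, (d / 2 * ‖p u‖ ^ 2 + 1 / (2 * d)) := by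
    refine intervalIntegral.norm_integral_le_of_norm_le hst (Eventually.of_forall fun u _ => ?_)
      ((hcont.add continuous_const).intervalIntegrable _ _)
    have : d / 2 * ‖p u‖ ^ 2 + 1 / (2 * d) - ‖p u‖ = (d * ‖p u‖ - 1) ^ 2 / (2 * d) := by
      field_simp; ring
    have h2 : 0 ≤ (d * ‖p u‖ - 1) ^ 2 / (2 * d) := by positivity
    linarith
  refine h1.trans ?_
  rw [intervalIntegral.integral_add (hcont.intervalIntegrable _ _)
    (continuous_const.intervalIntegrable _ _), intervalIntegral.integral_const_mul,
    intervalIntegral.integral_const]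
  have h3 : ∫ u in s..t, ‖p u‖ ^ 2 ≤ ∫ u in (0 : ℝ)..1, ‖p u‖ ^ 2 :=
    intervalIntegral.integral_mono_interval hs hst ht
      (Eventually.of_forall fun u => by positivity) ((hp.norm.pow 2).intervalIntegrable _ _)
  have h4 : (t - s) • (1 / (2 * d)) = d / 2 := by
    rw [← hdd, smul_eq_mul]; field_simp
  rw [h4]
  nlinarith [mul_le_mul_of_nonneg_left (h3.trans hB) (half_pos hd).le]

theorem exists_subseq_tendsto_of_integral_sq_deriv_le {F : Type*} [NormedAddCommGroup F]
    [NormedSpace ℝ F] [FiniteDimensional ℝ F] {x p : ℕ → ℝ → F} {B : ℝ}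
    (hx : ∀ n t, HasDerivAt (x n) (p n t) t) (hp : ∀ n, Continuous (p n))
    (hB : ∀ n, ∫ t in (0 : ℝ)..1, ‖p n t‖ ^ 2 ≤ B)
    (hx1 : ∀ n, ∫ t in (0 : ℝ)..1, ‖x n t‖ ^ 2 = 1) :
    ∃ (φ : ℕ → ℕ) (z : ℝ → F) (S : ℝ), StrictMono φ ∧ Continuous z ∧
      (∀ n, ∀ t ∈ Icc (0 : ℝ) 1, ‖x n t‖ ≤ S) ∧
      ∀ t ∈ Icc (0 : ℝ) 1, Tendsto (fun n => x (φ n) t) atTop (nhds (z t)) := by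
  have : ProperSpace F := FiniteDimensional.proper ℝ F
  have : CompleteSpace F := FiniteDimensional.complete ℝ F
  have hB0 : 0 ≤ B := le_trans
    (intervalIntegral.integral_nonneg zero_le_one fun t _ => by positivity) (hB 0)
  have hxc : ∀ n, Continuous (x n) := fun n =>
    continuous_iff_continuousAt.mpr fun t => (hx n t).continuousAt
  have hmod : ∀ n, ∀ s ∈ Icc (0 : ℝ) 1, ∀ t ∈ Icc (0 : ℝ) 1,
      ‖x n t - x n s‖ ≤ (B + 1) / 2 * Real.sqrt |t - s| := by
    intro n s hs t ht
    rcases le_total s t with h | h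
    · rw [abs_of_nonneg (sub_nonneg.mpr h)]
      exact norm_sub_le_sqrt_of_integral_sq_deriv_le (hx n) (hp n) (hB n) hs.1 h ht.2
    · rw [norm_sub_rev, abs_sub_comm, abs_of_nonneg (sub_nonneg.mpr h)]
      exact norm_sub_le_sqrt_of_integral_sq_deriv_le (hx n) (hp n) (hB n) ht.1 h hs.2
  have hsup : ∀ n, ∀ t ∈ Icc (0 : ℝ) 1, ‖x n t‖ ≤ 1 + (B + 1) / 2 := by
    intro n t ht
    obtain ⟨s, hs, hs1⟩ : ∃ s ∈ Icc (0 : ℝ) 1, ‖x n s‖ ≤ 1 := by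
      by_contra! hcon
      have h1 : 0 < ∫ t in (0 : ℝ)..1, (‖x n t‖ ^ 2 - 1) := by
        refine intervalIntegral.intervalIntegral_pos_of_pos_on
          ((((hxc n).norm.pow 2).sub continuous_const).intervalIntegrable _ _) (fun u hu => ?_) one_pos
        have := hcon u ⟨hu.1.le, hu.2.le⟩
        nlinarith
      have hn := (hxc n).norm.pow 2
      simp only [Pi.pow_def] at hn
      rw [intervalIntegral.integral_sub (hn.intervalIntegrable _ _)
        (continuous_const.intervalIntegrable _ _), hx1] at h1
      simp at h1
    have h2 : Real.sqrt |t - s| ≤ 1 := by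
      rw [Real.sqrt_le_one]
      exact abs_le.mpr ⟨by linarith [ht.1, hs.2], by linarith [ht.2, hs.1]⟩
    have h3 := hmod n s hs t ht
    have h4 := norm_sub_norm_le (x n t) (x n s)
    nlinarith
  let X : ℕ → BoundedContinuousFunction (Icc (0 : ℝ) 1) F := fun n =>
    BoundedContinuousFunction.mkOfCompact ⟨fun t => x n t, (hxc n).comp continuous_subtype_val⟩
  have hcomp : IsCompact (closure (range X)) := by
    refine BoundedContinuousFunction.arzela_ascoli (Metric.closedBall 0 (1 + (B + 1) / 2))
      (isCompact_closedBall _ _) _ ?_ ?_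
    · rintro f t ⟨n, rfl⟩
      rw [mem_closedBall_zero_iff]
      exact hsup n t t.2
    · refine Metric.equicontinuous_of_continuity_modulus
        (fun d => (B + 1) / 2 * Real.sqrt d) ?_ _ ?_
      · have : Continuous fun d => (B + 1) / 2 * Real.sqrt d := Real.continuous_sqrt.const_mul _
        simpa using this.tendsto 0
      · rintro s t ⟨f, n, rfl⟩
        rw [dist_eq_norm]
        exact hmod n t t.2 s s.2
  obtain ⟨Z, -, φ, hφ, hZ⟩ := hcomp.tendsto_subseq (x := X) fun n => subset_closure ⟨n, rfl⟩
  refine ⟨φ, IccExtend zero_le_one Z, _, hφ, Z.continuous.Icc_extend', hsup, fun t ht => ?_⟩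
  rw [IccExtend_of_mem _ _ ht]
  exact (BoundedContinuousFunction.tendsto_iff_tendstoUniformly.mp hZ).tendsto_at ⟨t, ht⟩

end Compactness

section FourierUniqueness

open Real in
theorem eq_zero_of_integral_mul_cos_pow_eq_zero {χ : ℝ → ℝ} (hχ : Continuous χ)
    (h : ∀ n : ℕ, ∫ t in (0 : ℝ)..1, χ t * cos (π * t) ^ n = 0) : ∀ t ∈ Icc (0 : ℝ) 1, χ t = 0 := by
  have hpi := pi_pos
  have hcos : Continuous fun t => cos (π * t) := by fun_prop
  have hpoly : ∀ p : Polynomial ℝ, ∫ t in (0 : ℝ)..1, χ t * p.eval (cos (π * t)) = 0 := by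
    intro p
    simp_rw [Polynomial.eval_eq_sum_range, Finset.mul_sum]
    rw [intervalIntegral.integral_finsetSum]
    · refine Finset.sum_eq_zero fun n _ => ?_
      have : ∀ t, χ t * (p.coeff n * cos (π * t) ^ n) = p.coeff n * (χ t * cos (π * t) ^ n) :=
        fun t => by ring
      simp_rw [this, intervalIntegral.integral_const_mul, h n, mul_zero]
    · intro n _
      exact (hχ.mul ((hcos.pow n).const_mul _)).intervalIntegrable _ _
  have hsq : ∫ t in (0 : ℝ)..1, χ t ^ 2 ≤ 0 := by
    refine le_of_forall_pos_le_add fun ε hε => ?_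
    set I := ∫ t in (0 : ℝ)..1, |χ t|
    have hI : 0 ≤ I := intervalIntegral.integral_nonneg zero_le_one fun t _ => abs_nonneg _
    obtain ⟨p, hp⟩ := exists_polynomial_near_of_continuousOn (-1) 1 (fun y => χ (arccos y / π))
      (hχ.comp (continuous_arccos.div_const _)).continuousOn (ε / (I + 1)) (by positivity)
    have hpc : Continuous fun t => p.eval (cos (π * t)) := p.continuous.comp hcos
    have h1 : ∫ t in (0 : ℝ)..1, χ t ^ 2 =
        ∫ t in (0 : ℝ)..1, (χ t ^ 2 - χ t * p.eval (cos (π * t))) := by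
      rw [intervalIntegral.integral_sub (Continuous.intervalIntegrable (by fun_prop) _ _)
        (Continuous.intervalIntegrable (by fun_prop) _ _), hpoly, sub_zero]
    have h2 : ∫ t in (0 : ℝ)..1, (χ t ^ 2 - χ t * p.eval (cos (π * t))) ≤
        ∫ t in (0 : ℝ)..1, ε / (I + 1) * |χ t| := by
      refine intervalIntegral.integral_mono_on zero_le_one
        (((hχ.pow 2).sub (hχ.mul hpc)).intervalIntegrable _ _)
        ((hχ.abs.const_mul _).intervalIntegrable _ _) fun t ht => ?_
      have h3 := hp (cos (π * t)) ⟨neg_one_le_cos _, cos_le_one _⟩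
      rw [arccos_cos (mul_nonneg hpi.le ht.1) (by nlinarith [ht.2]), mul_div_cancel_left₀ _ hpi.ne'] at h3
      calc χ t ^ 2 - χ t * p.eval (cos (π * t)) = -(χ t * (p.eval (cos (π * t)) - χ t)) := by ring
        _ ≤ |χ t * (p.eval (cos (π * t)) - χ t)| := neg_le_abs _
        _ = |p.eval (cos (π * t)) - χ t| * |χ t| := by rw [abs_mul, mul_comm]
        _ ≤ _ := mul_le_mul_of_nonneg_right h3.le (abs_nonneg _)
    rw [intervalIntegral.integral_const_mul] at h2
    have h4 : ε / (I + 1) * I ≤ ε := by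
      rw [div_mul_eq_mul_div, div_le_iff₀ (by positivity)]; nlinarith
    linarith
  intro t ht
  by_contra hne
  have := intervalIntegral.integral_pos (f := fun t => χ t ^ 2) one_pos (by fun_prop)
    (fun u _ => by positivity) ⟨t, ht, by positivity⟩
  linarith

open Real in
theorem eq_const_of_integral_mul_cos_eq_zero {f : ℝ → ℝ} (hf : Continuous f)
    (h : ∀ k : ℤ, k ≠ 0 → ∫ t in (0 : ℝ)..1, f t * cos (π * k * t) = 0) :
    ∃ r, ∀ t ∈ Icc (0 : ℝ) 1, f t = r := by
  refine ⟨∫ t in (0 : ℝ)..1, f t, fun t ht => ?_⟩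
  set r := ∫ t in (0 : ℝ)..1, f t
  rw [← sub_eq_zero]
  have hχ : Continuous fun t => f t - r := hf.sub continuous_const
  have key : ∀ (n : ℕ) (k : ℤ), ∫ t in (0 : ℝ)..1, (f t - r) * cos (π * t) ^ n * cos (π * k * t) = 0 := by
    intro n
    induction n with
    | zero =>
      intro k
      simp only [pow_zero, mul_one, sub_mul]
      rw [intervalIntegral.integral_sub
        (Continuous.intervalIntegrable (by fun_prop) _ _)
        (Continuous.intervalIntegrable (by fun_prop) _ _),
        intervalIntegral.integral_const_mul]
      by_cases hk : k = 0
      · subst hk; simp [r]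
      · have hk' : π * (k : ℝ) ≠ 0 := mul_ne_zero pi_ne_zero (by exact_mod_cast hk)
        rw [h k hk, intervalIntegral.integral_comp_mul_left (fun x => cos x) hk', integral_cos]
        have : sin (π * k) = 0 := by rw [mul_comm]; exact sin_int_mul_pi k
        simp [this]
    | succ n ih =>
      intro k
      have : ∀ t, (f t - r) * cos (π * t) ^ (n + 1) * cos (π * k * t) =
          1 / 2 * ((f t - r) * cos (π * t) ^ n * cos (π * (k + 1 : ℤ) * t)) +
          1 / 2 * ((f t - r) * cos (π * t) ^ n * cos (π * (k - 1 : ℤ) * t)) := by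
        intro t
        have h1 : π * (k + 1 : ℤ) * t = π * k * t + π * t := by push_cast; ring
        have h2 : π * (k - 1 : ℤ) * t = π * k * t - π * t := by push_cast; ring
        rw [h1, h2, cos_add, cos_sub]; ring
      simp_rw [this]
      rw [intervalIntegral.integral_add
        (Continuous.intervalIntegrable (by fun_prop) _ _)
        (Continuous.intervalIntegrable (by fun_prop) _ _),
        intervalIntegral.integral_const_mul, intervalIntegral.integral_const_mul, ih, ih]
      simp
  exact eq_zero_of_integral_mul_cos_pow_eq_zero hχ (fun n => by simpa using key n 0) t ht

open Real in
theorem eq_zero_of_integral_mul_sin_eq_zero {f : ℝ → ℝ} (hf : Continuous f)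
    (h : ∀ k : ℤ, ∫ t in (0 : ℝ)..1, f t * sin (π * k * t) = 0) :
    ∀ t ∈ Icc (0 : ℝ) 1, f t = 0 := by
  have key : ∀ (n : ℕ) (k : ℤ), ∫ t in (0 : ℝ)..1, f t * cos (π * t) ^ n * sin (π * k * t) = 0 := by
    intro n
    induction n with
    | zero =>
      intro k
      simpa using h k
    | succ n ih =>
      intro k
      have : ∀ t, f t * cos (π * t) ^ (n + 1) * sin (π * k * t) =
          1 / 2 * (f t * cos (π * t) ^ n * sin (π * (k + 1 : ℤ) * t)) +
          1 / 2 * (f t * cos (π * t) ^ n * sin (π * (k - 1 : ℤ) * t)) := by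
        intro t
        have h1 : π * (k + 1 : ℤ) * t = π * k * t + π * t := by push_cast; ring
        have h2 : π * (k - 1 : ℤ) * t = π * k * t - π * t := by push_cast; ring
        rw [h1, h2, sin_add, sin_sub]; ring
      simp_rw [this]
      rw [intervalIntegral.integral_add
        (Continuous.intervalIntegrable (by fun_prop) _ _)
        (Continuous.intervalIntegrable (by fun_prop) _ _),
        intervalIntegral.integral_const_mul, intervalIntegral.integral_const_mul, ih, ih]
      simp
  have hprod := eq_zero_of_integral_mul_cos_pow_eq_zero (χ := fun t => f t * sin (π * t))
    (hf.mul (by fun_prop)) fun n => by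
      refine Eq.trans ?_ (key n 1)
      simp only [Int.cast_one, mul_one]
      exact intervalIntegral.integral_congr fun t _ => by ring
  have hclosed : IsClosed {t | f t = 0} := isClosed_eq hf continuous_const
  have hsub : Ioo (0 : ℝ) 1 ⊆ {t | f t = 0} := fun t ht => by
    refine (mul_eq_zero.mp (hprod t ⟨ht.1.le, ht.2.le⟩)).resolve_right (ne_of_gt ?_)
    exact sin_pos_of_pos_of_lt_pi (mul_pos pi_pos ht.1) (by nlinarith [pi_pos, ht.2])
  have := closure_minimal hsub hclosed
  rw [closure_Ioo zero_ne_one] at this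
  exact this

open Real in
theorem eq_integral_of_trig_moments {f g f' g' : ℝ → ℝ} (hf : Continuous f) (hf' : Continuous f')
    (hg : Continuous g) (hg' : Continuous g') {lam : ℝ}
    (h : ∀ k : ℤ, π * k * (∫ t in (0 : ℝ)..1, (f t * cos (π * k * t) + f' t * sin (π * k * t))) =
      lam * ∫ t in (0 : ℝ)..1, (g t * cos (π * k * t) + g' t * sin (π * k * t))) :
    ∃ r, (∀ t ∈ Icc (0 : ℝ) 1, f t = r - lam * ∫ u in (0 : ℝ)..t, g' u) ∧
      (∀ t ∈ Icc (0 : ℝ) 1, f' t = lam * ∫ u in (0 : ℝ)..t, g u) ∧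
      lam * ∫ u in (0 : ℝ)..1, g u = 0 := by
  let Y : ℝ → ℝ := fun t => -(lam * ∫ u in (0 : ℝ)..t, g' u)
  let Y' : ℝ → ℝ := fun t => lam * ∫ u in (0 : ℝ)..t, g u
  have hY : ∀ t, HasDerivAt Y (-(lam * g' t)) t := fun t =>
    ((hg'.integral_hasStrictDerivAt 0 t).hasDerivAt.const_mul lam).neg
  have hY' : ∀ t, HasDerivAt Y' (lam * g t) t := fun t =>
    (hg.integral_hasStrictDerivAt 0 t).hasDerivAt.const_mul lam
  have hYc : Continuous Y := continuous_iff_continuousAt.mpr fun t => (hY t).continuousAt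
  have hYc' : Continuous Y' := continuous_iff_continuousAt.mpr fun t => (hY' t).continuousAt
  have h0 : Y' 1 = 0 := by
    have := h 0
    simp only [Int.cast_zero, mul_zero, zero_mul, cos_zero, mul_one, sin_zero, add_zero] at this
    exact this.symm
  have hparts : ∀ k : ℤ, π * k * (∫ t in (0 : ℝ)..1, (Y t * cos (π * k * t) + Y' t * sin (π * k * t))) =
      lam * ∫ t in (0 : ℝ)..1, (g t * cos (π * k * t) + g' t * sin (π * k * t)) := by
    intro k
    have hd : ∀ t, HasDerivAt (fun t => Y' t * cos (π * k * t) - Y t * sin (π * k * t))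
        (lam * (g t * cos (π * k * t) + g' t * sin (π * k * t)) -
          π * k * (Y t * cos (π * k * t) + Y' t * sin (π * k * t))) t := by
      intro t
      have hl : HasDerivAt (fun t => π * k * t) (π * k) t := by
        simpa using (hasDerivAt_id t).const_mul (π * k)
      refine (((hY' t).mul hl.cos).sub ((hY t).mul hl.sin)).congr_deriv ?_
      ring
    have := intervalIntegral.integral_eq_sub_of_hasDerivAt (a := 0) (b := 1) (fun t _ => hd t)
      (Continuous.intervalIntegrable (by fun_prop) _ _)
    rw [intervalIntegral.integral_sub (Continuous.intervalIntegrable (by fun_prop) _ _)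
      (Continuous.intervalIntegrable (by fun_prop) _ _), intervalIntegral.integral_const_mul,
      intervalIntegral.integral_const_mul, h0] at this
    have hs : sin (π * k) = 0 := by rw [mul_comm]; exact sin_int_mul_pi k
    have hY0 : Y' 0 = 0 := by simp [Y']
    rw [mul_one, hs, hY0, mul_zero (π * (k : ℝ)), sin_zero] at this
    linarith
  have hD : ∀ k : ℤ, k ≠ 0 → ∫ t in (0 : ℝ)..1, ((f t - Y t) * cos (π * k * t) +
      (f' t - Y' t) * sin (π * k * t)) = 0 := by
    intro k hk
    have hk' : π * (k : ℝ) ≠ 0 := mul_ne_zero pi_ne_zero (by exact_mod_cast hk)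
    have h1 := mul_left_cancel₀ hk' ((h k).trans (hparts k).symm)
    rw [← sub_eq_zero, ← intervalIntegral.integral_sub (Continuous.intervalIntegrable (by fun_prop) _ _)
      (Continuous.intervalIntegrable (by fun_prop) _ _)] at h1
    rw [← h1]
    congr 1 with t
    ring
  have hsplit : ∀ k : ℤ, k ≠ 0 → (∫ t in (0 : ℝ)..1, (f t - Y t) * cos (π * k * t)) = 0 ∧
      (∫ t in (0 : ℝ)..1, (f' t - Y' t) * sin (π * k * t)) = 0 := by
    intro k hk
    have h1 := hD k hk
    have h2 := hD (-k) (neg_ne_zero.mpr hk)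
    simp only [Int.cast_neg, mul_neg, neg_mul, cos_neg, sin_neg] at h2
    rw [intervalIntegral.integral_add (Continuous.intervalIntegrable (by fun_prop) _ _)
      (Continuous.intervalIntegrable (by fun_prop) _ _)] at h1 h2
    rw [intervalIntegral.integral_neg] at h2
    constructor <;> linarith
  obtain ⟨r, hr⟩ := eq_const_of_integral_mul_cos_eq_zero (hf.sub hYc) fun k hk => (hsplit k hk).1
  have hz := eq_zero_of_integral_mul_sin_eq_zero (hf'.sub hYc') fun k => by
    by_cases hk : k = 0
    · subst hk; simp
    · exact (hsplit k hk).2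
  refine ⟨r, fun t ht => ?_, fun t ht => ?_, h0⟩
  · have := hr t ht
    simp only [Pi.sub_apply, Y] at this
    linarith
  · have := hz t ht
    simp only [Pi.sub_apply, Y'] at this
    linarith

end FourierUniqueness

section HamiltonianChord

theorem gradient_smul_of_homogeneous {F : Type*} [NormedAddCommGroup F] [InnerProductSpace ℝ F]
    {h : F → ℝ} {G : F → F} (hh : ∀ x, HasFDerivAt h (innerSL ℝ (G x)) x)
    (hhom : ∀ (s : ℝ) x, h (s • x) = s ^ 2 * h x) (s : ℝ) (x : F) : G (s • x) = s • G x := by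
  have key : ∀ (s : ℝ) x, s • G (s • x) = s ^ 2 • G x := by
    intro s x
    have h1 : HasFDerivAt (fun x => h (s • x)) (innerSL ℝ (s • G (s • x))) x := by
      have h2 : HasFDerivAt (fun x : F => s • x) (s • ContinuousLinearMap.id ℝ F) x :=
        (hasFDerivAt_id x).const_smul s
      refine ((hh (s • x)).comp x h2).congr_fderiv ?_
      ext v
      simp
    have h2 : HasFDerivAt (fun x => h (s • x)) (innerSL ℝ (s ^ 2 • G x)) x := by
      simp_rw [hhom]
      refine ((hh x).const_mul (s ^ 2)).congr_fderiv ?_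
      ext v
      simp
    have h3 := h1.unique h2
    refine ext_inner_right ℝ fun v => ?_
    have h4 := congrArg (fun L => L v) h3
    simpa only [innerSL_apply_apply] using h4
  by_cases hs : s = 0
  · have := key 2 0
    rw [smul_zero] at this
    have h0 : G 0 = 0 := by
      have h1 : ((2 : ℝ) ^ 2 - 2) • G 0 = 0 := by rw [sub_smul, ← this, sub_self]
      exact (smul_eq_zero.mp h1).resolve_left (by norm_num)
    simp [hs, h0]
  · have := key s x
    rw [sq, mul_smul] at this
    exact smul_right_injective F hs this

theorem inner_I_smul_self (x : EuclideanSpace ℂ (Fin 2)) : inner ℝ x (Complex.I • x) = (0 : ℝ) := by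
  rw [PiLp.inner_apply]
  refine Finset.sum_eq_zero fun i _ => ?_
  simp [Complex.inner]
  ring

theorem norm_I_smul (x : EuclideanSpace ℂ (Fin 2)) : ‖Complex.I • x‖ = ‖x‖ := by
  rw [norm_smul, Complex.norm_I, one_mul]

/-- Galerkin approximations of the boundary value problem. -/
theorem exists_galerkin_approximation {h : EuclideanSpace ℂ (Fin 2) → ℝ}
    {G : EuclideanSpace ℂ (Fin 2) → EuclideanSpace ℂ (Fin 2)}
    (hh : ∀ x, HasFDerivAt h (innerSL ℝ (G x)) x) (hG : Continuous G)
    (hhom : ∀ (s : ℝ) x, h (s • x) = s ^ 2 * h x)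
    {a b M : ℝ} (ha : 0 < a) (hb : 0 < b)
    (hah : ∀ x, a * ‖x‖ ^ 2 ≤ h x) (hbh : ∀ x, h x ≤ b * ‖x‖ ^ 2) (hM : ∀ x, ‖G x‖ ≤ M * ‖x‖)
    (m : ℕ) (N : ℕ) :
    ∃ (lam : ℝ) (x p : ℝ → EuclideanSpace ℂ (Fin 2)), Real.pi * m / (2 * b) ≤ lam ∧
      lam ≤ Real.pi * m / (2 * a) ∧ (∀ t, HasDerivAt x (p t) t) ∧ Continuous p ∧
      ∫ t in (0 : ℝ)..1, ‖x t‖ ^ 2 = 1 ∧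
      ∫ t in (0 : ℝ)..1, ‖p t‖ ^ 2 ≤ (Real.pi * m / (2 * a) * M) ^ 2 ∧
      ∀ k : ℤ, |k| ≤ N → ∀ i, Real.pi * k * (∫ t in (0 : ℝ)..1, inner ℝ (x t) (trigMode k i t)) =
        lam * ∫ t in (0 : ℝ)..1, inner ℝ (G (x t)) (trigMode k i t) := by
  let ι : Finset ℤ := Finset.Icc (-(m + N : ℤ)) (m + N)
  obtain ⟨lam, c, h1, h2, hc, heq⟩ := exists_trigEval_critical hh hG hhom
    (gradient_smul_of_homogeneous hh hhom) ha hb hah hbh (m := m) (ι := ι)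
    (by simp only [ι, Finset.mem_Icc]; omega)
  have hlam : 0 ≤ lam := le_trans (by have := Real.pi_pos; positivity) h1
  have hxc := continuous_trigEval_apply ι c
  have hx1 : ∫ t in (0 : ℝ)..1, ‖trigEval ι t c‖ ^ 2 = 1 := by
    rw [integral_norm_sq_trigEval, hc, one_pow]
  have hM0 : 0 ≤ M := by
    have h3 := hM (EuclideanSpace.single 0 1)
    rw [PiLp.norm_single, norm_one, mul_one] at h3
    exact (norm_nonneg _).trans h3
  refine ⟨lam, fun t => trigEval ι t c, fun t => Complex.I • trigEval ι t (freqMul ι c), h1, h2,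
    hasDerivAt_trigEval ι c, (continuous_trigEval_apply ι _).fun_const_smul _, hx1, ?_, ?_⟩
  · simp_rw [norm_I_smul]
    rw [integral_norm_sq_trigEval]
    set d := freqMul ι c
    have hdc := continuous_trigEval_apply ι d
    have hGc : Continuous fun t => G (trigEval ι t c) := hG.comp hxc
    have h3 : ‖d‖ ^ 2 = lam * ∫ t in (0 : ℝ)..1, inner ℝ (G (trigEval ι t c)) (trigEval ι t d) := by
      rw [integral_inner_trigEval_right ι d hGc, EuclideanSpace.norm_sq_eq, Finset.mul_sum]
      refine Finset.sum_congr rfl fun j _ => ?_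
      rw [Real.norm_eq_abs, sq_abs, sq]
      nth_rewrite 2 [heq j]
      ring
    have h4 : lam * (∫ t in (0 : ℝ)..1, inner ℝ (G (trigEval ι t c)) (trigEval ι t d)) ≤
        ∫ t in (0 : ℝ)..1, ((lam * M) ^ 2 / 2 * ‖trigEval ι t c‖ ^ 2 + 1 / 2 * ‖trigEval ι t d‖ ^ 2) := by
      rw [← intervalIntegral.integral_const_mul]
      refine intervalIntegral.integral_mono_on zero_le_one ?_ ?_ fun t _ => ?_
      · exact Continuous.intervalIntegrable (((hG.comp hxc).inner hdc).const_mul _) _ _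
      · exact Continuous.intervalIntegrable (by fun_prop) _ _
      · have h5 := real_inner_le_norm (G (trigEval ι t c)) (trigEval ι t d)
        have h6 := mul_le_mul_of_nonneg_right (hM (trigEval ι t c)) (norm_nonneg (trigEval ι t d))
        have h7 := mul_le_mul_of_nonneg_left (h5.trans h6) hlam
        nlinarith [sq_nonneg (lam * M * ‖trigEval ι t c‖ - ‖trigEval ι t d‖)]
    rw [intervalIntegral.integral_add (Continuous.intervalIntegrable (by fun_prop) _ _)
      (Continuous.intervalIntegrable (by fun_prop) _ _), intervalIntegral.integral_const_mul,
      intervalIntegral.integral_const_mul, hx1, integral_norm_sq_trigEval, ← h3] at h4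
    have h5 : (lam * M) ^ 2 ≤ (Real.pi * m / (2 * a) * M) ^ 2 :=
      pow_le_pow_left₀ (mul_nonneg hlam hM0) (mul_le_mul_of_nonneg_right h2 hM0) 2
    linarith
  · intro k hk i
    have hkι : k ∈ ι := by
      simp only [ι, Finset.mem_Icc]
      have := abs_le.mp hk
      omega
    have := heq (⟨k, hkι⟩, i)
    rw [freqMul_apply, ← integral_inner_trigEval_trigMode] at this
    exact this

theorem exists_hamiltonian_chord {h : EuclideanSpace ℂ (Fin 2) → ℝ}
    {G : EuclideanSpace ℂ (Fin 2) → EuclideanSpace ℂ (Fin 2)}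
    (hh : ∀ x, HasFDerivAt h (innerSL ℝ (G x)) x) (hG : Continuous G)
    (hhom : ∀ (s : ℝ) x, h (s • x) = s ^ 2 * h x) (hpos : ∀ x, x ≠ 0 → 0 < h x) (Λ : ℝ) :
    ∃ lam ≥ Λ, ∃ ζ : ℝ → EuclideanSpace ℂ (Fin 2), Continuous ζ ∧
      (∀ t ∈ Icc (0 : ℝ) 1, h (ζ t) = 1 ∧ HasDerivAt ζ (Complex.I • lam • G (ζ t)) t) ∧
      (∀ i, (ζ 0 i).im = 0) ∧ ∀ i, (ζ 1 i).im = 0 := by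
  have hGhom := gradient_smul_of_homogeneous hh hhom
  have hhc : Continuous h := continuous_iff_continuousAt.mpr fun x => (hh x).continuousAt
  have hsph : IsCompact (Metric.sphere (0 : EuclideanSpace ℂ (Fin 2)) 1) := isCompact_sphere _ _
  have hne : (Metric.sphere (0 : EuclideanSpace ℂ (Fin 2)) 1).Nonempty :=
    NormedSpace.sphere_nonempty.mpr zero_le_one
  have hunit : ∀ x : EuclideanSpace ℂ (Fin 2), x ≠ 0 → ‖x‖⁻¹ • x ∈ Metric.sphere (0 : EuclideanSpace ℂ (Fin 2)) 1 :=
    fun x hx => by rw [mem_sphere_zero_iff_norm]; exact norm_smul_inv_norm hx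
  have hre : ∀ x : EuclideanSpace ℂ (Fin 2), x ≠ 0 → x = ‖x‖ • (‖x‖⁻¹ • x) := fun x hx => by
    rw [smul_smul, mul_inv_cancel₀ (norm_ne_zero_iff.mpr hx), one_smul]
  have h0 : h 0 = 0 := by simpa using hhom 0 0
  have hG0 : G 0 = 0 := by simpa using hGhom 0 0
  obtain ⟨xa, hxa, hamin⟩ := hsph.exists_isMinOn hne hhc.continuousOn
  obtain ⟨xb, hxb, hbmax⟩ := hsph.exists_isMaxOn hne hhc.continuousOn
  obtain ⟨xM, hxM, hMmax⟩ := hsph.exists_isMaxOn hne hG.norm.continuousOn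
  have hxa0 : xa ≠ 0 := by rintro rfl; simp at hxa
  have hxb0 : xb ≠ 0 := by rintro rfl; simp at hxb
  have ha := hpos xa hxa0
  have hb := hpos xb hxb0
  set a := h xa
  set b := h xb
  set M := ‖G xM‖
  have hah : ∀ x, a * ‖x‖ ^ 2 ≤ h x := by
    intro x
    by_cases hx : x = 0
    · simp [hx, h0]
    · have := hamin (hunit x hx)
      nth_rewrite 2 [hre x hx]
      rw [hhom, mul_comm]
      exact mul_le_mul_of_nonneg_left this (by positivity)
  have hbh : ∀ x, h x ≤ b * ‖x‖ ^ 2 := by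
    intro x
    by_cases hx : x = 0
    · simp [hx, h0]
    · have := hbmax (hunit x hx)
      nth_rewrite 1 [hre x hx]
      rw [hhom, mul_comm]
      exact mul_le_mul_of_nonneg_right this (by positivity)
  have hM : ∀ x, ‖G x‖ ≤ M * ‖x‖ := by
    intro x
    by_cases hx : x = 0
    · simp [hx, hG0]
    · have := hMmax (hunit x hx)
      nth_rewrite 1 [hre x hx]
      rw [hGhom, norm_smul, norm_norm, mul_comm]
      exact mul_le_mul_of_nonneg_right this (by positivity)
  obtain ⟨m, hm⟩ := exists_nat_ge (Λ * (2 * b) / Real.pi)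
  have hmΛ : Λ ≤ Real.pi * m / (2 * b) := by
    rw [div_le_iff₀ Real.pi_pos] at hm
    rw [le_div_iff₀ (by positivity)]
    linarith
  choose lam x p hlam1 hlam2 hxd hpc hx1 hpB hcoef using
    exists_galerkin_approximation hh hG hhom ha hb hah hbh hM m
  have hxc : ∀ n, Continuous (x n) := fun n =>
    continuous_iff_continuousAt.mpr fun t => (hxd n t).continuousAt
  obtain ⟨φ, z, S, hφ, hz, hS, hlim⟩ :=
    exists_subseq_tendsto_of_integral_sq_deriv_le hxd hpc hpB hx1
  obtain ⟨l, hl, ψ, hψ, hlaml⟩ := (isCompact_Icc (a := Real.pi * m / (2 * b))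
    (b := Real.pi * m / (2 * a))).tendsto_subseq (x := fun n => lam (φ n))
    fun n => ⟨hlam1 _, hlam2 _⟩
  have hlim' : ∀ t ∈ Icc (0 : ℝ) 1, Tendsto (fun n => x (φ (ψ n)) t) atTop (nhds (z t)) :=
    fun t ht => (hlim t ht).comp hψ.tendsto_atTop
  have hIoc : ∀ t, t ∈ Set.uIoc (0 : ℝ) 1 → t ∈ Icc (0 : ℝ) 1 := fun t ht => by
    rw [uIoc_of_le zero_le_one] at ht; exact ⟨ht.1.le, ht.2⟩
  have hDCT : ∀ u : EuclideanSpace ℂ (Fin 2) × ℝ → ℝ, Continuous u →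
      Tendsto (fun n => ∫ t in (0 : ℝ)..1, u (x (φ (ψ n)) t, t)) atTop
        (nhds (∫ t in (0 : ℝ)..1, u (z t, t))) := by
    intro u hu
    obtain ⟨C, hC⟩ := ((isCompact_closedBall (0 : EuclideanSpace ℂ (Fin 2)) S).prod
      (isCompact_Icc (a := (0 : ℝ)) (b := 1))).exists_bound_of_continuousOn hu.continuousOn
    refine intervalIntegral.tendsto_integral_filter_of_dominated_convergence (fun _ => C)
      (Eventually.of_forall fun n => ?_) (Eventually.of_forall fun n => Eventually.of_forall fun t ht => ?_)
      (by simp) (Eventually.of_forall fun t ht => ?_)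
    · exact (hu.comp ((hxc _).prodMk continuous_id)).aestronglyMeasurable
    · exact hC _ ⟨mem_closedBall_zero_iff.mpr (hS _ t (hIoc t ht)), hIoc t ht⟩
    · exact (hu.tendsto (z t, t)).comp ((hlim' t (hIoc t ht)).prodMk_nhds tendsto_const_nhds)
  have hz1 : ∫ t in (0 : ℝ)..1, ‖z t‖ ^ 2 = 1 := by
    have := hDCT (fun y => ‖y.1‖ ^ 2) (by fun_prop)
    simp only [hx1] at this
    exact (tendsto_nhds_unique this tendsto_const_nhds)
  have hzcoef : ∀ (k : ℤ) i, Real.pi * k * (∫ t in (0 : ℝ)..1, inner ℝ (z t) (trigMode k i t)) =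
      l * ∫ t in (0 : ℝ)..1, inner ℝ (G (z t)) (trigMode k i t) := by
    intro k i
    have hk := continuous_trigMode k i
    have h1 := (hDCT (fun y => inner ℝ y.1 (trigMode k i y.2)) (by fun_prop)).const_mul (Real.pi * k)
    have h2 := hlaml.mul (hDCT (fun y => inner ℝ (G y.1) (trigMode k i y.2)) (by fun_prop))
    refine tendsto_nhds_unique_of_eventuallyEq h1 h2 ?_
    filter_upwards [eventually_ge_atTop k.natAbs] with n hn
    have h3 : n ≤ φ (ψ n) := (hψ.id_le n).trans (hφ.id_le _)
    exact hcoef _ k (by rw [Int.abs_eq_natAbs]; exact_mod_cast hn.trans h3) i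
  have hzi : ∀ i, Continuous fun t => z t i := fun i => by fun_prop
  have hgi : ∀ i, Continuous fun t => G (z t) i := fun i => by fun_prop
  have hmom : ∀ i, ∃ r : ℝ,
      (∀ t ∈ Icc (0 : ℝ) 1, (z t i).re = r - l * ∫ u in (0 : ℝ)..t, (G (z u) i).im) ∧
      (∀ t ∈ Icc (0 : ℝ) 1, (z t i).im = l * ∫ u in (0 : ℝ)..t, (G (z u) i).re) ∧
      l * ∫ u in (0 : ℝ)..1, (G (z u) i).re = 0 := by
    intro i
    refine eq_integral_of_trig_moments (Complex.continuous_re.comp (hzi i))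
      (Complex.continuous_im.comp (hzi i)) (Complex.continuous_re.comp (hgi i))
      (Complex.continuous_im.comp (hgi i)) fun k => ?_
    have := hzcoef k i
    simp_rw [inner_trigMode] at this
    exact this
  choose r hr1 hr2 hr3 using hmom
  have hYc : Continuous fun t => Complex.I • l • G (z t) := by fun_prop
  let y : ℝ → EuclideanSpace ℂ (Fin 2) := fun t =>
    WithLp.toLp 2 (fun i => (r i : ℂ)) + ∫ u in (0 : ℝ)..t, Complex.I • l • G (z u)
  have hyd : ∀ t, HasDerivAt y (Complex.I • l • G (z t)) t := fun t =>
    (hYc.integral_hasStrictDerivAt 0 t).hasDerivAt.const_add _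
  have hyz : ∀ t ∈ Icc (0 : ℝ) 1, y t = z t := by
    intro t ht
    ext i
    have h1 : (∫ u in (0 : ℝ)..t, Complex.I • l • G (z u)) i =
        ∫ u in (0 : ℝ)..t, (Complex.I • l • G (z u)) i :=
      ((EuclideanSpace.proj i : EuclideanSpace ℂ (Fin 2) →L[ℂ] ℂ).restrictScalars ℝ).intervalIntegral_comp_comm
        (hYc.intervalIntegrable (μ := MeasureTheory.volume) 0 t) |>.symm
    have hci : Continuous fun u => (Complex.I • l • G (z u)) i := by fun_prop
    have h2 : (∫ u in (0 : ℝ)..t, (Complex.I • l • G (z u)) i).re =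
        ∫ u in (0 : ℝ)..t, ((Complex.I • l • G (z u)) i).re :=
      (Complex.reCLM.intervalIntegral_comp_comm
        (hci.intervalIntegrable (μ := MeasureTheory.volume) 0 t)).symm
    have h3 : (∫ u in (0 : ℝ)..t, (Complex.I • l • G (z u)) i).im =
        ∫ u in (0 : ℝ)..t, ((Complex.I • l • G (z u)) i).im :=
      (Complex.imCLM.intervalIntegral_comp_comm
        (hci.intervalIntegrable (μ := MeasureTheory.volume) 0 t)).symm
    have h4 : y t i = (r i : ℂ) + (∫ u in (0 : ℝ)..t, Complex.I • l • G (z u)) i := rfl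
    apply Complex.ext
    · rw [h4, h1, Complex.add_re, h2, hr1 i t ht, ← intervalIntegral.integral_const_mul,
        sub_eq_add_neg, ← intervalIntegral.integral_neg]
      simp
    · rw [h4, h1, Complex.add_im, h3, hr2 i t ht, ← intervalIntegral.integral_const_mul]
      simp
  have hyd' : ∀ t ∈ Icc (0 : ℝ) 1, HasDerivAt y (Complex.I • l • G (y t)) t := fun t ht => by
    rw [hyz t ht]; exact hyd t
  have hyc : Continuous y := continuous_iff_continuousAt.mpr fun t => (hyd t).continuousAt
  have hE : ∀ t ∈ Icc (0 : ℝ) 1, h (y t) = h (y 0) := by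
    refine constant_of_has_deriv_right_zero (hhc.comp hyc).continuousOn fun t ht => ?_
    have h1 := (hh (y t)).comp_hasDerivAt t (hyd' t ⟨ht.1, ht.2.le⟩)
    refine (h1.congr_deriv ?_).hasDerivWithinAt
    rw [innerSL_apply_apply, smul_comm, real_inner_smul_right, inner_I_smul_self, mul_zero]
  have hEpos : 0 < h (y 0) := by
    by_contra hcon
    have hz0 : ∀ t ∈ Icc (0 : ℝ) 1, z t = 0 := by
      intro t ht
      by_contra hne0
      have := hpos _ hne0
      rw [← hyz t ht, hE t ht] at this
      exact hcon this
    have : ∫ t in (0 : ℝ)..1, ‖z t‖ ^ 2 = ∫ t in (0 : ℝ)..1, (0 : ℝ) :=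
      intervalIntegral.integral_congr fun t ht => by
        rw [uIcc_of_le zero_le_one] at ht
        simp [hz0 t ht]
    rw [hz1] at this
    simp at this
  set e := h (y 0)
  refine ⟨l, hmΛ.trans hl.1, fun t => (Real.sqrt e)⁻¹ • y t, hyc.fun_const_smul _, fun t ht => ⟨?_, ?_⟩, ?_, ?_⟩
  · rw [hhom, hE t ht, inv_pow, Real.sq_sqrt hEpos.le, inv_mul_cancel₀ hEpos.ne']
  · rw [hGhom, smul_comm l, smul_comm Complex.I]
    exact (hyd' t ht).const_smul (Real.sqrt e)⁻¹
  · intro i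
    have h1 := hr2 i 0 ⟨le_rfl, zero_le_one⟩
    rw [← hyz 0 ⟨le_rfl, zero_le_one⟩, intervalIntegral.integral_same, mul_zero] at h1
    simp [h1]
  · intro i
    have h1 := hr2 i 1 ⟨zero_le_one, le_rfl⟩
    rw [← hyz 1 ⟨zero_le_one, le_rfl⟩, hr3] at h1
    simp [h1]

end HamiltonianChord

section RadialGauge

theorem zero_unique_of_deriv_pos {k k' : ℝ → ℝ} {s t : ℝ} (hst : s < t)
    (hk : ∀ u ∈ Icc s t, HasDerivAt k (k' u) u) (hpos : ∀ u ∈ Icc s t, k u = 0 → 0 < k' u)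
    (hs : k s = 0) (ht : k t = 0) : False := by
  have hle : ∀ u ∈ Icc s t, (fun _ => (0 : ℝ)) u ≤ k u :=
    fun u hu => image_le_of_deriv_right_lt_deriv_boundary' (f' := fun _ => 0) continuousOn_const
      (fun u _ => hasDerivWithinAt_const _ _ _) hs.ge
      (fun u hu => (hk u hu).continuousAt.continuousWithinAt)
      (fun u hu => (hk u ⟨hu.1, hu.2.le⟩).hasDerivWithinAt)
      (fun u hu h0 => hpos u ⟨hu.1, hu.2.le⟩ h0.symm) hu
  have htm : t ∈ Icc s t := ⟨hst.le, le_rfl⟩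
  have h1 := hk t htm
  have h2 := eventually_nhdsWithin_sign_eq_of_deriv_pos (h1.deriv.symm ▸ hpos t htm ht) ht
  have h3 : ∀ᶠ u in nhds t, SignType.sign (k u) = SignType.sign (u - t) := h2
  obtain ⟨u, hu1, hu2⟩ := ((h3.filter_mono nhdsWithin_le_nhds).and
    (Ioo_mem_nhdsLT hst)).exists
  rw [sign_neg (sub_neg.mpr hu2.2)] at hu1
  have h4 := sign_eq_neg_one_iff.mp hu1
  exact absurd (hle u ⟨hu2.1.le, hu2.2.le⟩) (not_le.mpr h4)

variable {F : Type*} [NormedAddCommGroup F] [InnerProductSpace ℝ F]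

theorem radial_zero_unique {K : F → ℝ} {g : F → F} {Ω : Set F}
    (hstar : ∀ x ∈ Ω, ∀ s ∈ Icc (0 : ℝ) 1, s • x ∈ Ω)
    (hK : ∀ x ∈ Ω, HasFDerivAt K (innerSL ℝ (g x)) x)
    (htrans : ∀ x ∈ Ω, K x = 0 → 0 < inner ℝ x (g x)) {x : F} {s t : ℝ} (hs : 0 < s)
    (hst : s < t) (htΩ : t • x ∈ Ω) (hs0 : K (s • x) = 0) (ht0 : K (t • x) = 0) : False := by
  have ht : 0 < t := hs.trans hst
  have hmem : ∀ u ∈ Icc s t, u • x ∈ Ω := fun u hu => by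
    have h1 := hstar _ htΩ (u / t) ⟨div_nonneg (hs.le.trans hu.1) ht.le, (div_le_one ht).mpr hu.2⟩
    rwa [smul_smul, div_mul_cancel₀ _ ht.ne'] at h1
  refine zero_unique_of_deriv_pos (k := fun u : ℝ => K (u • x))
    (k' := fun u => inner ℝ (g (u • x)) x) hst (fun u hu => ?_) (fun u hu h0 => ?_) hs0 ht0
  · have h1 : HasDerivAt (fun u : ℝ => u • x) ((1 : ℝ) • x) u := (hasDerivAt_id u).smul_const x
    refine ((hK _ (hmem u hu)).comp_hasDerivAt u h1).congr_deriv ?_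
    simp
  · have h1 := htrans _ (hmem u hu) h0
    rw [real_inner_smul_left, real_inner_comm] at h1
    exact pos_of_mul_pos_right h1 (hs.le.trans hu.1)

theorem hasFDerivAt_radial_root [CompleteSpace F] {K : F → ℝ} {g : F → F} {Ω : Set F} (hΩ : IsOpen Ω)
    (hK : ∀ x ∈ Ω, HasFDerivAt K (innerSL ℝ (g x)) x) (hg : ContinuousOn g Ω)
    {S : F → ℝ} {x₀ : F} (hS0 : 0 < S x₀) (hSΩ : S x₀ • x₀ ∈ Ω) (hSK : K (S x₀ • x₀) = 0)
    (hne : inner ℝ (g (S x₀ • x₀)) x₀ ≠ 0)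
    (huniq : ∀ᶠ x in nhds x₀, ∀ s > 0, s • x ∈ Ω → K (s • x) = 0 → s = S x) :
    HasFDerivAt S (-(S x₀ / inner ℝ (g (S x₀ • x₀)) x₀) • innerSL ℝ (g (S x₀ • x₀))) x₀ := by
  have hΩn := hΩ.mem_nhds hSΩ
  have hKs : HasStrictFDerivAt K (innerSL ℝ (g (S x₀ • x₀))) (S x₀ • x₀) :=
    hasStrictFDerivAt_of_hasFDerivAt_of_continuousAt
      (f' := fun x => innerSL ℝ (g x)) (Filter.mem_of_superset hΩn hK)
      ((innerSL ℝ).continuous.continuousAt.comp (hg.continuousAt hΩn))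
  have hsm : HasStrictFDerivAt (fun p : F × ℝ => p.2 • p.1)
      (S x₀ • ContinuousLinearMap.fst ℝ F ℝ + (ContinuousLinearMap.snd ℝ F ℝ).smulRight x₀)
      (x₀, S x₀) :=
    (hasStrictFDerivAt_snd (𝕜 := ℝ) (p := (x₀, S x₀))).fun_smul
      (hasStrictFDerivAt_fst (𝕜 := ℝ) (p := (x₀, S x₀)))
  have hf := HasStrictFDerivAt.comp (x₀, S x₀) (g := K) (f := fun p : F × ℝ => p.2 • p.1) hKs hsm
  have hinv : (((innerSL ℝ (g (S x₀ • x₀))).comp (S x₀ • ContinuousLinearMap.fst ℝ F ℝ +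
      (ContinuousLinearMap.snd ℝ F ℝ).smulRight x₀)).comp
      (ContinuousLinearMap.inr ℝ F ℝ)).IsInvertible := by
    refine ⟨ContinuousLinearEquiv.unitsEquivAut ℝ (Units.mk0 _ hne), ?_⟩
    ext
    simp
  have htend := hf.tendsto_implicitFunctionOfProdDomain hinv
  have hzero := hf.eventually_apply_implicitFunctionOfProdDomain hinv
  have hder := (hf.hasStrictFDerivAt_implicitFunctionOfProdDomain hinv).hasFDerivAt
  generalize hf.implicitFunctionOfProdDomain hinv = ψ at htend hzero hder
  have hev : ψ =ᶠ[nhds x₀] S := by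
    have h1 : ∀ᶠ x in nhds x₀, 0 < ψ x := htend.eventually (lt_mem_nhds hS0)
    have h2 : ∀ᶠ x in nhds x₀, ψ x • x ∈ Ω := (htend.smul tendsto_id).eventually hΩn
    filter_upwards [h1, h2, hzero, huniq] with x h1 h2 h3 h4
    exact h4 _ h1 h2 (h3.trans hSK)
  have hd := hder.congr_of_eventuallyEq hev.symm
  have hcomp : HasFDerivAt (fun x => K (S x • x)) _ x₀ :=
    HasFDerivAt.comp x₀ hKs.hasFDerivAt (hd.smul (hasFDerivAt_id x₀))
  have hconst : HasFDerivAt (fun x => K (S x • x)) (0 : F →L[ℝ] ℝ) x₀ := by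
    refine (hasFDerivAt_const (0 : ℝ) x₀).congr_of_eventuallyEq ?_
    filter_upwards [hev, hzero] with x h1 h2
    rw [← h1]
    exact h2.trans hSK
  have heq := hcomp.unique hconst
  refine hd.congr_fderiv ?_
  ext v
  have h1 := congrArg (fun L : F →L[ℝ] ℝ => L v) heq
  simp only [ContinuousLinearMap.comp_apply, add_apply, smul_apply,
    ContinuousLinearMap.smulRight_apply, ContinuousLinearMap.id_apply, innerSL_apply_apply,
    inner_add_right, inner_smul_right, zero_apply] at h1
  simp only [smul_apply, innerSL_apply_apply, smul_eq_mul]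
  field_simp
  linarith

/-- An even hypersurface which is transverse to the rays issuing from the origin and which meets
each of them is the unit level set of a positive `C¹` function homogeneous of degree two. -/
theorem exists_gauge_of_radial_transversality [FiniteDimensional ℝ F] {K : F → ℝ} {g : F → F} {Ω : Set F} (hΩ : IsOpen Ω)
    (hstar : ∀ x ∈ Ω, ∀ s ∈ Icc (0 : ℝ) 1, s • x ∈ Ω) (hneg : ∀ x ∈ Ω, -x ∈ Ω)
    (hK : ∀ x ∈ Ω, HasFDerivAt K (innerSL ℝ (g x)) x) (hg : ContinuousOn g Ω)
    (heven : ∀ x, K (-x) = K x) (htrans : ∀ x ∈ Ω, K x = 0 → 0 < inner ℝ x (g x))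
    (hex : ∀ x, x ≠ 0 → ∃ s > (0 : ℝ), s • x ∈ Ω ∧ K (s • x) = 0) :
    ∃ (h : F → ℝ) (G : F → F), (∀ x, HasFDerivAt h (innerSL ℝ (G x)) x) ∧ Continuous G ∧
      (∀ (s : ℝ) x, h (s • x) = s ^ 2 * h x) ∧ (∀ x, x ≠ 0 → 0 < h x) ∧
      ∀ x, h x = 1 → x ∈ Ω ∧ K x = 0 ∧ G x = (2 / inner ℝ x (g x)) • g x := by
  classical
  choose! S hSpos hSΩ hSK using hex
  have huniq : ∀ x, x ≠ 0 → ∀ s > 0, s • x ∈ Ω → K (s • x) = 0 → s = S x := by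
    intro x hx s hs hsΩ hs0
    rcases lt_trichotomy s (S x) with h | h | h
    · exact (radial_zero_unique hstar hK htrans hs h (hSΩ x hx) hs0 (hSK x hx)).elim
    · exact h
    · exact (radial_zero_unique hstar hK htrans (hSpos x hx) h hsΩ (hSK x hx) hs0).elim
  have hSsmul : ∀ (r : ℝ) x, r ≠ 0 → x ≠ 0 → S (r • x) = S x / |r| := by
    intro r x hr hx
    have hy : (S x / |r|) • r • x = S x • x ∨ (S x / |r|) • r • x = -(S x • x) := by
      rw [smul_smul]
      rcases abs_choice r with h | h
      · left; rw [h, div_mul_cancel₀ _ hr]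
      · right; rw [h, ← neg_smul]; congr 1; field_simp
    refine (huniq _ (smul_ne_zero hr hx) _ (div_pos (hSpos x hx) (abs_pos.mpr hr)) ?_ ?_).symm
    · rcases hy with h | h <;> rw [h]
      exacts [hSΩ x hx, hneg _ (hSΩ x hx)]
    · rcases hy with h | h <;> rw [h]
      exacts [hSK x hx, (heven _).trans (hSK x hx)]
  have hden : ∀ x, x ≠ 0 → 0 < inner ℝ (g (S x • x)) x := by
    intro x hx
    have h1 := htrans _ (hSΩ x hx) (hSK x hx)
    rw [real_inner_smul_left, real_inner_comm] at h1
    exact pos_of_mul_pos_right h1 (hSpos x hx).le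
  have hSder := fun x (hx : x ≠ 0) => hasFDerivAt_radial_root hΩ hK hg (hSpos x hx) (hSΩ x hx)
    (hSK x hx) (hden x hx).ne' ((eventually_ne_nhds hx).mono fun y hy => huniq y hy)
  let h : F → ℝ := fun x => if x = 0 then 0 else (S x ^ 2)⁻¹
  let G : F → F := fun x =>
    if x = 0 then 0 else ((S x)⁻¹ * (2 / inner ℝ (S x • x) (g (S x • x)))) • g (S x • x)
  have hh_ne : ∀ x, x ≠ 0 → h x = (S x ^ 2)⁻¹ := fun x hx => if_neg hx
  have hG_ne : ∀ x, x ≠ 0 →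
      G x = ((S x)⁻¹ * (2 / inner ℝ (S x • x) (g (S x • x)))) • g (S x • x) := fun x hx => if_neg hx
  have hhom : ∀ (s : ℝ) x, h (s • x) = s ^ 2 * h x := by
    intro s x
    by_cases hs : s = 0
    · simp [hs, h]
    by_cases hx : x = 0
    · simp [hx, h]
    rw [hh_ne _ hx, hh_ne _ (smul_ne_zero hs hx), hSsmul s x hs hx, div_pow, sq_abs, inv_div]
    rfl
  have hder_ne : ∀ x, x ≠ 0 → HasFDerivAt h (innerSL ℝ (G x)) x := by
    intro x hx
    have hS := (hSpos x hx).ne'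
    have h1 : HasDerivAt (fun s : ℝ => (s ^ 2)⁻¹) (-(2 * S x) / (S x ^ 2) ^ 2) (S x) := by
      have := (hasDerivAt_pow 2 (S x)).fun_inv (pow_ne_zero 2 hS)
      simpa using this
    have h2 := h1.comp_hasFDerivAt x (hSder x hx)
    have h3 : h =ᶠ[nhds x] (fun s : ℝ => (s ^ 2)⁻¹) ∘ S :=
      (eventually_ne_nhds hx).mono fun y hy => hh_ne y hy
    refine (h2.congr_of_eventuallyEq h3).congr_fderiv ?_
    ext v
    have hd := (hden x hx).ne'
    rw [hG_ne x hx]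
    simp only [smul_apply, innerSL_apply_apply, smul_eq_mul, real_inner_smul_left]
    rw [real_inner_comm (g (S x • x)) x]
    field_simp
  have hcont_ne : ∀ x, x ≠ 0 → ContinuousAt G x := by
    intro x hx
    have h1 : ContinuousAt S x := (hSder x hx).continuousAt
    have h2 : ContinuousAt (fun x => S x • x) x := h1.smul continuousAt_id
    have h3 : ContinuousAt (fun x => g (S x • x)) x :=
      ContinuousAt.comp (f := fun x => S x • x) (hg.continuousAt (hΩ.mem_nhds (hSΩ x hx))) h2
    have h4 : ContinuousAt
        (fun x => ((S x)⁻¹ * (2 / inner ℝ (S x • x) (g (S x • x)))) • g (S x • x)) x :=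
      ((h1.inv₀ (hSpos x hx).ne').mul (continuousAt_const.div (h2.inner h3)
        (htrans _ (hSΩ x hx) (hSK x hx)).ne')).smul h3
    exact h4.congr ((eventually_ne_nhds hx).mono fun y hy => (hG_ne y hy).symm)
  have hsph : ∀ x ∈ Metric.sphere (0 : F) 1, x ≠ 0 := fun x hx h0 => by
    simp [h0] at hx
  have hunit : ∀ x : F, x ≠ 0 → ‖x‖⁻¹ • x ∈ Metric.sphere (0 : F) 1 := fun x hx => by
    simp [norm_smul, inv_mul_cancel₀ (norm_ne_zero_iff.mpr hx)]
  have hcancel : ∀ x : F, x ≠ 0 → ‖x‖ • ‖x‖⁻¹ • x = x := fun x hx => by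
    rw [smul_smul, mul_inv_cancel₀ (norm_ne_zero_iff.mpr hx), one_smul]
  obtain ⟨C, hC⟩ := (isCompact_sphere (0 : F) 1).exists_bound_of_continuousOn (f := h)
    fun x hx => (hder_ne x (hsph x hx)).continuousAt.continuousWithinAt
  obtain ⟨C', hC'⟩ := (isCompact_sphere (0 : F) 1).exists_bound_of_continuousOn (f := G)
    fun x hx => (hcont_ne x (hsph x hx)).continuousWithinAt
  have hh : ∀ x, HasFDerivAt h (innerSL ℝ (G x)) x := by
    intro x
    by_cases hx : x = 0
    · have h1 : h =O[nhds (0 : F)] fun x => ‖x - 0‖ ^ 2 := by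
        refine Asymptotics.IsBigO.of_bound C (Eventually.of_forall fun y => ?_)
        by_cases hy : y = 0
        · simp [hy, h]
        · have h2 := hC _ (hunit y hy)
          have h3 := hhom ‖y‖ (‖y‖⁻¹ • y)
          rw [hcancel y hy] at h3
          rw [h3, norm_mul, sub_zero, mul_comm]
          gcongr
      have h2 : HasFDerivAt h (0 : F →L[ℝ] ℝ) 0 := h1.hasFDerivAt one_lt_two
      rw [hx, show G 0 = 0 from if_pos rfl, map_zero]
      exact h2
    · exact hder_ne x hx
  have hcont : Continuous G := by
    rw [continuous_iff_continuousAt]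
    intro x
    by_cases hx : x = 0
    · rw [hx, ContinuousAt, show G 0 = 0 from if_pos rfl]
      refine squeeze_zero_norm (a := fun y : F => ‖y‖ * C') (fun y => ?_) ?_
      · by_cases hy : y = 0
        · simp [hy, G]
        · have h2 := hC' _ (hunit y hy)
          have h3 := gradient_smul_of_homogeneous hh hhom ‖y‖ (‖y‖⁻¹ • y)
          rw [hcancel y hy] at h3
          rw [h3, norm_smul, norm_norm]
          gcongr
      · have : Continuous fun y : F => ‖y‖ * C' := by fun_prop
        simpa using this.tendsto 0
    · exact hcont_ne x hx
  refine ⟨h, G, hh, hcont, hhom, fun x hx => ?_, fun x hx => ?_⟩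
  · rw [hh_ne x hx]
    exact inv_pos.mpr (pow_pos (hSpos x hx) 2)
  · have hx0 : x ≠ 0 := by
      rintro rfl
      simp [h] at hx
    rw [hh_ne x hx0, inv_eq_one, pow_eq_one_iff_of_nonneg (hSpos x hx0).le two_ne_zero] at hx
    have h1 := hSΩ x hx0
    have h2 := hSK x hx0
    have h3 := hG_ne x hx0
    rw [hx, one_smul] at h1 h2
    rw [hx, one_smul, inv_one, one_mul] at h3
    exact ⟨h1, h2, h3⟩

end RadialGauge

section RadialPotential

/-- The condition on `ρ` saying that it is smaller than the distance from the secondary primary to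
the collinear critical point lying between the primaries. -/
def BelowL1 (μ ρ : ℝ) : Prop :=
  (1 - μ) * ρ ^ 3 * (1 + (1 - ρ) + (1 - ρ) ^ 2) < μ * (1 - ρ) ^ 3 * (1 + ρ + ρ ^ 2)

theorem dist_origin_bounds {ρ C D : ℝ} (hρ : 0 < ρ) (hρ1 : ρ < 1) (hC : C ∈ Icc (-1 : ℝ) 1)
    (hD : 0 < D) (hD2 : D ^ 2 = 1 + 2 * ρ * C + ρ ^ 2) : 1 - ρ ≤ D ∧ D ≤ 1 + ρ := by
  obtain ⟨h1, h2⟩ := hC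
  constructor
  · refine (pow_le_pow_iff_left₀ (by linarith) hD.le two_ne_zero).mp ?_
    nlinarith
  · refine (pow_le_pow_iff_left₀ hD.le (by linarith) two_ne_zero).mp ?_
    nlinarith

theorem radial_force_le {ρ C D : ℝ} (hρ : 0 < ρ) (hρ1 : ρ < 1) (hC : C ∈ Icc (-1 : ℝ) 1)
    (hD : 0 < D) (hD2 : D ^ 2 = 1 + 2 * ρ * C + ρ ^ 2) :
    (ρ + C) * (1 - 1 / D ^ 3) ≤ 1 / (1 - ρ) ^ 2 - (1 - ρ) := by
  obtain ⟨hdD, hDs⟩ := dist_origin_bounds hρ hρ1 hC hD hD2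
  have hd : 0 < 1 - ρ := by linarith
  have hd1 : 1 ≤ 1 / (1 - ρ) ^ 2 := by
    rw [le_div_iff₀ (by positivity)]
    nlinarith
  rcases lt_or_ge (ρ + C) 0 with hy | hy
  · have h1 : 1 / D ^ 3 ≤ 1 / (1 - ρ) ^ 3 :=
      one_div_le_one_div_of_le (by positivity) (by gcongr)
    have h2 : D ≤ 1 := by
      refine (pow_le_pow_iff_left₀ hD.le zero_le_one two_ne_zero).mp ?_
      nlinarith
    have h3 : 1 ≤ 1 / D ^ 3 := by
      rw [le_div_iff₀ (by positivity)]
      nlinarith [pow_le_one₀ hD.le h2 (n := 3)]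
    have h4 : (1 - ρ) * (1 / (1 - ρ) ^ 3 - 1) = 1 / (1 - ρ) ^ 2 - (1 - ρ) := by
      field_simp
    rw [← h4]
    have h5 : -(ρ + C) ≤ 1 - ρ := by linarith [hC.1]
    have := mul_le_mul h5 (sub_le_sub_right h1 1) (by linarith) hd.le
    linarith
  · rcases le_or_gt D 1 with h2 | h2
    · have h3 : 1 ≤ 1 / D ^ 3 := by
        rw [le_div_iff₀ (by positivity)]
        nlinarith [pow_le_one₀ hD.le h2 (n := 3)]
      nlinarith
    · have h1 : 1 / (1 + ρ) ^ 3 ≤ 1 / D ^ 3 :=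
        one_div_le_one_div_of_le (by positivity) (by gcongr)
      have h3 : 1 / D ^ 3 ≤ 1 := by
        rw [div_le_iff₀ (by positivity)]
        nlinarith [one_le_pow₀ h2.le (n := 3)]
      have h4 : (ρ + C) * (1 - 1 / D ^ 3) ≤ (1 + ρ) * (1 - 1 / (1 + ρ) ^ 3) := by
        refine mul_le_mul (by linarith [hC.2]) (by linarith) (by linarith) (by linarith)
      refine h4.trans ?_
      have h5 : (1 + ρ) * (1 - 1 / (1 + ρ) ^ 3) = 1 + ρ - 1 / (1 + ρ) ^ 2 := by
        field_simp
      rw [h5]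
      have h6 : 2 ≤ 1 / (1 - ρ) ^ 2 + 1 / (1 + ρ) ^ 2 := by
        rw [div_add_div _ _ (by positivity) (by positivity), le_div_iff₀ (by positivity)]
        nlinarith [mul_nonneg (sq_nonneg ρ) (by nlinarith : 0 ≤ 1 - ρ ^ 2)]
      linarith

theorem BelowL1.div_lt {μ ρ : ℝ} (h : BelowL1 μ ρ) (hρ : 0 < ρ) (hρ1 : ρ < 1) :
    (1 - μ) * (1 / (1 - ρ) ^ 2 - (1 - ρ)) < μ * (1 / ρ ^ 2 - ρ) := by
  have hd : 0 < 1 - ρ := by linarith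
  have h1 : (1 - μ) * (1 / (1 - ρ) ^ 2 - (1 - ρ)) =
      ((1 - μ) * ρ ^ 3 * (1 + (1 - ρ) + (1 - ρ) ^ 2)) / (ρ ^ 2 * (1 - ρ) ^ 2) := by
    field_simp
    ring
  have h2 : μ * (1 / ρ ^ 2 - ρ) =
      (μ * (1 - ρ) ^ 3 * (1 + ρ + ρ ^ 2)) / (ρ ^ 2 * (1 - ρ) ^ 2) := by
    field_simp
    ring
  rw [h1, h2]
  exact div_lt_div_of_pos_right h (by positivity)

theorem radial_slope_pos {μ ρ C D : ℝ} (hμ1 : μ < 1) (hρ : 0 < ρ) (hρ1 : ρ < 1)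
    (hL : BelowL1 μ ρ) (hC : C ∈ Icc (-1 : ℝ) 1) (hD : 0 < D)
    (hD2 : D ^ 2 = 1 + 2 * ρ * C + ρ ^ 2) :
    0 < -((1 - μ) * C + ρ) + μ / ρ ^ 2 + (1 - μ) * (ρ + C) / D ^ 3 := by
  have h1 := hL.div_lt hρ hρ1
  have h2 := mul_le_mul_of_nonneg_left (radial_force_le hρ hρ1 hC hD hD2) (by linarith : 0 ≤ 1 - μ)
  have h3 : -((1 - μ) * C + ρ) + μ / ρ ^ 2 + (1 - μ) * (ρ + C) / D ^ 3 =
    μ * (1 / ρ ^ 2 - ρ) - (1 - μ) * ((ρ + C) * (1 - 1 / D ^ 3)) := by ring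
  linarith

theorem radial_convexity_bound {ρ C D : ℝ} (hρ : 0 < ρ) (hρ1 : ρ < 1) (hC : C ∈ Icc (-1 : ℝ) 1)
    (hD : 0 < D) (hD2 : D ^ 2 = 1 + 2 * ρ * C + ρ ^ 2) :
    (1 - ρ) ^ 3 * (D ^ 2 - 3 * (ρ + C) ^ 2) * (1 + ρ + ρ ^ 2) ≤
      2 * (1 + (1 - ρ) + (1 - ρ) ^ 2) * D ^ 5 := by
  obtain ⟨hdD, hDs⟩ := dist_origin_bounds hρ hρ1 hC hD hD2
  have hd : 0 < 1 - ρ := by linarith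
  have key : ∀ k : ℝ, 0 < k → k * (1 - ρ) ≤ D →
      1 + ρ + ρ ^ 2 ≤ 2 * k ^ 3 * (1 + (1 - ρ) + (1 - ρ) ^ 2) →
      (1 - ρ) ^ 3 * (D ^ 2 - 3 * (ρ + C) ^ 2) * (1 + ρ + ρ ^ 2) ≤
        2 * (1 + (1 - ρ) + (1 - ρ) ^ 2) * D ^ 5 := by
    intro k hk hkD hk2
    have h1 : (k * (1 - ρ)) ^ 3 ≤ D ^ 3 := by gcongr
    calc (1 - ρ) ^ 3 * (D ^ 2 - 3 * (ρ + C) ^ 2) * (1 + ρ + ρ ^ 2)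
        ≤ (1 - ρ) ^ 3 * D ^ 2 * (1 + ρ + ρ ^ 2) := by
          gcongr
          nlinarith [sq_nonneg (ρ + C)]
      _ ≤ (1 - ρ) ^ 3 * D ^ 2 * (2 * k ^ 3 * (1 + (1 - ρ) + (1 - ρ) ^ 2)) := by gcongr
      _ = 2 * (1 + (1 - ρ) + (1 - ρ) ^ 2) * D ^ 2 * (k * (1 - ρ)) ^ 3 := by ring
      _ ≤ 2 * (1 + (1 - ρ) + (1 - ρ) ^ 2) * D ^ 2 * D ^ 3 := by gcongr
      _ = _ := by ring
  rcases le_or_gt ρ (4 / 5) with h | h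
  · exact key 1 one_pos (by linarith) (by nlinarith)
  rcases le_or_gt (23 / 20 * (1 - ρ)) D with h' | h'
  · exact key (23 / 20) (by norm_num) h' (by nlinarith)
  · have h1 : D ^ 2 ≤ (23 / 20 * (1 - ρ)) ^ 2 := by gcongr
    have h2 : 2 * ρ * (ρ + C) = D ^ 2 - 1 + ρ ^ 2 := by rw [hD2]; ring
    have h3 : 2 * ρ * (ρ + C) ≤ -(38 / 25 * (1 - ρ)) := by nlinarith
    have h4 : ρ + C ≤ -(19 / 25 * (1 - ρ)) := by
      by_contra! h5
      have : 2 * ρ * (19 / 25 * (1 - ρ)) ≤ 38 / 25 * (1 - ρ) := by nlinarith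
      nlinarith
    have h5 : (19 / 25 * (1 - ρ)) ^ 2 ≤ (ρ + C) ^ 2 := by
      rw [← neg_sq (ρ + C)]
      exact pow_le_pow_left₀ (by positivity) (by linarith) 2
    have h6 : D ^ 2 - 3 * (ρ + C) ^ 2 ≤ 0 := by nlinarith [sq_nonneg (1 - ρ)]
    have h7 : (1 - ρ) ^ 3 * (D ^ 2 - 3 * (ρ + C) ^ 2) * (1 + ρ + ρ ^ 2) ≤ 0 :=
      mul_nonpos_of_nonpos_of_nonneg (mul_nonpos_of_nonneg_of_nonpos (by positivity) h6)
        (by positivity)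
    exact h7.trans (by positivity)

theorem radial_second_deriv_lt {μ ρ C D : ℝ} (hμ1 : μ < 1) (hρ : 0 < ρ) (hρ1 : ρ < 1)
    (hL : BelowL1 μ ρ) (hC : C ∈ Icc (-1 : ℝ) 1) (hD : 0 < D)
    (hD2 : D ^ 2 = 1 + 2 * ρ * C + ρ ^ 2) :
    (1 - μ) * (1 / D ^ 3 - 3 * (ρ + C) ^ 2 / D ^ 5) < 2 * μ / ρ ^ 3 := by
  have hd : 0 < 1 - ρ := by linarith
  have hm : 0 < 1 - μ := by linarith
  have h1 := radial_convexity_bound hρ hρ1 hC hD hD2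
  have h2 : 1 / D ^ 3 - 3 * (ρ + C) ^ 2 / D ^ 5 = (D ^ 2 - 3 * (ρ + C) ^ 2) / D ^ 5 := by
    field_simp
  have hP : 0 < 1 + ρ + ρ ^ 2 := by positivity
  have hQ : 0 < 1 + (1 - ρ) + (1 - ρ) ^ 2 := by positivity
  have h3 : (D ^ 2 - 3 * (ρ + C) ^ 2) / D ^ 5 ≤
      2 * (1 + (1 - ρ) + (1 - ρ) ^ 2) / ((1 - ρ) ^ 3 * (1 + ρ + ρ ^ 2)) := by
    rw [div_le_div_iff₀ (by positivity) (by positivity)]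
    linarith
  have h4 : (1 - μ) * (2 * (1 + (1 - ρ) + (1 - ρ) ^ 2) / ((1 - ρ) ^ 3 * (1 + ρ + ρ ^ 2))) <
      2 * μ / ρ ^ 3 := by
    rw [mul_div_assoc', div_lt_div_iff₀ (by positivity) (by positivity)]
    have := hL
    unfold BelowL1 at this
    linarith
  rw [h2]
  exact (mul_le_mul_of_nonneg_left h3 hm.le).trans_lt h4

theorem exists_L1_dist {μ : ℝ} (hμ : μ ∈ Ioo (0 : ℝ) 1) :
    ∃ ρ₁ ∈ Ioo (0 : ℝ) 1, (1 - μ) * (1 / (1 - ρ₁) ^ 2 - (1 - ρ₁)) = μ * (1 / ρ₁ ^ 2 - ρ₁) ∧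
      ∀ ρ, 0 < ρ → ρ < ρ₁ → BelowL1 μ ρ := by
  obtain ⟨h0, h1⟩ := hμ
  let φ : ℝ → ℝ := fun ρ => μ * (1 - ρ) ^ 3 * (1 + ρ + ρ ^ 2) -
    (1 - μ) * ρ ^ 3 * (1 + (1 - ρ) + (1 - ρ) ^ 2)
  have hφ : Continuous φ := by fun_prop
  obtain ⟨ρ₁, hρ₁, hz⟩ := intermediate_value_Ioo' zero_le_one hφ.continuousOn
    (show (0 : ℝ) ∈ Ioo (φ 1) (φ 0) from by constructor <;> simp [φ] <;> linarith)
  have hd : 0 < 1 - ρ₁ := by linarith [hρ₁.2]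
  have hp := hρ₁.1
  refine ⟨ρ₁, hρ₁, ?_, fun ρ hρ hlt => ?_⟩
  · have : (1 - μ) * (1 / (1 - ρ₁) ^ 2 - (1 - ρ₁)) - μ * (1 / ρ₁ ^ 2 - ρ₁) =
      -φ ρ₁ / (ρ₁ ^ 2 * (1 - ρ₁) ^ 2) := by
      simp only [φ]
      field_simp
      ring
    rw [hz, neg_zero, zero_div] at this
    linarith
  · have e : ∀ x : ℝ, φ x = μ * ((1 - x) ^ 2 * (1 - x ^ 3)) -
        (1 - μ) * (x ^ 2 * (1 - (1 - x) ^ 3)) := fun x => by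
      simp only [φ]
      ring
    have a1 : (1 - ρ₁) ^ 2 * (1 - ρ₁ ^ 3) < (1 - ρ) ^ 2 * (1 - ρ ^ 3) := by
      have b1 : 1 - ρ₁ ^ 3 < 1 - ρ ^ 3 := by
        have : ρ ^ 3 < ρ₁ ^ 3 := by gcongr
        linarith
      have b2 : 0 ≤ 1 - ρ₁ ^ 3 := by linarith [pow_le_one₀ hp.le hρ₁.2.le (n := 3)]
      have b3 : (1 - ρ₁) ^ 2 < (1 - ρ) ^ 2 := by gcongr
      exact mul_lt_mul'' b3 b1 (by positivity) b2
    have a2 : ρ ^ 2 * (1 - (1 - ρ) ^ 3) < ρ₁ ^ 2 * (1 - (1 - ρ₁) ^ 3) := by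
      have b1 : (1 - ρ₁) ^ 3 < (1 - ρ) ^ 3 := by gcongr
      have b2 : (1 - ρ) ^ 3 ≤ 1 := pow_le_one₀ (by linarith [hρ₁.2]) (by linarith)
      have b3 : ρ ^ 2 < ρ₁ ^ 2 := by gcongr
      exact mul_lt_mul'' b3 (by linarith) (by positivity) (by linarith)
    have h2 := e ρ
    have h3 := e ρ₁
    have h4 : 0 < φ ρ := by
      have c1 := mul_lt_mul_of_pos_left a1 h0
      have c2 := mul_lt_mul_of_pos_left a2 (by linarith : 0 < 1 - μ)
      linarith
    unfold BelowL1
    simp only [φ] at h4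
    linarith

/-- The effective potential at distance `ρ` from the secondary primary, in the direction whose
angle with the axis through the primaries has cosine `C`. -/
noncomputable def radialV (μ C ρ : ℝ) : ℝ :=
  -(((1 - μ) ^ 2 + 2 * (1 - μ) * ρ * C + ρ ^ 2) / 2) - μ / ρ - (1 - μ) / √(1 + 2 * ρ * C + ρ ^ 2)

noncomputable def radialV' (μ C ρ : ℝ) : ℝ :=
  -((1 - μ) * C + ρ) + μ / ρ ^ 2 + (1 - μ) * (ρ + C) / √(1 + 2 * ρ * C + ρ ^ 2) ^ 3

noncomputable def radialV'' (μ C ρ : ℝ) : ℝ :=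
  -1 - 2 * μ / ρ ^ 3 + (1 - μ) * (1 / √(1 + 2 * ρ * C + ρ ^ 2) ^ 3 -
    3 * (ρ + C) ^ 2 / √(1 + 2 * ρ * C + ρ ^ 2) ^ 5)

theorem dist_origin_sq_pos {ρ C : ℝ} (hρ : 0 ≤ ρ) (hρ1 : ρ < 1) (hC : C ∈ Icc (-1 : ℝ) 1) :
    0 < 1 + 2 * ρ * C + ρ ^ 2 := by
  obtain ⟨h1, h2⟩ := hC
  nlinarith [pow_pos (sub_pos.mpr hρ1) 2]

theorem hasDerivAt_dist_origin {ρ C : ℝ} (h : 0 < 1 + 2 * ρ * C + ρ ^ 2) :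
    HasDerivAt (fun ρ => √(1 + 2 * ρ * C + ρ ^ 2)) ((ρ + C) / √(1 + 2 * ρ * C + ρ ^ 2)) ρ := by
  have h1 : HasDerivAt (fun ρ : ℝ => 1 + 2 * ρ * C + ρ ^ 2) (2 * C + 2 * ρ) ρ := by
    have := (((hasDerivAt_id ρ).const_mul 2).mul_const C).const_add 1 |>.add (hasDerivAt_pow 2 ρ)
    refine this.congr_deriv ?_
    simp
  refine (h1.sqrt h.ne').congr_deriv ?_
  rw [div_eq_div_iff (by positivity) (by positivity)]
  ring

theorem hasDerivAt_radialV {μ ρ C : ℝ} (hρ : ρ ≠ 0) (h : 0 < 1 + 2 * ρ * C + ρ ^ 2) :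
    HasDerivAt (radialV μ C) (radialV' μ C ρ) ρ := by
  have hs := Real.sqrt_pos.mpr h
  have h1 : HasDerivAt (fun ρ : ℝ => (1 - μ) ^ 2 + 2 * (1 - μ) * ρ * C + ρ ^ 2)
      (2 * (1 - μ) * C + 2 * ρ) ρ := by
    have := (((hasDerivAt_id ρ).const_mul (2 * (1 - μ))).mul_const C).const_add ((1 - μ) ^ 2)
      |>.add (hasDerivAt_pow 2 ρ)
    refine this.congr_deriv ?_
    simp
  have h2 := ((h1.div_const 2).fun_neg.fun_sub ((hasDerivAt_inv hρ).const_mul μ)).fun_sub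
    (((hasDerivAt_dist_origin h).fun_inv hs.ne').const_mul (1 - μ))
  refine h2.congr_deriv ?_
  unfold radialV'
  generalize √(1 + 2 * ρ * C + ρ ^ 2) = D at hs
  field_simp
  ring

theorem hasDerivAt_radialV' {μ ρ C : ℝ} (hρ : ρ ≠ 0) (h : 0 < 1 + 2 * ρ * C + ρ ^ 2) :
    HasDerivAt (radialV' μ C) (radialV'' μ C ρ) ρ := by
  have hs := Real.sqrt_pos.mpr h
  have h2 := (((hasDerivAt_id ρ).const_add ((1 - μ) * C)).fun_neg.fun_add
    (((hasDerivAt_pow 2 ρ).fun_inv (pow_ne_zero 2 hρ)).const_mul μ)).fun_add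
    ((((hasDerivAt_id ρ).add_const C).const_mul (1 - μ)).fun_div
      ((hasDerivAt_dist_origin h).fun_pow 3) (pow_ne_zero 3 hs.ne'))
  refine h2.congr_deriv ?_
  unfold radialV''
  simp only [id]
  generalize √(1 + 2 * ρ * C + ρ ^ 2) = D at hs
  field_simp
  ring

/-- On a circle around the secondary primary the potential is smallest at the point closest to
the main primary. -/
theorem radialV_neg_one_le {μ ρ C : ℝ} (hμ1 : μ < 1) (hρ : 0 < ρ) (hρ1 : ρ < 1)
    (hC : C ∈ Icc (-1 : ℝ) 1) : radialV μ (-1) ρ ≤ radialV μ C ρ := by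
  have h := dist_origin_sq_pos hρ.le hρ1 hC
  have hs := Real.sqrt_pos.mpr h
  have hD2 := Real.sq_sqrt h.le
  unfold radialV
  rw [show 1 + 2 * ρ * (-1) + ρ ^ 2 = (1 - ρ) ^ 2 by ring, Real.sqrt_sq (by linarith)]
  generalize √(1 + 2 * ρ * C + ρ ^ 2) = D at hs hD2
  obtain ⟨hdD, hDs⟩ := dist_origin_bounds hρ hρ1 hC hs hD2
  have hd : 0 < 1 - ρ := by linarith
  have h1 : 0 ≤ (D - (1 - ρ)) * (2 - (1 - ρ) * D * (D + (1 - ρ))) := by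
    refine mul_nonneg (by linarith) ?_
    have : (1 - ρ) * D ≤ 1 := by nlinarith
    nlinarith
  have h2 : D ^ 2 / 2 + 1 / D ≤ (1 - ρ) ^ 2 / 2 + 1 / (1 - ρ) := by
    rw [← sub_nonneg]
    have : (1 - ρ) ^ 2 / 2 + 1 / (1 - ρ) - (D ^ 2 / 2 + 1 / D) =
        (D - (1 - ρ)) * (2 - (1 - ρ) * D * (D + (1 - ρ))) / (2 * D * (1 - ρ)) := by
      field_simp
      ring
    rw [this]
    positivity
  have h3 := mul_le_mul_of_nonneg_left h2 (by linarith : 0 ≤ 1 - μ)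
  rw [hD2] at h3
  have e1 : (1 - μ) / D = (1 - μ) * (1 / D) := by ring
  have e2 : (1 - μ) / (1 - ρ) = (1 - μ) * (1 / (1 - ρ)) := by ring
  rw [e1, e2]
  linarith

theorem radialV'_pos {μ ρ₁ C ρ : ℝ} (hμ : μ < 1) (hρ₁ : ρ₁ < 1)
    (hL : ∀ ρ, 0 < ρ → ρ < ρ₁ → BelowL1 μ ρ) (hC : C ∈ Icc (-1 : ℝ) 1) (hρ : 0 < ρ)
    (hlt : ρ < ρ₁) : 0 < radialV' μ C ρ := by
  have h := dist_origin_sq_pos hρ.le (hlt.trans hρ₁) hC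
  exact radial_slope_pos hμ hρ (hlt.trans hρ₁) (hL ρ hρ hlt) hC (Real.sqrt_pos.mpr h)
    (Real.sq_sqrt h.le)

theorem radialV_lt_radialV {μ ρ₁ C ρ σ : ℝ} (hμ : μ < 1) (hρ₁ : ρ₁ < 1)
    (hL : ∀ ρ, 0 < ρ → ρ < ρ₁ → BelowL1 μ ρ) (hC : C ∈ Icc (-1 : ℝ) 1) (hσ : 0 < σ)
    (hσρ : σ < ρ) (hlt : ρ ≤ ρ₁) : radialV μ C σ < radialV μ C ρ := by
  have hd : ∀ x ∈ Icc σ ρ, HasDerivAt (radialV μ C) (radialV' μ C x) x := fun x hx =>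
    hasDerivAt_radialV (hσ.trans_le hx.1).ne' (dist_origin_sq_pos (hσ.le.trans hx.1)
      ((hx.2.trans hlt).trans_lt hρ₁) hC)
  refine strictMonoOn_of_deriv_pos (convex_Icc σ ρ)
    (fun x hx => (hd x hx).continuousAt.continuousWithinAt) (fun x hx => ?_)
    ⟨le_rfl, hσρ.le⟩ ⟨hσρ.le, le_rfl⟩ hσρ
  rw [interior_Icc] at hx
  rw [(hd x ⟨hx.1.le, hx.2.le⟩).deriv]
  exact radialV'_pos hμ hρ₁ hL hC (hσ.trans hx.1) (hx.2.trans_le hlt)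

/-- Inside the Hill region the radial slope of the potential dominates the speed, which is the
reason for the transversality of the regularized energy surface to the rays. -/
theorem two_mul_lt_radialV'_sq {μ ρ₁ C ρ c : ℝ} (hμ : μ < 1) (hρ₁ : ρ₁ < 1)
    (hL : ∀ ρ, 0 < ρ → ρ < ρ₁ → BelowL1 μ ρ) (hC : C ∈ Icc (-1 : ℝ) 1) (hρ : 0 < ρ)
    (hlt : ρ < ρ₁) (hVc : radialV μ C ρ ≤ c) (hc : c < radialV μ C ρ₁) :
    2 * (c - radialV μ C ρ) < radialV' μ C ρ ^ 2 := by
  have hp : ∀ x ∈ Icc ρ ρ₁, 0 < 1 + 2 * x * C + x ^ 2 := fun x hx =>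
    dist_origin_sq_pos (hρ.le.trans hx.1) (hx.2.trans_lt hρ₁) hC
  have hd : ∀ x ∈ Icc ρ ρ₁, HasDerivAt (radialV μ C) (radialV' μ C x) x := fun x hx =>
    hasDerivAt_radialV (hρ.trans_le hx.1).ne' (hp x hx)
  have hd' : ∀ x ∈ Icc ρ ρ₁, HasDerivAt (radialV' μ C) (radialV'' μ C x) x := fun x hx =>
    hasDerivAt_radialV' (hρ.trans_le hx.1).ne' (hp x hx)
  obtain ⟨σ, hσ, hσc⟩ := intermediate_value_Ico hlt.le
    (fun x hx => (hd x hx).continuousAt.continuousWithinAt) ⟨hVc, hc⟩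
  let g : ℝ → ℝ := fun x => radialV' μ C x ^ 2 / 2 + radialV μ C x
  have hg : ∀ x ∈ Icc ρ ρ₁, HasDerivAt g (radialV' μ C x * (radialV'' μ C x + 1)) x := by
    intro x hx
    refine ((((hd' x hx).fun_pow 2).div_const 2).fun_add (hd x hx)).congr_deriv ?_
    push_cast
    ring
  have hsub : Icc ρ σ ⊆ Icc ρ ρ₁ := Icc_subset_Icc_right hσ.2.le
  have hanti : AntitoneOn g (Icc ρ σ) := by
    refine antitoneOn_of_deriv_nonpos (convex_Icc ρ σ)
      (fun x hx => (hg x (hsub hx)).continuousAt.continuousWithinAt)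
      (fun x hx => (hg x (hsub (interior_subset hx))).differentiableAt.differentiableWithinAt)
      fun x hx => ?_
    have hx' := hsub (interior_subset hx)
    rw [interior_Icc] at hx
    have hxp := hρ.trans hx.1
    have hxl := hx.2.trans hσ.2
    rw [(hg x hx').deriv]
    have h1 := radialV'_pos hμ hρ₁ hL hC hxp hxl
    have h2 := radial_second_deriv_lt hμ hxp (hxl.trans hρ₁) (hL x hxp hxl) hC
      (Real.sqrt_pos.mpr (hp x hx')) (Real.sq_sqrt (hp x hx').le)
    refine mul_nonpos_of_nonneg_of_nonpos h1.le ?_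
    unfold radialV''
    linarith
  have h1 := hanti ⟨le_rfl, hσ.1⟩ ⟨hσ.1, le_rfl⟩ hσ.1
  have h2 := radialV'_pos hμ hρ₁ hL hC (hρ.trans_le hσ.1) hσ.2
  simp only [g, hσc] at h1
  have h3 : 0 < radialV' μ C σ ^ 2 := by positivity
  linarith

end RadialPotential

section EffectivePotential

theorem nrm_eq_norm (z : ℂ) : nrm (z.re, z.im) = ‖z‖ := (Complex.norm_eq_sqrt_sq_add_sq z).symm

/-- The gradient of the effective potential, in complex notation. -/
noncomputable def gradV (μ : ℝ) (q : ℂ) : ℂ :=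
  -(q - μ) + (μ / ‖q - 1‖ ^ 3 : ℝ) • (q - 1) + ((1 - μ) / ‖q‖ ^ 3 : ℝ) • q

theorem gradV_re (μ : ℝ) (q : ℂ) : (gradV μ q).re =
    -(q.re - μ) + μ / ‖q - 1‖ ^ 3 * (q.re - 1) + (1 - μ) / ‖q‖ ^ 3 * q.re := by
  simp only [gradV, Complex.add_re, Complex.neg_re, Complex.sub_re, Complex.smul_re,
    Complex.ofReal_re, Complex.one_re, smul_eq_mul]

theorem gradV_im (μ : ℝ) (q : ℂ) : (gradV μ q).im =
    -q.im + μ / ‖q - 1‖ ^ 3 * q.im + (1 - μ) / ‖q‖ ^ 3 * q.im := by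
  simp only [gradV, Complex.add_im, Complex.neg_im, Complex.sub_im, Complex.smul_im,
    Complex.ofReal_im, Complex.one_im, smul_eq_mul, sub_zero]

theorem V_eq (μ : ℝ) (q : ℂ) :
    V μ (q.re, q.im) = -(((q.re - μ) ^ 2 + q.im ^ 2) / 2) - μ / ‖q - 1‖ - (1 - μ) / ‖q‖ := by
  have h1 := nrm_eq_norm (q - 1)
  have h2 := nrm_eq_norm q
  simp only [Complex.sub_re, Complex.sub_im, Complex.one_re, Complex.one_im, sub_zero] at h1
  unfold V
  rw [h1, h2]

theorem hasFDerivAt_nrm {p : ℝ × ℝ} (hp : 0 < p.1 ^ 2 + p.2 ^ 2) :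
    HasFDerivAt nrm ((p.1 / nrm p) • ContinuousLinearMap.fst ℝ ℝ ℝ +
      (p.2 / nrm p) • ContinuousLinearMap.snd ℝ ℝ ℝ) p := by
  have h1 : HasFDerivAt (fun p : ℝ × ℝ => p.1 ^ 2 + p.2 ^ 2) _ p :=
    (HasFDerivAt.pow (hasFDerivAt_fst (𝕜 := ℝ) (p := p)) 2).fun_add
      (HasFDerivAt.pow (hasFDerivAt_snd (𝕜 := ℝ) (p := p)) 2)
  have hs : 0 < nrm p := Real.sqrt_pos.mpr hp
  refine (h1.sqrt hp.ne').congr_fderiv ?_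
  change (1 / (2 * nrm p)) • _ = _
  refine ContinuousLinearMap.ext fun v => ?_
  simp only [smul_apply, add_apply, smul_eq_mul, ContinuousLinearMap.coe_fst',
    ContinuousLinearMap.coe_snd']
  field_simp
  push_cast
  ring

theorem norm_sq_pos_coords {q : ℂ} (hq : q ≠ 0) : 0 < q.re ^ 2 + q.im ^ 2 := by
  have := Complex.normSq_pos.mpr hq
  rw [Complex.normSq_apply] at this
  nlinarith

theorem hasFDerivAt_V (μ : ℝ) {q : ℂ} (h0 : q ≠ 0) (h1 : q ≠ 1) :
    HasFDerivAt (V μ) ((gradV μ q).re • ContinuousLinearMap.fst ℝ ℝ ℝ +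
      (gradV μ q).im • ContinuousLinearMap.snd ℝ ℝ ℝ) (q.re, q.im) := by
  have n0 : 0 < ‖q‖ := norm_pos_iff.mpr h0
  have n1 : 0 < ‖q - 1‖ := norm_pos_iff.mpr (sub_ne_zero.mpr h1)
  have e0 := nrm_eq_norm q
  have e1 := nrm_eq_norm (q - 1)
  have p1 := norm_sq_pos_coords (sub_ne_zero.mpr h1)
  simp only [Complex.sub_re, Complex.sub_im, Complex.one_re, Complex.one_im, sub_zero] at e1 p1
  have d0 := hasFDerivAt_nrm (p := (q.re, q.im)) (norm_sq_pos_coords h0)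
  have sh : HasFDerivAt (fun p : ℝ × ℝ => (p.1 - 1, p.2)) (ContinuousLinearMap.id ℝ (ℝ × ℝ))
      (q.re, q.im) :=
    ((HasFDerivAt.sub_const 1 (hasFDerivAt_fst (𝕜 := ℝ) (p := (q.re, q.im)))).prodMk
      (hasFDerivAt_snd (𝕜 := ℝ) (p := (q.re, q.im)))).congr_fderiv
      (ContinuousLinearMap.ext fun _ => rfl)
  have d1 := HasFDerivAt.comp (q.re, q.im) (g := nrm)
    (hasFDerivAt_nrm (p := (q.re - 1, q.im)) p1) sh
  have d2 : HasFDerivAt (fun p : ℝ × ℝ => (p.1 - μ) ^ 2 + p.2 ^ 2) _ (q.re, q.im) :=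
    (HasFDerivAt.pow
      (HasFDerivAt.sub_const μ (hasFDerivAt_fst (𝕜 := ℝ) (p := (q.re, q.im)))) 2).fun_add
      (HasFDerivAt.pow (hasFDerivAt_snd (𝕜 := ℝ) (p := (q.re, q.im))) 2)
  rw [e0] at d0
  rw [e1] at d1
  have i0 := ((hasDerivAt_inv (n0.ne')).const_mul (1 - μ)).comp_hasFDerivAt_of_eq (q.re, q.im) d0
    e0.symm
  have i1 := ((hasDerivAt_inv (n1.ne')).const_mul μ).comp_hasFDerivAt_of_eq (q.re, q.im) d1
    e1.symm
  have i2 := (d2.mul_const (2⁻¹ : ℝ)).fun_neg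
  refine ((i2.fun_sub i1).fun_sub i0).congr_fderiv ?_
  refine ContinuousLinearMap.ext fun v => ?_
  simp only [gradV_re, gradV_im, smul_apply, add_apply, sub_apply, neg_apply, smul_eq_mul,
    ContinuousLinearMap.coe_fst', ContinuousLinearMap.coe_snd', ContinuousLinearMap.comp_id]
  field_simp
  push_cast
  ring

theorem gradV_eq_zero_of_mem_critSet {μ : ℝ} {q : ℂ} (hq : (q.re, q.im) ∈ critSet μ) :
    q ≠ 0 ∧ q ≠ 1 ∧ gradV μ q = 0 := by
  obtain ⟨h0, h1, h2⟩ := hq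
  have n0 : q ≠ 0 := by rintro rfl; exact h0 rfl
  have n1 : q ≠ 1 := by rintro rfl; exact h1 rfl
  rw [(hasFDerivAt_V μ n0 n1).fderiv] at h2
  refine ⟨n0, n1, Complex.ext ?_ ?_⟩
  · simpa using congrArg (fun L : ℝ × ℝ →L[ℝ] ℝ => L (1, 0)) h2
  · simpa using congrArg (fun L : ℝ × ℝ →L[ℝ] ℝ => L (0, 1)) h2

theorem V_ge_of_gradV_eq_zero {μ : ℝ} (hμ : μ ∈ Ioo (0 : ℝ) 1) {q : ℂ} (h0 : q ≠ 0)
    (h1 : q ≠ 1) (hg : gradV μ q = 0) : -64 ≤ V μ (q.re, q.im) := by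
  obtain ⟨hμ0, hμ1⟩ := hμ
  have n0 : 0 < ‖q‖ := norm_pos_iff.mpr h0
  have n1 : 0 < ‖q - 1‖ := norm_pos_iff.mpr (sub_ne_zero.mpr h1)
  have hm : 0 < 1 - μ := by linarith
  have hsum : q - μ = (μ / ‖q - 1‖ ^ 3 : ℝ) • (q - 1) + ((1 - μ) / ‖q‖ ^ 3 : ℝ) • q := by
    rw [← sub_eq_zero, ← neg_eq_zero, ← hg]
    unfold gradV
    abel
  have nA : ‖(μ / ‖q - 1‖ ^ 3 : ℝ) • (q - 1)‖ = μ / ‖q - 1‖ ^ 2 := by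
    rw [norm_smul, Real.norm_of_nonneg (by positivity)]
    field_simp
  have nR : ‖((1 - μ) / ‖q‖ ^ 3 : ℝ) • q‖ = (1 - μ) / ‖q‖ ^ 2 := by
    rw [norm_smul, Real.norm_of_nonneg (by positivity)]
    field_simp
  have t1 := norm_add_le ((μ / ‖q - 1‖ ^ 3 : ℝ) • (q - 1)) (((1 - μ) / ‖q‖ ^ 3 : ℝ) • q)
  have t2 := norm_sub_le (q - μ) (((1 - μ) / ‖q‖ ^ 3 : ℝ) • q)
  have t3 := norm_sub_le (q - μ) ((μ / ‖q - 1‖ ^ 3 : ℝ) • (q - 1))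
  rw [← hsum, nA, nR] at t1
  rw [show q - μ - ((1 - μ) / ‖q‖ ^ 3 : ℝ) • q = (μ / ‖q - 1‖ ^ 3 : ℝ) • (q - 1) by
    rw [hsum]; abel, nA, nR] at t2
  rw [show q - μ - (μ / ‖q - 1‖ ^ 3 : ℝ) • (q - 1) = ((1 - μ) / ‖q‖ ^ 3 : ℝ) • q by
    rw [hsum]; abel, nA, nR] at t3
  have nμ : ‖(μ : ℂ)‖ = μ := by rw [Complex.norm_real, Real.norm_of_nonneg hμ0.le]
  have t4 := norm_sub_le q μ
  have t5 := norm_sub_norm_le q μ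
  have t6 := norm_sub_norm_le q 1
  have t7 := norm_sub_le q 1
  have t8 := norm_sub_le q (q - 1)
  rw [nμ] at t4 t5
  rw [norm_one] at t6 t7
  rw [sub_sub_cancel, norm_one] at t8
  have hsq : (q.re - μ) ^ 2 + q.im ^ 2 = ‖q - μ‖ ^ 2 := by
    rw [← Complex.normSq_eq_norm_sq, Complex.normSq_apply]
    simp
    ring
  rw [V_eq, hsq]
  have eA : μ / ‖q - 1‖ = μ / ‖q - 1‖ ^ 2 * ‖q - 1‖ := by field_simp
  have eR : (1 - μ) / ‖q‖ = (1 - μ) / ‖q‖ ^ 2 * ‖q‖ := by field_simp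
  rw [eA, eR]
  have bA : ∀ ε > 0, ε ≤ ‖q - 1‖ → μ / ‖q - 1‖ ^ 2 ≤ 1 / ε ^ 2 := fun ε he h => by gcongr
  have bR : ∀ ε > 0, ε ≤ ‖q‖ → (1 - μ) / ‖q‖ ^ 2 ≤ 1 / ε ^ 2 := fun ε he h => by
    gcongr
    linarith
  have pA : 0 < μ / ‖q - 1‖ ^ 2 := by positivity
  have pR : 0 < (1 - μ) / ‖q‖ ^ 2 := by positivity
  generalize μ / ‖q - 1‖ ^ 2 = A at *
  generalize (1 - μ) / ‖q‖ ^ 2 = R at *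
  generalize ‖q - μ‖ = s at *
  generalize ‖q - 1‖ = a at *
  generalize ‖q‖ = r at *
  have hr : r ≤ 3 := by
    by_contra! hr
    have b1 := bA 2 two_pos (by linarith)
    have b2 := bR 3 three_pos (by linarith)
    norm_num at b1 b2
    linarith
  have hA : A ≤ 8 ∧ R ≤ 8 := by
    rcases le_or_gt (1 / 2) a with h | h
    · have := bA (1 / 2) (by norm_num) h
      norm_num at this
      constructor <;> linarith
    · have := bR (1 / 2) (by norm_num) (by linarith)
      norm_num at this
      constructor <;> linarith
  have s0 : s ≤ 4 := by linarith
  have s1 : -4 ≤ s := by linarith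
  have p1 := mul_le_mul hA.1 (by linarith : a ≤ 4) n1.le (by norm_num)
  have p2 := mul_le_mul hA.2 hr n0.le (by norm_num)
  have p3 : s ^ 2 ≤ 4 ^ 2 := sq_le_sq' s1 s0
  linarith

theorem firstCriticalValue_le {μ : ℝ} (hμ : μ ∈ Ioo (0 : ℝ) 1) {q : ℂ} (h0 : q ≠ 0) (h1 : q ≠ 1)
    (hg : gradV μ q = 0) : firstCriticalValue μ ≤ V μ (q.re, q.im) := by
  refine csInf_le ⟨-64, ?_⟩ ⟨(q.re, q.im), ⟨?_, ?_, ?_⟩, rfl⟩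
  · rintro _ ⟨⟨x, y⟩, hp, rfl⟩
    obtain ⟨n0, n1, h⟩ := gradV_eq_zero_of_mem_critSet (q := ⟨x, y⟩) hp
    exact V_ge_of_gradV_eq_zero (q := ⟨x, y⟩) hμ n0 n1 h
  · intro h
    exact h0 (Complex.ext (congrArg Prod.fst h) (congrArg Prod.snd h))
  · intro h
    exact h1 (Complex.ext (congrArg Prod.fst h) (congrArg Prod.snd h))
  · rw [(hasFDerivAt_V μ h0 h1).fderiv, hg]
    simp

theorem norm_one_add_smul {ρ : ℝ} {e : ℂ} (he : ‖e‖ = 1) :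
    ‖1 + ρ • e‖ = √(1 + 2 * ρ * e.re + ρ ^ 2) := by
  have h := Complex.normSq_apply e
  rw [Complex.normSq_eq_norm_sq, he] at h
  rw [Complex.norm_eq_sqrt_sq_add_sq]
  congr 1
  simp
  linear_combination -ρ ^ 2 * h

theorem V_one_add_smul (μ : ℝ) {ρ : ℝ} (hρ : 0 ≤ ρ) {e : ℂ} (he : ‖e‖ = 1) :
    V μ ((1 + ρ • e).re, (1 + ρ • e).im) = radialV μ e.re ρ := by
  have h := Complex.normSq_apply e
  rw [Complex.normSq_eq_norm_sq, he] at h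
  rw [V_eq, add_sub_cancel_left, norm_smul, he, mul_one, Real.norm_of_nonneg hρ,
    norm_one_add_smul he, radialV]
  congr 3
  simp
  linear_combination -ρ ^ 2 * h

theorem re_mem_Icc {e : ℂ} (he : ‖e‖ = 1) : e.re ∈ Icc (-1 : ℝ) 1 :=
  abs_le.mp ((Complex.abs_re_le_norm e).trans he.le)

/-- A radius bounding the component of the Hill region around the secondary primary. -/
theorem exists_hill_radius {μ c : ℝ} (hμ : μ ∈ Ioo (0 : ℝ) 1) (hc : c < firstCriticalValue μ) :
    ∃ ρ₁ ∈ Ioo (0 : ℝ) 1, (∀ ρ, 0 < ρ → ρ < ρ₁ → BelowL1 μ ρ) ∧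
      ∀ C ∈ Icc (-1 : ℝ) 1, c < radialV μ C ρ₁ := by
  obtain ⟨ρ₁, hρ₁, heq, hL⟩ := exists_L1_dist hμ
  obtain ⟨hp, hp1⟩ := hρ₁
  have hd : 0 < 1 - ρ₁ := by linarith
  refine ⟨ρ₁, ⟨hp, hp1⟩, hL, fun C hC => ?_⟩
  have hn : ‖((1 - ρ₁ : ℝ) : ℂ)‖ = 1 - ρ₁ := by
    rw [Complex.norm_real, Real.norm_of_nonneg hd.le]
  have hs : ((1 - ρ₁ : ℝ) : ℂ) - 1 = ((-ρ₁ : ℝ) : ℂ) := by push_cast; ring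
  have hn1 : ‖((1 - ρ₁ : ℝ) : ℂ) - 1‖ = ρ₁ := by
    rw [hs, Complex.norm_real, norm_neg, Real.norm_of_nonneg hp.le]
  have hg : gradV μ ((1 - ρ₁ : ℝ) : ℂ) = 0 := by
    refine Complex.ext ?_ ?_
    · rw [gradV_re, hn1, hn, Complex.ofReal_re, Complex.zero_re]
      have e1 : μ / ρ₁ ^ 3 * (1 - ρ₁ - 1) = -(μ * (1 / ρ₁ ^ 2)) := by field_simp; ring
      have e2 : (1 - μ) / (1 - ρ₁) ^ 3 * (1 - ρ₁) = (1 - μ) * (1 / (1 - ρ₁) ^ 2) := by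
        field_simp
      rw [e1, e2]
      linarith
    · rw [gradV_im]
      simp
  have h1 := firstCriticalValue_le hμ (norm_pos_iff.mp (by rw [hn]; exact hd))
    (sub_ne_zero.mp (norm_pos_iff.mp (by rw [hn1]; exact hp))) hg
  have h2 := V_one_add_smul μ hp.le (e := -1) (by simp)
  have h3 : (1 + ρ₁ • (-1) : ℂ) = ((1 - ρ₁ : ℝ) : ℂ) := by
    rw [Complex.real_smul]
    push_cast
    ring
  rw [h3] at h2
  rw [h2] at h1
  have h4 := radialV_neg_one_le hμ.2 hp hp1 hC
  simp only [Complex.neg_re, Complex.one_re] at h1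
  linarith

theorem mem_KSetE {μ c ρ₁ ρ : ℝ} (hμ : μ ∈ Ioo (0 : ℝ) 1) (hρ₁ : ρ₁ < 1)
    (hL : ∀ ρ, 0 < ρ → ρ < ρ₁ → BelowL1 μ ρ) (hρ : 0 < ρ) (hlt : ρ < ρ₁) {e : ℂ} (he : ‖e‖ = 1)
    (hV : radialV μ e.re ρ ≤ c) : ((1 + ρ • e).re, (1 + ρ • e).im) ∈ KSetE μ c := by
  let f : ℝ → ℝ × ℝ := fun σ => ((1 + σ • e).re, (1 + σ • e).im)
  have hf : Continuous f := by
    have : Continuous fun σ : ℝ => 1 + σ • e := by fun_prop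
    exact (Complex.continuous_re.comp this).prodMk (Complex.continuous_im.comp this)
  have hsub : f '' Ioc 0 ρ ⊆ Hill μ c := by
    rintro _ ⟨σ, hσ, rfl⟩
    have he0 : e ≠ 0 := norm_ne_zero_iff.mp (he ▸ one_ne_zero)
    refine ⟨fun h => ?_, fun h => ?_, ?_⟩
    · have h1 : (1 + σ • e : ℂ) = 0 := Complex.ext (congrArg Prod.fst h) (congrArg Prod.snd h)
      have h2 := norm_one_add_smul (ρ := σ) he
      rw [h1, norm_zero] at h2
      have h3 := dist_origin_sq_pos hσ.1.le (by linarith [hσ.2]) (re_mem_Icc he)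
      exact absurd h2.symm (Real.sqrt_pos.mpr h3).ne'
    · have h1 : (1 + σ • e : ℂ) = 1 := Complex.ext (congrArg Prod.fst h) (congrArg Prod.snd h)
      exact smul_ne_zero hσ.1.ne' he0 (by simpa using h1)
    · change V μ ((1 + σ • e).re, (1 + σ • e).im) ≤ c
      rw [V_one_add_smul μ hσ.1.le he]
      rcases hσ.2.eq_or_lt with h | h
      · rwa [h]
      · exact (radialV_lt_radialV hμ.2 hρ₁ hL (re_mem_Icc he) hσ.1 h hlt.le).le.trans hV
  have hmem : f ρ ∈ f '' Ioc 0 ρ := ⟨ρ, ⟨hρ, le_rfl⟩, rfl⟩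
  refine ⟨hsub hmem, ?_⟩
  have h1 := (isPreconnected_Ioc.image f hf.continuousOn).subset_connectedComponentIn hmem hsub
  refine closure_mono h1 (image_closure_subset_closure_image hf ⟨0, ?_, ?_⟩)
  · rw [closure_Ioc hρ.ne]
    exact ⟨le_rfl, hρ.le⟩
  · simp [f]

end EffectivePotential

section LeviCivita

open scoped ComplexConjugate

theorem real_inner_complex (z w : ℂ) : inner ℝ z w = z.re * w.re + z.im * w.im := by
  rw [Complex.inner, Complex.mul_re, Complex.conj_re, Complex.conj_im]
  ring

/-- The factor by which the regularized potential grows quadratically. -/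
noncomputable def regR (μ c : ℝ) (z : ℂ) : ℝ :=
  c + ‖(1 - μ : ℝ) + z ^ 2‖ ^ 2 / 2 + (1 - μ) / ‖1 + z ^ 2‖

noncomputable def regH (μ : ℝ) (z : ℂ) : ℂ :=
  (1 - μ : ℝ) + z ^ 2 - ((1 - μ) / ‖1 + z ^ 2‖ ^ 3 : ℝ) • (1 + z ^ 2)

/-- The regularized potential `‖z‖² (c - V (1 + z²))`. -/
noncomputable def regU (μ c : ℝ) (z : ℂ) : ℝ := μ + ‖z‖ ^ 2 * regR μ c z

noncomputable def gradU (μ c : ℝ) (z : ℂ) : ℂ :=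
  (2 * regR μ c z) • z + (2 * ‖z‖ ^ 2) • (conj z * regH μ z)

theorem hasFDerivAt_regU (μ c : ℝ) {z : ℂ} (hz : 1 + z ^ 2 ≠ 0) :
    HasFDerivAt (regU μ c) (innerSL ℝ (gradU μ c z)) z := by
  have n : 0 < ‖1 + z ^ 2‖ := norm_pos_iff.mpr hz
  have h0 : HasFDerivAt (fun z : ℂ => z ^ 2)
      ((ContinuousLinearMap.mul ℝ ℂ (2 * z))) z := by
    have h := ((hasDerivAt_pow 2 z).hasFDerivAt).restrictScalars ℝ
    refine h.congr_fderiv (ContinuousLinearMap.ext fun v => ?_)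
    simp
    ring
  have h1 := (h0.const_add ((1 - μ : ℝ) : ℂ)).norm_sq
  have h2 := (h0.const_add (1 : ℂ)).norm_sq
  have h3 := (hasFDerivAt_id (𝕜 := ℝ) z).norm_sq
  have h4 := h2.sqrt (pow_pos n 2).ne'
  simp only [Real.sqrt_sq (norm_nonneg _)] at h4
  have h5 := ((hasDerivAt_inv n.ne').const_mul (1 - μ)).comp_hasFDerivAt_of_eq z h4 rfl
  have h6 := ((h1.mul_const (2⁻¹ : ℝ)).const_add c).fun_add h5
  refine ((h3.fun_mul h6).const_add μ).congr_fderiv ?_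
  refine ContinuousLinearMap.ext fun v => ?_
  simp only [smul_apply, add_apply, smul_eq_mul, ContinuousLinearMap.comp_apply,
    innerSL_apply_apply, ContinuousLinearMap.id_apply, ContinuousLinearMap.mul_apply', id]
  unfold gradU regR regH
  have e1 : inner ℝ ((1 - μ : ℝ) + z ^ 2 : ℂ) (2 * z * v) =
      2 * inner ℝ (conj z * ((1 - μ : ℝ) + z ^ 2)) v := by
    simp only [Complex.inner, map_mul, Complex.conj_conj]
    rw [← Complex.re_ofReal_mul]
    congr 1
    push_cast
    ring
  have e2 : inner ℝ (1 + z ^ 2 : ℂ) (2 * z * v) = 2 * inner ℝ (conj z * (1 + z ^ 2)) v := by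
    simp only [Complex.inner, map_mul, Complex.conj_conj]
    rw [← Complex.re_ofReal_mul]
    congr 1
    push_cast
    ring
  rw [e1, e2, mul_sub, mul_smul_comm _ (conj z) (1 + z ^ 2), inner_add_left, real_inner_smul_left,
    real_inner_smul_left, inner_sub_left, real_inner_smul_left]
  simp only [nsmul_eq_mul, Function.comp_apply]
  push_cast
  field_simp
  ring

theorem continuousOn_regR (μ c : ℝ) : ContinuousOn (regR μ c) {z | 1 + z ^ 2 ≠ 0} := by
  unfold regR
  have h1 : Continuous fun z : ℂ => c + ‖(1 - μ : ℝ) + z ^ 2‖ ^ 2 / 2 := by fun_prop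
  have h2 : Continuous fun z : ℂ => ‖1 + z ^ 2‖ := by fun_prop
  refine h1.continuousOn.add (continuousOn_const.div h2.continuousOn ?_)
  exact fun z hz => norm_ne_zero_iff.mpr hz

theorem continuousOn_regH (μ : ℝ) : ContinuousOn (regH μ) {z | 1 + z ^ 2 ≠ 0} := by
  unfold regH
  have h1 : Continuous fun z : ℂ => (1 - μ : ℝ) + z ^ 2 := by fun_prop
  have h2 : Continuous fun z : ℂ => ‖1 + z ^ 2‖ ^ 3 := by fun_prop
  have h3 : Continuous fun z : ℂ => 1 + z ^ 2 := by fun_prop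
  refine h1.continuousOn.sub (ContinuousOn.smul
    (continuousOn_const.div h2.continuousOn ?_) h3.continuousOn)
  exact fun z hz => pow_ne_zero 3 (norm_ne_zero_iff.mpr hz)

theorem continuousOn_gradU (μ c : ℝ) : ContinuousOn (gradU μ c) {z | 1 + z ^ 2 ≠ 0} := by
  unfold gradU
  have h1 := continuousOn_regR μ c
  have h2 := continuousOn_regH μ
  have h3 : Continuous fun z : ℂ => conj z := Complex.continuous_conj
  have h4 : Continuous fun z : ℂ => 2 * ‖z‖ ^ 2 := by fun_prop
  exact ((continuousOn_const.mul h1).smul continuousOn_id).add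
    (h4.continuousOn.smul (h3.continuousOn.mul h2))

theorem one_add_sq_ne_zero {z : ℂ} (hz : ‖z‖ ^ 2 < 1) : 1 + z ^ 2 ≠ 0 := by
  intro h
  have h1 : z ^ 2 = -1 := by linear_combination h
  rw [← norm_pow, h1] at hz
  simp at hz

theorem inner_gradU (μ c : ℝ) (z : ℂ) : inner ℝ z (gradU μ c z) =
    ‖z‖ ^ 2 * (2 * regR μ c z + 2 * inner ℝ (z ^ 2) (regH μ z)) := by
  have h : inner ℝ z (conj z * regH μ z) = inner ℝ (z ^ 2) (regH μ z) := by
    simp only [Complex.inner, map_pow]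
    congr 1
    ring
  rw [gradU, inner_add_right, inner_smul_right, inner_smul_right, h, real_inner_self_eq_norm_sq]
  ring

/-- Writing `z² = ρ e` with `‖e‖ = 1`. -/
theorem regU_eq_radial {μ c : ℝ} {z e : ℂ} (hz : z ≠ 0) (he : ‖e‖ = 1)
    (hze : z ^ 2 = (‖z‖ ^ 2) • e) :
    regU μ c z = ‖z‖ ^ 2 * (c - radialV μ e.re (‖z‖ ^ 2)) := by
  have hn : 0 < ‖z‖ ^ 2 := pow_pos (norm_pos_iff.mpr hz) 2
  have h := Complex.normSq_apply e
  rw [Complex.normSq_eq_norm_sq, he] at h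
  rw [regU, regR, hze, norm_one_add_smul he, ← Complex.normSq_eq_norm_sq (_ + _),
    Complex.normSq_apply]
  unfold radialV
  generalize ‖z‖ ^ 2 = ρ at hn
  simp only [Complex.add_re, Complex.add_im, Complex.ofReal_re, Complex.ofReal_im,
    Complex.smul_re, Complex.smul_im, smul_eq_mul]
  field_simp
  linear_combination -ρ ^ 3 * h

theorem inner_gradU_eq_radial {μ c : ℝ} {z e : ℂ} (hz : z ≠ 0) (hz1 : ‖z‖ ^ 2 < 1) (he : ‖e‖ = 1)
    (hze : z ^ 2 = (‖z‖ ^ 2) • e) :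
    inner ℝ z (gradU μ c z) = 2 * regU μ c z - 2 * (‖z‖ ^ 2) ^ 2 * radialV' μ e.re (‖z‖ ^ 2) := by
  have hn : 0 < ‖z‖ ^ 2 := pow_pos (norm_pos_iff.mpr hz) 2
  have h := Complex.normSq_apply e
  rw [Complex.normSq_eq_norm_sq, he] at h
  have hp := Real.sqrt_pos.mpr (dist_origin_sq_pos hn.le hz1 (re_mem_Icc he))
  rw [inner_gradU, regU, regH, hze, norm_one_add_smul he, real_inner_complex]
  generalize regR μ c z = R
  unfold radialV'
  generalize ‖z‖ ^ 2 = ρ at hn hp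
  simp only [Complex.add_re, Complex.add_im, Complex.ofReal_re, Complex.ofReal_im,
    Complex.sub_re, Complex.sub_im, Complex.one_re, Complex.one_im,
    Complex.smul_re, Complex.smul_im, smul_eq_mul]
  generalize √(1 + 2 * ρ * e.re + ρ ^ 2) = D at hp
  field_simp
  linear_combination (ρ ^ 3 * (1 - μ) - ρ ^ 3 * D ^ 3) * h

theorem exists_unit_sq {z : ℂ} (hz : z ≠ 0) : ∃ e : ℂ, ‖e‖ = 1 ∧ z ^ 2 = (‖z‖ ^ 2) • e := by
  have hn : ‖z‖ ^ 2 ≠ 0 := pow_ne_zero 2 (norm_ne_zero_iff.mpr hz)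
  refine ⟨(‖z‖ ^ 2)⁻¹ • z ^ 2, ?_, ?_⟩
  · rw [norm_smul, norm_inv, norm_pow, norm_norm, norm_pow, inv_mul_cancel₀ hn]
  · rw [smul_smul, mul_inv_cancel₀ hn, one_smul]

theorem regularized_transversality {μ c ρ₁ : ℝ} (hμ : μ ∈ Ioo (0 : ℝ) 1) (hρ₁ : ρ₁ < 1)
    (hL : ∀ ρ, 0 < ρ → ρ < ρ₁ → BelowL1 μ ρ) (hc : ∀ C ∈ Icc (-1 : ℝ) 1, c < radialV μ C ρ₁)
    {z v : ℂ} (hz : ‖z‖ ^ 2 < ρ₁) (hv : ‖v‖ ^ 2 = 8 * regU μ c z) :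
    0 < 8 * regU μ c z - 4 * ‖z‖ ^ 2 * inner ℝ (Complex.I * z) v -
      4 * inner ℝ z (gradU μ c z) := by
  by_cases hz0 : z = 0
  · subst hz0
    simp [regU]
    exact hμ.1
  obtain ⟨e, he, hze⟩ := exists_unit_sq hz0
  have hn : 0 < ‖z‖ ^ 2 := pow_pos (norm_pos_iff.mpr hz0) 2
  have hU := regU_eq_radial (μ := μ) (c := c) hz0 he hze
  have hC := re_mem_Icc he
  have hUn : 0 ≤ regU μ c z := by nlinarith [sq_nonneg ‖v‖]
  have hV : radialV μ e.re (‖z‖ ^ 2) ≤ c := by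
    rw [hU] at hUn
    linarith [nonneg_of_mul_nonneg_right hUn hn]
  have h1 := two_mul_lt_radialV'_sq hμ.2 hρ₁ hL hC hn hz hV (hc _ hC)
  have h2 := radialV'_pos hμ.2 hρ₁ hL hC hn hz
  rw [inner_gradU_eq_radial hz0 (hz.trans hρ₁) he hze]
  have h3 : inner ℝ (Complex.I * z) v ≤ ‖z‖ * ‖v‖ := by
    refine (real_inner_le_norm _ _).trans_eq ?_
    rw [norm_mul, Complex.norm_I, one_mul]
  have h4 : ‖z‖ * ‖v‖ < 2 * ‖z‖ ^ 2 * radialV' μ e.re (‖z‖ ^ 2) := by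
    refine lt_of_pow_lt_pow_left₀ 2 (by positivity) ?_
    rw [mul_pow, hv, hU]
    nlinarith [mul_lt_mul_of_pos_left h1 (mul_pos hn hn)]
  nlinarith [mul_lt_mul_of_pos_left (h3.trans_lt h4) hn]

end LeviCivita

section Chord

/-- The position component of a point of `ℂ² = ℂ ⊕ iℂ`. -/
noncomputable def lcPos : EuclideanSpace ℂ (Fin 2) →L[ℝ] ℂ :=
  LinearMap.toContinuousLinearMap
    { toFun := fun x => ⟨(x 0).im, (x 1).im⟩
      map_add' := fun x y => by apply Complex.ext <;> simp
      map_smul' := fun s x => by apply Complex.ext <;> simp }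

/-- The momentum component of a point of `ℂ² = ℂ ⊕ iℂ`. -/
noncomputable def lcMom : EuclideanSpace ℂ (Fin 2) →L[ℝ] ℂ :=
  LinearMap.toContinuousLinearMap
    { toFun := fun x => ⟨(x 0).re, (x 1).re⟩
      map_add' := fun x y => by apply Complex.ext <;> simp
      map_smul' := fun s x => by apply Complex.ext <;> simp }

noncomputable def lcPair (a b : ℂ) : EuclideanSpace ℂ (Fin 2) :=
  !₂[⟨a.re, b.re⟩, ⟨a.im, b.im⟩]

theorem lcPos_apply (x : EuclideanSpace ℂ (Fin 2)) : lcPos x = ⟨(x 0).im, (x 1).im⟩ := rfl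

theorem lcMom_apply (x : EuclideanSpace ℂ (Fin 2)) : lcMom x = ⟨(x 0).re, (x 1).re⟩ := rfl

theorem lcPos_lcPair (a b : ℂ) : lcPos (lcPair a b) = b := by
  apply Complex.ext <;> simp [lcPos_apply, lcPair]

theorem lcMom_lcPair (a b : ℂ) : lcMom (lcPair a b) = a := by
  apply Complex.ext <;> simp [lcMom_apply, lcPair]

theorem lcPos_I_smul (x : EuclideanSpace ℂ (Fin 2)) : lcPos (Complex.I • x) = lcMom x := by
  apply Complex.ext <;> simp [lcPos_apply, lcMom_apply]

theorem lcMom_I_smul (x : EuclideanSpace ℂ (Fin 2)) : lcMom (Complex.I • x) = -lcPos x := by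
  apply Complex.ext <;> simp [lcPos_apply, lcMom_apply]

theorem inner_lcPair (x : EuclideanSpace ℂ (Fin 2)) (a b : ℂ) :
    inner ℝ x (lcPair a b) = inner ℝ (lcMom x) a + inner ℝ (lcPos x) b := by
  have h : inner ℝ x (lcPair a b) = (inner ℂ x (lcPair a b)).re := rfl
  rw [h, PiLp.inner_apply, Fin.sum_univ_two]
  simp [lcPos_apply, lcMom_apply, lcPair]
  ring

theorem eq_zero_of_lcPos_of_lcMom {x : EuclideanSpace ℂ (Fin 2)} (hp : lcPos x = 0)
    (hm : lcMom x = 0) : x = 0 := by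
  rw [lcPos_apply, Complex.ext_iff] at hp
  rw [lcMom_apply, Complex.ext_iff] at hm
  ext i
  fin_cases i
  · exact Complex.ext hm.1 hp.1
  · exact Complex.ext hm.2 hp.2

theorem continuous_lcPair : Continuous fun p : ℂ × ℂ => lcPair p.1 p.2 := by
  unfold lcPair
  refine (PiLp.continuous_toLp 2 _).comp (continuous_pi fun i => ?_)
  have h (a b : ℂ × ℂ → ℝ) (ha : Continuous a) (hb : Continuous b) :
      Continuous fun p => (⟨a p, b p⟩ : ℂ) := by
    have : (fun p => (⟨a p, b p⟩ : ℂ)) = fun p => (a p : ℂ) + b p * Complex.I := by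
      funext p
      exact Complex.mk_eq_add_mul_I _ _
    rw [this]
    fun_prop
  fin_cases i
  · exact h _ _ (by fun_prop) (by fun_prop)
  · exact h _ _ (by fun_prop) (by fun_prop)

/-- The velocity in regularized coordinates. -/
noncomputable def lcVel (x : EuclideanSpace ℂ (Fin 2)) : ℂ :=
  lcMom x - (2 * ‖lcPos x‖ ^ 2) • (Complex.I * lcPos x)

/-- The regularized Hamiltonian. -/
noncomputable def lcHam (μ c : ℝ) (x : EuclideanSpace ℂ (Fin 2)) : ℝ :=
  ‖lcVel x‖ ^ 2 / 2 - 4 * regU μ c (lcPos x)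

noncomputable def lcForce (μ c : ℝ) (x : EuclideanSpace ℂ (Fin 2)) : ℂ :=
  (-4 * inner ℝ (lcVel x) (Complex.I * lcPos x)) • lcPos x +
    (2 * ‖lcPos x‖ ^ 2) • (Complex.I * lcVel x) - (4 : ℝ) • gradU μ c (lcPos x)

noncomputable def lcGrad (μ c : ℝ) (x : EuclideanSpace ℂ (Fin 2)) : EuclideanSpace ℂ (Fin 2) :=
  lcPair (lcVel x) (lcForce μ c x)

theorem hasFDerivAt_lcVel (x : EuclideanSpace ℂ (Fin 2)) : HasFDerivAt lcVel
    (lcMom - ((2 * ‖lcPos x‖ ^ 2) • (ContinuousLinearMap.mul ℝ ℂ Complex.I).comp lcPos +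
      ((4 : ℝ) • (innerSL ℝ (lcPos x)).comp lcPos).smulRight (Complex.I * lcPos x))) x := by
  have h1 := (lcPos.hasFDerivAt (x := x)).norm_sq.const_mul 2
  have h2 := ((ContinuousLinearMap.mul ℝ ℂ Complex.I).comp lcPos).hasFDerivAt (x := x)
  refine ((lcMom.hasFDerivAt (x := x)).fun_sub (h1.fun_smul h2)).congr_fderiv ?_
  refine ContinuousLinearMap.ext fun y => ?_
  simp
  left
  ring

theorem hasFDerivAt_lcHam (μ c : ℝ) {x : EuclideanSpace ℂ (Fin 2)} (hx : 1 + lcPos x ^ 2 ≠ 0) :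
    HasFDerivAt (lcHam μ c) (innerSL ℝ (lcGrad μ c x)) x := by
  have h1 := (hasFDerivAt_lcVel x).norm_sq.mul_const (2⁻¹ : ℝ)
  have h2 := ((hasFDerivAt_regU μ c hx).comp x (lcPos.hasFDerivAt (x := x))).const_mul 4
  refine (h1.fun_sub h2).congr_fderiv ?_
  refine ContinuousLinearMap.ext fun y => ?_
  simp only [innerSL_apply_apply, sub_apply, smul_apply, ContinuousLinearMap.comp_apply,
    add_apply, ContinuousLinearMap.smulRight_apply, ContinuousLinearMap.mul_apply', smul_eq_mul,
    nsmul_eq_mul]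
  rw [real_inner_comm y, lcGrad, inner_lcPair, lcForce]
  simp only [real_inner_complex, Complex.sub_re, Complex.sub_im, Complex.add_re, Complex.add_im,
    Complex.smul_re, Complex.smul_im, Complex.mul_re, Complex.mul_im, Complex.I_re, Complex.I_im,
    smul_eq_mul]
  push_cast
  ring

theorem continuousOn_lcGrad (μ c : ℝ) :
    ContinuousOn (lcGrad μ c) {x | 1 + lcPos x ^ 2 ≠ 0} := by
  have hv : Continuous lcVel := by
    unfold lcVel
    fun_prop
  have hg : ContinuousOn (fun x => gradU μ c (lcPos x)) {x | 1 + lcPos x ^ 2 ≠ 0} :=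
    (continuousOn_gradU μ c).comp lcPos.continuous.continuousOn fun x hx => hx
  have h1 : Continuous fun x => (-4 * inner ℝ (lcVel x) (Complex.I * lcPos x)) • lcPos x +
      (2 * ‖lcPos x‖ ^ 2) • (Complex.I * lcVel x) := by fun_prop
  exact continuous_lcPair.comp_continuousOn
    (hv.continuousOn.prodMk (h1.continuousOn.sub (hg.const_smul (4 : ℝ))))

theorem inner_lcGrad (μ c : ℝ) (x : EuclideanSpace ℂ (Fin 2)) : inner ℝ x (lcGrad μ c x) =
    ‖lcVel x‖ ^ 2 - 4 * ‖lcPos x‖ ^ 2 * inner ℝ (Complex.I * lcPos x) (lcVel x) -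
      4 * inner ℝ (lcPos x) (gradU μ c (lcPos x)) := by
  have h : lcMom x = lcVel x + (2 * ‖lcPos x‖ ^ 2) • (Complex.I * lcPos x) := by
    rw [lcVel]
    abel
  have h2 := Complex.normSq_apply (lcPos x)
  rw [Complex.normSq_eq_norm_sq] at h2
  rw [lcGrad, inner_lcPair, h, lcForce, ← Complex.normSq_eq_norm_sq (lcVel x),
    Complex.normSq_apply]
  simp only [real_inner_complex, Complex.sub_re, Complex.sub_im, Complex.add_re, Complex.add_im,
    Complex.smul_re, Complex.smul_im, Complex.mul_re, Complex.mul_im, Complex.I_re, Complex.I_im,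
    smul_eq_mul, h2]
  ring

theorem exists_regularized_bounds {μ c ρ₁ : ℝ} (hρ₁ : ρ₁ < 1) : ∃ M > (0 : ℝ),
    ∀ z : ℂ, ‖z‖ ^ 2 ≤ ρ₁ → |regR μ c z| ≤ M ∧ ‖gradU μ c z‖ ≤ 4 * M * ‖z‖ := by
  have hk : IsCompact {z : ℂ | ‖z‖ ^ 2 ≤ ρ₁} := by
    refine Metric.isCompact_of_isClosed_isBounded (isClosed_le (by fun_prop) (by fun_prop)) ?_
    refine (Metric.isBounded_closedBall (x := (0 : ℂ)) (r := 1)).subset fun z hz => ?_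
    have hz' : ‖z‖ ^ 2 ≤ ρ₁ := hz
    rw [mem_closedBall_zero_iff]
    nlinarith [norm_nonneg z]
  have hs : {z : ℂ | ‖z‖ ^ 2 ≤ ρ₁} ⊆ {z | 1 + z ^ 2 ≠ 0} := fun z hz =>
    one_add_sq_ne_zero (lt_of_le_of_lt hz hρ₁)
  obtain ⟨M₁, h1⟩ := hk.exists_bound_of_continuousOn ((continuousOn_regR μ c).mono hs)
  obtain ⟨M₂, h2⟩ := hk.exists_bound_of_continuousOn ((continuousOn_regH μ).mono hs)
  refine ⟨max 1 (max M₁ M₂), lt_of_lt_of_le one_pos (le_max_left _ _), fun z hz => ?_⟩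
  have h3 : |regR μ c z| ≤ max 1 (max M₁ M₂) :=
    (h1 z hz).trans ((le_max_left _ _).trans (le_max_right _ _))
  have h4 : ‖regH μ z‖ ≤ max 1 (max M₁ M₂) :=
    (h2 z hz).trans ((le_max_right _ _).trans (le_max_right _ _))
  have hz1 : ‖z‖ ^ 2 < 1 := lt_of_le_of_lt hz hρ₁
  refine ⟨h3, ?_⟩
  rw [gradU]
  refine (norm_add_le _ _).trans ?_
  rw [norm_smul, norm_smul, norm_mul (starRingEnd ℂ z), RCLike.norm_conj, Real.norm_eq_abs, Real.norm_eq_abs,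
    abs_mul, abs_mul, abs_two, abs_of_nonneg (sq_nonneg ‖z‖)]
  have h5 : |regR μ c z| * ‖z‖ ≤ max 1 (max M₁ M₂) * ‖z‖ := by gcongr
  have h6 : ‖z‖ ^ 2 * (‖z‖ * ‖regH μ z‖) ≤ 1 * (‖z‖ * max 1 (max M₁ M₂)) := by gcongr
  linarith

theorem exists_pos_smul_lcHam_eq_zero {μ c ρ₁ : ℝ} (hμ : μ ∈ Ioo (0 : ℝ) 1)
    (hρ₁ : ρ₁ ∈ Ioo (0 : ℝ) 1) (hc : ∀ C ∈ Icc (-1 : ℝ) 1, c < radialV μ C ρ₁)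
    {x : EuclideanSpace ℂ (Fin 2)} (hx : x ≠ 0) :
    ∃ s > (0 : ℝ), ‖lcPos (s • x)‖ ^ 2 < ρ₁ ∧ lcHam μ c (s • x) = 0 := by
  by_cases hz : lcPos x = 0
  · have hw : lcMom x ≠ 0 := fun h => hx (eq_zero_of_lcPos_of_lcMom hz h)
    have hn := norm_pos_iff.mpr hw
    have h8 : 0 < √(8 * μ) := Real.sqrt_pos.mpr (by linarith [hμ.1])
    refine ⟨√(8 * μ) / ‖lcMom x‖, by positivity, ?_, ?_⟩
    · simp [hz, hρ₁.1]
    · rw [lcHam, lcVel, map_smul, map_smul, hz, smul_zero, mul_zero, smul_zero, sub_zero,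
        norm_smul, Real.norm_of_nonneg (by positivity), div_mul_cancel₀ _ hn.ne',
        Real.sq_sqrt (by linarith [hμ.1]), regU]
      simp
      ring
  · have hn := norm_pos_iff.mpr hz
    have hr : 0 < √ρ₁ := Real.sqrt_pos.mpr hρ₁.1
    have hsz (s : ℝ) (hs : s ∈ Icc 0 (√ρ₁ / ‖lcPos x‖)) : ‖lcPos (s • x)‖ ≤ √ρ₁ := by
      rw [map_smul, norm_smul, Real.norm_of_nonneg hs.1]
      exact (le_div_iff₀ hn).mp hs.2
    have hsq (s : ℝ) (hs : s ∈ Icc 0 (√ρ₁ / ‖lcPos x‖)) : ‖lcPos (s • x)‖ ^ 2 ≤ ρ₁ := by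
      rw [← Real.sq_sqrt hρ₁.1.le]
      exact pow_le_pow_left₀ (norm_nonneg _) (hsz s hs) 2
    have h0 : lcHam μ c ((0 : ℝ) • x) < 0 := by
      simp [lcHam, lcVel, regU, hμ.1]
    have h1 : 0 < lcHam μ c ((√ρ₁ / ‖lcPos x‖) • x) := by
      have hne : lcPos ((√ρ₁ / ‖lcPos x‖) • x) ≠ 0 := by
        rw [map_smul]
        exact smul_ne_zero (by positivity) hz
      have hnn : ‖lcPos ((√ρ₁ / ‖lcPos x‖) • x)‖ ^ 2 = ρ₁ := by
        rw [map_smul, norm_smul, Real.norm_of_nonneg (by positivity), div_mul_cancel₀ _ hn.ne',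
          Real.sq_sqrt hρ₁.1.le]
      obtain ⟨e, he, hze⟩ := exists_unit_sq hne
      have h := regU_eq_radial (μ := μ) (c := c) hne he hze
      rw [hnn] at h
      rw [lcHam, h]
      nlinarith [sq_nonneg ‖lcVel ((√ρ₁ / ‖lcPos x‖) • x)‖,
        mul_pos hρ₁.1 (sub_pos.mpr (hc _ (re_mem_Icc he)))]
    have hcont : ContinuousOn (fun s : ℝ => lcHam μ c (s • x)) (Icc 0 (√ρ₁ / ‖lcPos x‖)) := by
      intro s hs
      have hd := hasFDerivAt_lcHam μ c (x := s • x)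
        (one_add_sq_ne_zero ((hsq s hs).trans_lt hρ₁.2))
      exact (ContinuousAt.comp (f := fun s : ℝ => s • x) hd.continuousAt
        (by fun_prop)).continuousWithinAt
    obtain ⟨s, hs, hs0⟩ := intermediate_value_Ioo (by positivity) hcont ⟨h0, h1⟩
    refine ⟨s, hs.1, ?_, hs0⟩
    rw [map_smul, norm_smul, Real.norm_of_nonneg hs.1.le, ← Real.sq_sqrt hρ₁.1.le]
    exact pow_lt_pow_left₀ ((lt_div_iff₀ hn).mp hs.2) (mul_nonneg hs.1.le hn.le) two_ne_zero

/-- Arbitrarily fast chords of the regularized flow from the collision fibre to itself. -/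
theorem exists_regularized_chord {μ c ρ₁ : ℝ} (hμ : μ ∈ Ioo (0 : ℝ) 1) (hρ₁ : ρ₁ ∈ Ioo (0 : ℝ) 1)
    (hL : ∀ ρ, 0 < ρ → ρ < ρ₁ → BelowL1 μ ρ) (hc : ∀ C ∈ Icc (-1 : ℝ) 1, c < radialV μ C ρ₁)
    (L : ℝ) : ∃ (a : ℝ → ℝ) (z v : ℝ → ℂ), z 0 = 0 ∧ z 1 = 0 ∧ ContinuousOn a (Icc 0 1) ∧
      ∀ t ∈ Icc (0 : ℝ) 1, L ≤ a t ∧ 0 < a t ∧ ‖z t‖ ^ 2 < ρ₁ ∧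
        ‖v t‖ ^ 2 = 8 * regU μ c (z t) ∧ HasDerivAt z (a t • v t) t ∧
        HasDerivAt v (a t • ((4 : ℝ) • gradU μ c (z t) -
          (8 * ‖z t‖ ^ 2) • (Complex.I * v t))) t := by
  let Ω : Set (EuclideanSpace ℂ (Fin 2)) := {x | ‖lcPos x‖ ^ 2 < ρ₁}
  have hreg (x) (hx : x ∈ Ω) : 1 + lcPos x ^ 2 ≠ 0 :=
    one_add_sq_ne_zero (lt_trans hx hρ₁.2)
  have hvel (x) (hx : lcHam μ c x = 0) : ‖lcVel x‖ ^ 2 = 8 * regU μ c (lcPos x) := by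
    rw [lcHam] at hx
    linarith
  have htrans (x) (hx : x ∈ Ω) (h0 : lcHam μ c x = 0) : 0 < inner ℝ x (lcGrad μ c x) := by
    rw [inner_lcGrad, hvel x h0]
    exact regularized_transversality hμ hρ₁.2 hL hc hx (hvel x h0)
  have hneg (x) : lcVel (-x) = -lcVel x := by
    simp [lcVel]
    ring
  obtain ⟨h, G, hh, hG, hhom, hpos, hlev⟩ :=
    exists_gauge_of_radial_transversality (K := lcHam μ c) (g := lcGrad μ c) (Ω := Ω)
      (isOpen_lt (by fun_prop) (by fun_prop))
      (fun x hx s hs => by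
        change ‖lcPos (s • x)‖ ^ 2 < ρ₁
        have hx' : ‖lcPos x‖ ^ 2 < ρ₁ := hx
        rw [map_smul, norm_smul, mul_pow, Real.norm_of_nonneg hs.1]
        have : s ^ 2 ≤ 1 := pow_le_one₀ hs.1 hs.2
        nlinarith [sq_nonneg ‖lcPos x‖])
      (fun x hx => by
        change ‖lcPos (-x)‖ ^ 2 < ρ₁
        rw [map_neg, norm_neg]
        exact hx)
      (fun x hx => hasFDerivAt_lcHam μ c (hreg x hx))
      ((continuousOn_lcGrad μ c).mono hreg)
      (fun x => by
        rw [lcHam, lcHam, hneg, norm_neg, map_neg, regU, regU, regR, regR, norm_neg, neg_sq])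
      htrans
      (fun x hx => exists_pos_smul_lcHam_eq_zero hμ hρ₁ hc hx)
  obtain ⟨M, hM, hbd⟩ := exists_regularized_bounds (μ := μ) (c := c) hρ₁.2
  obtain ⟨lam, hlam, ζ, hζc, hζ, hζ0, hζ1⟩ :=
    exists_hamiltonian_chord hh hG hhom hpos ((44 + 56 * M) * (|L| + 1))
  have hlam0 : 0 < lam := lt_of_lt_of_le (by positivity) hlam
  have hzero {x : EuclideanSpace ℂ (Fin 2)} (hx : ∀ i, (x i).im = 0) : lcPos x = 0 :=
    Complex.ext (hx 0) (hx 1)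
  refine ⟨fun t => lam * (2 / inner ℝ (ζ t) (lcGrad μ c (ζ t))), fun t => lcPos (ζ t),
    fun t => lcVel (ζ t), hzero hζ0, hzero hζ1, ?_, fun t ht => ?_⟩
  · have h1 : ContinuousOn (fun t => lcGrad μ c (ζ t)) (Icc 0 1) :=
      (continuousOn_lcGrad μ c).comp hζc.continuousOn
        fun t ht => hreg _ (hlev _ (hζ t ht).1).1
    refine continuousOn_const.mul (continuousOn_const.div (hζc.continuousOn.inner h1) ?_)
    exact fun t ht => (htrans _ (hlev _ (hζ t ht).1).1 (hlev _ (hζ t ht).1).2.1).ne'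
  · obtain ⟨hΩt, hKt, hGt⟩ := hlev _ (hζ t ht).1
    have hd := (hζ t ht).2
    have hp := htrans _ hΩt hKt
    have hv := hvel _ hKt
    have hz1 : ‖lcPos (ζ t)‖ ^ 2 < ρ₁ := hΩt
    have hle : inner ℝ (ζ t) (lcGrad μ c (ζ t)) ≤ 44 + 56 * M := by
      rw [inner_lcGrad]
      obtain ⟨hb1, hb2⟩ := hbd _ hz1.le
      have hn1 : ‖lcPos (ζ t)‖ ≤ 1 := by nlinarith [hρ₁.2, norm_nonneg (lcPos (ζ t))]
      have hU : regU μ c (lcPos (ζ t)) ≤ 1 + M := by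
        rw [regU]
        have h1 : ‖lcPos (ζ t)‖ ^ 2 * regR μ c (lcPos (ζ t)) ≤ 1 * M := by
          calc ‖lcPos (ζ t)‖ ^ 2 * regR μ c (lcPos (ζ t)) ≤ ‖lcPos (ζ t)‖ ^ 2 * M := by
                gcongr
                exact (le_abs_self _).trans hb1
            _ ≤ 1 * M := by
                gcongr
                exact hz1.le.trans hρ₁.2.le
        linarith [hμ.2]
      have hi1 : |inner ℝ (Complex.I * lcPos (ζ t)) (lcVel (ζ t))| ≤ ‖lcVel (ζ t)‖ := by
        refine (abs_real_inner_le_norm _ _).trans ?_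
        rw [norm_mul, Complex.norm_I, one_mul]
        nlinarith [norm_nonneg (lcVel (ζ t))]
      have hi2 : |inner ℝ (lcPos (ζ t)) (gradU μ c (lcPos (ζ t)))| ≤ 4 * M := by
        refine (abs_real_inner_le_norm _ _).trans ?_
        have : ‖lcPos (ζ t)‖ * ‖gradU μ c (lcPos (ζ t))‖ ≤ 1 * (4 * M * 1) := by
          refine mul_le_mul hn1 (hb2.trans ?_) (norm_nonneg _) one_pos.le
          gcongr
        linarith
      have hi3 : -(‖lcPos (ζ t)‖ ^ 2 * inner ℝ (Complex.I * lcPos (ζ t)) (lcVel (ζ t))) ≤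
          ‖lcVel (ζ t)‖ := by
        refine (neg_le_abs _).trans ?_
        rw [abs_mul, abs_of_nonneg (sq_nonneg _)]
        nlinarith [abs_nonneg (inner ℝ (Complex.I * lcPos (ζ t)) (lcVel (ζ t))), hρ₁.2,
          sq_nonneg ‖lcPos (ζ t)‖]
      have hi4 : ‖lcVel (ζ t)‖ ≤ 1 + ‖lcVel (ζ t)‖ ^ 2 := by
        nlinarith [sq_nonneg (‖lcVel (ζ t)‖ - 1)]
      have := (abs_le.mp hi2).1
      linarith
    beta_reduce
    have ha : |L| + 1 ≤ lam * (2 / inner ℝ (ζ t) (lcGrad μ c (ζ t))) := by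
      rw [mul_div_assoc', le_div_iff₀ hp]
      nlinarith [mul_le_mul_of_nonneg_left hle (add_nonneg (abs_nonneg L) zero_le_one)]
    generalize hadef : lam * (2 / inner ℝ (ζ t) (lcGrad μ c (ζ t))) = a at ha ⊢
    have hd' : HasDerivAt ζ (a • Complex.I • lcGrad μ c (ζ t)) t := by
      convert hd using 1
      rw [hGt, smul_smul, hadef, smul_comm]
    have hz' : HasDerivAt (fun t => lcPos (ζ t)) (a • lcVel (ζ t)) t := by
      have := lcPos.hasFDerivAt.comp_hasDerivAt t hd'
      rwa [map_smul, lcPos_I_smul, lcGrad, lcMom_lcPair] at this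
    have hv' := (hasFDerivAt_lcVel (ζ t)).comp_hasDerivAt t hd'
    refine ⟨(le_abs_self L).trans (by linarith), by linarith [abs_nonneg L], hz1, hv, hz',
      hv'.congr_deriv ?_⟩
    simp only [map_smul, sub_apply, add_apply, smul_apply, ContinuousLinearMap.comp_apply,
      ContinuousLinearMap.smulRight_apply, ContinuousLinearMap.mul_apply', innerSL_apply_apply,
      lcPos_I_smul, lcMom_I_smul, lcGrad, lcPos_lcPair, lcMom_lcPair]
    congr 1
    have h2 := Complex.normSq_apply (lcPos (ζ t))
    rw [Complex.normSq_eq_norm_sq] at h2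
    rw [lcForce, h2]
    apply Complex.ext <;>
    · simp only [real_inner_complex, Complex.sub_re, Complex.sub_im, Complex.add_re,
        Complex.add_im, Complex.neg_re, Complex.neg_im,
        Complex.smul_re, Complex.smul_im, Complex.mul_re, Complex.mul_im, Complex.I_re,
        Complex.I_im, smul_eq_mul]
      ring

end Chord

section TimeChange

theorem finite_zeros_of_hasDerivAt {K : Set ℝ} (hK : IsCompact K) {f f' : ℝ → ℂ}
    (hf : ∀ x ∈ K, HasDerivAt f (f' x) x) (h0 : ∀ x ∈ K, f x = 0 → f' x ≠ 0) :
    {x | x ∈ K ∧ f x = 0}.Finite := by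
  by_contra hinf
  obtain ⟨x, hx, hacc⟩ :=
    Set.Infinite.exists_accPt_of_subset_isCompact hinf hK fun y hy => hy.1
  have hev : ∀ᶠ y in nhdsWithin x {x}ᶜ, f y ≠ 0 := by
    by_cases hfx : f x = 0
    · exact (hf x hx).eventually_ne (h0 x hx hfx)
    · exact nhdsWithin_le_nhds ((hf x hx).continuousAt.eventually_ne hfx)
  rw [accPt_iff_frequently] at hacc
  rw [eventually_nhdsWithin_iff] at hev
  exact hacc (hev.mono fun y hy hy' => hy hy'.1 hy'.2.2)

/-- Reparametrization of the line by a density vanishing at finitely many points. -/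
theorem exists_timeChange {β : ℝ → ℝ} (hβ : Continuous β) (h0 : ∀ x, 0 ≤ β x)
    (hfin : {x | β x = 0}.Finite) (hge : ∀ x, 2 ≤ |x| → 1 ≤ β x) :
    ∃ τ : ℝ ≃o ℝ, τ 0 = 0 ∧ (∀ x, HasDerivAt τ.symm (β x) x) ∧
      ∀ t, β (τ t) ≠ 0 → HasDerivAt τ (β (τ t))⁻¹ t := by
  let T : ℝ → ℝ := fun x => ∫ s in (0 : ℝ)..x, β s
  have hT (x : ℝ) : HasDerivAt T (β x) x :=
    intervalIntegral.integral_hasDerivAt_right (hβ.intervalIntegrable _ _)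
      hβ.aestronglyMeasurable.stronglyMeasurableAtFilter hβ.continuousAt
  have hTc : Continuous T := continuous_iff_continuousAt.mpr fun x => (hT x).continuousAt
  have hmono : StrictMono T := by
    intro x y hxy
    have hpos : 0 < ∫ s in x..y, β s := by
      refine intervalIntegral.integral_pos hxy hβ.continuousOn (fun s _ => h0 s) ?_
      obtain ⟨s, hs, hs'⟩ := ((Icc_infinite hxy).sdiff hfin).nonempty
      exact ⟨s, hs, lt_of_le_of_ne (h0 s) (Ne.symm hs')⟩
    have := intervalIntegral.integral_add_adjacent_intervals
      (hβ.intervalIntegrable 0 x) (hβ.intervalIntegrable (μ := MeasureTheory.volume) x y)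
    change (∫ s in (0 : ℝ)..x, β s) < ∫ s in (0 : ℝ)..y, β s
    linarith
  have hlow {x y : ℝ} (hxy : x ≤ y) (h : ∀ s ∈ Icc x y, 1 ≤ β s) : y - x ≤ T y - T x := by
    have h1 : ∫ _ in x..y, (1 : ℝ) ≤ ∫ s in x..y, β s :=
      intervalIntegral.integral_mono_on hxy (by simp) (hβ.intervalIntegrable _ _) h
    have := intervalIntegral.integral_interval_sub_left
      (hβ.intervalIntegrable (μ := MeasureTheory.volume) 0 y) (hβ.intervalIntegrable 0 x)
    change y - x ≤ (∫ s in (0 : ℝ)..y, β s) - ∫ s in (0 : ℝ)..x, β s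
    rw [this]
    simpa using h1
  have htop : Tendsto T atTop atTop := by
    refine tendsto_atTop_mono' atTop ?_ (tendsto_atTop_add_const_right atTop (T 2 - 2) tendsto_id)
    filter_upwards [eventually_ge_atTop 2] with x hx
    have := hlow hx fun s hs => hge s (hs.1.trans (le_abs_self s))
    simp only [id]
    linarith
  have hbot : Tendsto T atBot atBot := by
    refine tendsto_atBot_mono' atBot ?_
      (tendsto_atBot_add_const_right atBot (T (-2) + 2) tendsto_id)
    filter_upwards [eventually_le_atBot (-2)] with x hx
    have := hlow hx fun s hs => hge s (by rw [abs_of_nonpos (by linarith [hs.2])]; linarith [hs.2])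
    simp only [id]
    linarith
  let e : ℝ ≃o ℝ := hmono.orderIsoOfSurjective T (hTc.surjective htop hbot)
  have he (x : ℝ) : e x = T x := rfl
  refine ⟨e.symm, ?_, fun x => ?_, fun t ht => ?_⟩
  · rw [OrderIso.symm_apply_eq, he]
    exact (intervalIntegral.integral_same).symm
  · exact hT x
  · exact (hT (e.symm t)).of_local_left_inverse e.symm.continuous.continuousAt ht
      (Eventually.of_forall fun y => e.apply_symm_apply y)

end TimeChange

section PhysicalOrbit

open scoped ComplexConjugate

theorem physical_acceleration {μ c : ℝ} {z v : ℂ} (hz : z ≠ 0) (hv : ‖v‖ ^ 2 = 8 * regU μ c z) :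
    (8 * ‖z‖ ^ 2 : ℝ)⁻¹ • (((4 : ℝ) • gradU μ c z - (8 * ‖z‖ ^ 2) • (Complex.I * v)) / conj z -
        v * conj v / conj z ^ 2) =
      -2 * Complex.I * (v / (2 * conj z)) - gradV μ (1 + z ^ 2) := by
  have hc : conj z ≠ 0 := (map_ne_zero _).mpr hz
  have hvv : v * conj v = ((8 * regU μ c z : ℝ) : ℂ) := by
    rw [Complex.mul_conj, Complex.normSq_eq_norm_sq, hv]
  have hn : ((‖z‖ ^ 2 : ℝ) : ℂ) = z * conj z := by
    rw [Complex.mul_conj, Complex.normSq_eq_norm_sq]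
  have hq : 1 + z ^ 2 - 1 = z ^ 2 := by ring
  have hn3 : ((μ / (‖z‖ ^ 2) ^ 3 : ℝ) : ℂ) = μ / (z * conj z) ^ 3 := by
    rw [← hn]
    push_cast
    rfl
  rw [hvv, gradU, gradV, regH, regU, hq, norm_pow]
  simp only [Complex.real_smul]
  rw [hn3]
  generalize ((1 - μ) / ‖1 + z ^ 2‖ ^ 3 : ℝ) = k
  generalize regR μ c z = R
  push_cast
  push_cast at hn
  rw [hn]
  field_simp
  ring

theorem physical_energy {μ c : ℝ} {z v : ℂ} (hz : z ≠ 0) (hv : ‖v‖ ^ 2 = 8 * regU μ c z) :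
    ‖v / (2 * conj z)‖ ^ 2 / 2 + V μ ((1 + z ^ 2).re, (1 + z ^ 2).im) = c := by
  obtain ⟨e, he, hze⟩ := exists_unit_sq hz
  have hn : 0 < ‖z‖ ^ 2 := pow_pos (norm_pos_iff.mpr hz) 2
  have h2 : ‖2 * conj z‖ = 2 * ‖z‖ := by
    rw [norm_mul, RCLike.norm_conj]
    simp
  rw [norm_div, h2, div_pow, hv, regU_eq_radial hz he hze, hze, V_one_add_smul μ hn.le he]
  field_simp
  ring

theorem physical_mem_KSetE {μ c ρ₁ : ℝ} (hμ : μ ∈ Ioo (0 : ℝ) 1) (hρ₁ : ρ₁ < 1)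
    (hL : ∀ ρ, 0 < ρ → ρ < ρ₁ → BelowL1 μ ρ) {z v : ℂ} (hz : z ≠ 0) (hzρ : ‖z‖ ^ 2 < ρ₁)
    (hv : ‖v‖ ^ 2 = 8 * regU μ c z) :
    ((1 + z ^ 2).re, (1 + z ^ 2).im) ∈ KSetE μ c := by
  obtain ⟨e, he, hze⟩ := exists_unit_sq hz
  have hn : 0 < ‖z‖ ^ 2 := pow_pos (norm_pos_iff.mpr hz) 2
  have hU := regU_eq_radial (μ := μ) (c := c) hz he hze
  rw [hze]
  refine mem_KSetE hμ hρ₁ hL hn hzρ he ?_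
  have : 0 ≤ regU μ c z := by nlinarith [sq_nonneg ‖v‖]
  rw [hU] at this
  linarith [nonneg_of_mul_nonneg_right this hn]

theorem hasDerivAt_physical {μ c a t : ℝ} {z v : ℝ → ℂ} {τ : ℝ → ℝ}
    (hz : HasDerivAt z (a • v (τ t)) (τ t))
    (hv : HasDerivAt v (a • ((4 : ℝ) • gradU μ c (z (τ t)) -
      (8 * ‖z (τ t)‖ ^ 2) • (Complex.I * v (τ t)))) (τ t))
    (hτ : HasDerivAt τ (4 * ‖z (τ t)‖ ^ 2 * a)⁻¹ t) (ha : a ≠ 0) (h0 : z (τ t) ≠ 0)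
    (hvn : ‖v (τ t)‖ ^ 2 = 8 * regU μ c (z (τ t))) :
    HasDerivAt (fun t => 1 + z (τ t) ^ 2) (v (τ t) / (2 * conj (z (τ t)))) t ∧
    HasDerivAt (fun t => v (τ t) / (2 * conj (z (τ t))))
      (-2 * Complex.I * (v (τ t) / (2 * conj (z (τ t)))) - gradV μ (1 + z (τ t) ^ 2)) t := by
  have h1 := hz.scomp t hτ
  have h2 := hv.scomp t hτ
  have hc : conj (z (τ t)) ≠ 0 := (map_ne_zero _).mpr h0
  have hn : ((‖z (τ t)‖ ^ 2 : ℝ) : ℂ) = z (τ t) * conj (z (τ t)) := by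
    rw [Complex.mul_conj, Complex.normSq_eq_norm_sq]
  have hn0 : ‖z (τ t)‖ ≠ 0 := norm_ne_zero_iff.mpr h0
  have hac : (a : ℂ) ≠ 0 := Complex.ofReal_ne_zero.mpr ha
  have h3 : HasDerivAt (fun t => conj (z (τ t)))
      (conj ((4 * ‖z (τ t)‖ ^ 2 * a)⁻¹ • a • v (τ t))) t :=
    Complex.conjCLE.toContinuousLinearMap.hasFDerivAt.comp_hasDerivAt t h1
  constructor
  · refine ((h1.fun_pow 2).const_add 1).congr_deriv ?_
    simp only [Function.comp_apply, Complex.real_smul]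
    push_cast
    push_cast at hn
    rw [hn]
    field_simp
    norm_num
  · rw [← physical_acceleration h0 hvn]
    refine (h2.fun_div (h3.const_mul 2) (mul_ne_zero two_ne_zero hc)).congr_deriv ?_
    simp only [Function.comp_apply, Complex.real_smul, map_mul, Complex.conj_ofReal]
    generalize gradU μ c (z (τ t)) = g
    push_cast
    push_cast at hn
    rw [hn]
    field_simp
    ring

/-- In complex notation, `Q` satisfies the equations of motion with velocity `P` and energy `c` at
time `t`. -/
def SolvesAt (μ c : ℝ) (Q P : ℝ → ℂ) (t : ℝ) : Prop :=
  HasDerivAt Q (P t) t ∧ HasDerivAt P (-2 * Complex.I * P t - gradV μ (Q t)) t ∧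
    ‖P t‖ ^ 2 / 2 + V μ ((Q t).re, (Q t).im) = c ∧ ((Q t).re, (Q t).im) ∈ KSetE μ c

/-- `Q` collides with `E` at time `t` with direction `D`. -/
def HasCollisionDirection (Q : ℝ → ℂ) (t : ℝ) (D : ℂ) : Prop :=
  D ≠ 0 ∧ Tendsto (fun s => ‖Q s - 1‖⁻¹ • (Q s - 1)) (nhdsWithin t {t}ᶜ) (nhds D)

/-- A solution arc with collisions at both ends and regular collisions in between. -/
def IsCollisionArc (μ c T : ℝ) (Q P : ℝ → ℂ) : Prop :=
  ContinuousOn Q (Icc 0 T) ∧ Q 0 = 1 ∧ Q T = 1 ∧ {t | t ∈ Icc 0 T ∧ Q t = 1}.Finite ∧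
  (∀ t ∈ Icc 0 T, Q t = 1 → ∃ D, HasCollisionDirection Q t D) ∧
  ∀ t ∈ Icc 0 T, Q t ≠ 1 → SolvesAt μ c Q P t

theorem tendsto_direction_sq {z : ℝ → ℂ} {z' : ℂ} {s : ℝ} (hz : HasDerivAt z z' s)
    (h0 : z s = 0) (hz' : z' ≠ 0) :
    Tendsto (fun y => ‖z y ^ 2‖⁻¹ • z y ^ 2) (nhdsWithin s {s}ᶜ)
      (nhds (‖z' ^ 2‖⁻¹ • z' ^ 2)) := by
  have h1 := hasDerivAt_iff_tendsto_slope.mp hz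
  have h2 : Tendsto (fun y => ‖slope z s y ^ 2‖⁻¹ • slope z s y ^ 2) (nhdsWithin s {s}ᶜ)
      (nhds (‖z' ^ 2‖⁻¹ • z' ^ 2)) :=
    ((h1.pow 2).norm.inv₀ (norm_ne_zero_iff.mpr (pow_ne_zero 2 hz'))).smul (h1.pow 2)
  refine h2.congr' ?_
  filter_upwards [self_mem_nhdsWithin] with y hy
  have hy' : y - s ≠ 0 := sub_ne_zero.mpr hy
  rw [slope_def_module, h0, sub_zero, smul_pow, norm_smul, mul_inv, smul_smul, norm_pow,
    norm_inv, Real.norm_eq_abs, inv_pow, inv_inv, sq_abs, inv_pow, mul_comm, ← mul_assoc,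
    inv_mul_cancel₀ (pow_ne_zero 2 hy'), one_mul]

/-- There are collision arcs of arbitrarily long duration. -/
theorem exists_collisionArc {μ c : ℝ} (hμ : μ ∈ Ioo (0 : ℝ) 1) (hc : c < firstCriticalValue μ)
    (L : ℝ) : ∃ T Q P, L ≤ T ∧ 0 < T ∧ IsCollisionArc μ c T Q P := by
  obtain ⟨ρ₁, hρ₁, hL1, hrad⟩ := exists_hill_radius hμ hc
  obtain ⟨M, hM, hbd⟩ := exists_regularized_bounds (μ := μ) (c := c) hρ₁.2
  obtain ⟨a, z, v, hz0, hz1, hac, hsol⟩ := exists_regularized_chord hμ hρ₁ hL1 hrad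
    ((72 + 88 * M) * |L| / (32 * μ))
  have hproj : Continuous fun x : ℝ => (projIcc (0 : ℝ) 1 zero_le_one x : ℝ) :=
    continuous_subtype_val.comp continuous_projIcc
  have hzc : ContinuousOn z (Icc 0 1) := fun t ht =>
    (hsol t ht).2.2.2.2.1.continuousAt.continuousWithinAt
  let b : ℝ → ℝ := fun s => 4 * ‖z s‖ ^ 2 * a s
  have hbc : ContinuousOn b (Icc 0 1) := (continuousOn_const.mul (hzc.norm.pow 2)).mul hac
  have hb0 (s : ℝ) (hs : s ∈ Icc (0 : ℝ) 1) : 0 ≤ b s :=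
    mul_nonneg (by positivity) (hsol s hs).2.1.le
  let β : ℝ → ℝ := fun x => b (projIcc (0 : ℝ) 1 zero_le_one x) +
    |x - projIcc (0 : ℝ) 1 zero_le_one x|
  have hβ : Continuous β :=
    (hbc.comp_continuous hproj fun x => (projIcc (0 : ℝ) 1 zero_le_one x).2).add
      (continuous_id.sub hproj).abs
  have hβin {s : ℝ} (hs : s ∈ Icc (0 : ℝ) 1) : β s = b s := by
    change b (projIcc (0 : ℝ) 1 zero_le_one s) + |s - projIcc (0 : ℝ) 1 zero_le_one s| = b s
    rw [projIcc_of_mem zero_le_one hs]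
    simp
  have hβ0 (x : ℝ) : 0 ≤ β x :=
    add_nonneg (hb0 _ (projIcc (0 : ℝ) 1 zero_le_one x).2) (abs_nonneg _)
  have hv0 {s : ℝ} (hs : s ∈ Icc (0 : ℝ) 1) (h0 : z s = 0) : a s • v s ≠ 0 := by
    have h := (hsol s hs).2.2.2.1
    refine smul_ne_zero (hsol s hs).2.1.ne' fun hv => ?_
    rw [hv, h0, regU] at h
    simp at h
    exact hμ.1.ne' h
  have hfin : {s | s ∈ Icc (0 : ℝ) 1 ∧ z s = 0}.Finite :=
    finite_zeros_of_hasDerivAt isCompact_Icc (fun s hs => (hsol s hs).2.2.2.2.1)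
      fun s hs h0 => hv0 hs h0
  have hβne {s : ℝ} (hs : s ∈ Icc (0 : ℝ) 1) (h0 : z s ≠ 0) : β s ≠ 0 := by
    rw [hβin hs]
    have := (hsol s hs).2.1
    have := norm_pos_iff.mpr h0
    positivity
  obtain ⟨τ, hτ0, hτs, hτ⟩ := exists_timeChange hβ hβ0
    (hfin.subset fun x hx => by
      have h2 : x = projIcc (0 : ℝ) 1 zero_le_one x := by
        have hx' : b (projIcc (0 : ℝ) 1 zero_le_one x) +
          |x - projIcc (0 : ℝ) 1 zero_le_one x| = 0 := hx
        have h3 := abs_nonneg (x - projIcc (0 : ℝ) 1 zero_le_one x)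
        have h4 := hb0 _ (projIcc (0 : ℝ) 1 zero_le_one x).2
        exact sub_eq_zero.mp (abs_eq_zero.mp (by linarith))
      have h1 : x ∈ Icc (0 : ℝ) 1 := by
        rw [h2]
        exact (projIcc (0 : ℝ) 1 zero_le_one x).2
      refine ⟨h1, ?_⟩
      by_contra h0
      exact hβne h1 h0 hx)
    (fun x hx => by
      have h := (projIcc (0 : ℝ) 1 zero_le_one x).2
      have h1 := hb0 _ h
      change 1 ≤ b (projIcc (0 : ℝ) 1 zero_le_one x) + |x - projIcc (0 : ℝ) 1 zero_le_one x|
      have h2 := abs_sub_abs_le_abs_sub x (projIcc (0 : ℝ) 1 zero_le_one x)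
      rw [abs_of_nonneg h.1] at h2
      linarith [h.2])
  have hT0 : τ.symm 0 = 0 := by rw [OrderIso.symm_apply_eq, hτ0]
  have hTpos : 0 < τ.symm 1 := by
    rw [← hT0]
    exact τ.symm.strictMono one_pos
  have hmem {t : ℝ} (ht : t ∈ Icc 0 (τ.symm 1)) : τ t ∈ Icc (0 : ℝ) 1 := by
    refine ⟨?_, (τ.le_symm_apply).mp ht.2⟩
    rw [← hτ0]
    exact τ.monotone ht.1
  have hone {t : ℝ} (h : 1 + z (τ t) ^ 2 = 1) : z (τ t) = 0 :=
    pow_eq_zero_iff two_ne_zero |>.mp (by linear_combination h)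
  refine ⟨τ.symm 1, fun t => 1 + z (τ t) ^ 2, fun t => v (τ t) / (2 * conj (z (τ t))), ?_, hTpos,
    ?_, ?_, ?_, ?_, fun t ht h1 => ?_, fun t ht h1 => ?_⟩
  · by_contra! hlt
    have hmono : MonotoneOn (fun s => inner ℝ (z s) (v s) + (72 + 88 * M) / 4 * τ.symm s -
        8 * μ * ((72 + 88 * M) * |L| / (32 * μ)) * s) (Icc (0 : ℝ) 1) := by
      have hder (s : ℝ) (hs : s ∈ Icc (0 : ℝ) 1) := (((hsol s hs).2.2.2.2.1.inner ℝ
        (hsol s hs).2.2.2.2.2).fun_add ((hτs s).const_mul ((72 + 88 * M) / 4))).fun_sub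
        ((hasDerivAt_id s).const_mul (8 * μ * ((72 + 88 * M) * |L| / (32 * μ))))
      refine monotoneOn_of_hasDerivWithinAt_nonneg (convex_Icc 0 1)
        (fun s hs => (hder s hs).continuousAt.continuousWithinAt)
        (fun s hs => (hder s (interior_subset hs)).hasDerivWithinAt) fun s hs => ?_
      have hs := interior_subset hs
      obtain ⟨ha, ha0, hzρ, hvn, -, -⟩ := hsol s hs
      obtain ⟨hb1, hb2⟩ := hbd _ hzρ.le
      rw [hβin hs]
      have hz1 : ‖z s‖ ^ 2 ≤ 1 := hzρ.le.trans hρ₁.2.le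
      have hU1 : μ - M * ‖z s‖ ^ 2 ≤ regU μ c (z s) := by
        rw [regU]
        nlinarith [neg_le_of_abs_le hb1, sq_nonneg ‖z s‖]
      have hU2 : regU μ c (z s) ≤ 1 + M := by
        rw [regU]
        nlinarith [le_of_abs_le hb1, sq_nonneg ‖z s‖, hμ.2]
      have hi1 : -(4 * M * ‖z s‖ ^ 2) ≤ inner ℝ (z s) (gradU μ c (z s)) := by
        refine neg_le_of_abs_le ((abs_real_inner_le_norm _ _).trans ?_)
        nlinarith [norm_nonneg (z s)]
      have hi2 : inner ℝ (z s) (Complex.I * v s) ≤ 9 + 8 * M := by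
        refine (real_inner_le_norm _ _).trans ?_
        rw [norm_mul, Complex.norm_I, one_mul]
        nlinarith [norm_nonneg (z s), norm_nonneg (v s), sq_nonneg (‖z s‖ - ‖v s‖)]
      have hkey : 8 * μ ≤ ‖v s‖ ^ 2 + inner ℝ (z s) ((4 : ℝ) • gradU μ c (z s) -
          (8 * ‖z s‖ ^ 2) • (Complex.I * v s)) + (72 + 88 * M) * ‖z s‖ ^ 2 := by
        rw [inner_sub_right, inner_smul_right, inner_smul_right, hvn]
        nlinarith [mul_le_mul_of_nonneg_left hi2 (sq_nonneg ‖z s‖)]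
      have h8 : 8 * μ * ((72 + 88 * M) * |L| / (32 * μ)) ≤ 8 * μ * a s :=
        mul_le_mul_of_nonneg_left ha (by linarith [hμ.1])
      rw [inner_smul_right, real_inner_smul_left, real_inner_self_eq_norm_sq]
      change 0 ≤ _ + (72 + 88 * M) / 4 * (4 * ‖z s‖ ^ 2 * a s) - _
      nlinarith [mul_le_mul_of_nonneg_left hkey ha0.le]
    have h01 := hmono (left_mem_Icc.mpr zero_le_one) (right_mem_Icc.mpr zero_le_one) zero_le_one
    simp only [hz0, hz1, inner_zero_left, hT0] at h01
    have h2 : 8 * μ * ((72 + 88 * M) * |L| / (32 * μ)) = (72 + 88 * M) / 4 * |L| := by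
      have := hμ.1.ne'
      field_simp
      ring
    rw [h2] at h01
    nlinarith [le_abs_self L]
  · exact continuousOn_const.add ((hzc.comp τ.continuous.continuousOn fun t ht => hmem ht).pow 2)
  · simp [hτ0, hz0]
  · simp [hz1]
  · refine (hfin.image τ.symm).subset fun t ht => ⟨τ t, ⟨hmem ht.1, hone ht.2⟩, ?_⟩
    exact τ.symm_apply_apply t
  · refine ⟨_, ?_, ((tendsto_direction_sq (hsol _ (hmem ht)).2.2.2.2.1 (hone h1)
      (hv0 (hmem ht) (hone h1))).comp (tendsto_nhdsWithin_iff.mpr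
        ⟨τ.continuous.continuousAt.tendsto.mono_left nhdsWithin_le_nhds, ?_⟩)).congr fun s => ?_⟩
    · have hd := pow_ne_zero 2 (hv0 (hmem ht) (hone h1))
      exact smul_ne_zero (inv_ne_zero (norm_ne_zero_iff.mpr hd)) hd
    · filter_upwards [self_mem_nhdsWithin] with s hs
      exact fun h => hs (τ.injective h)
    · simp
  · have h0 : z (τ t) ≠ 0 := fun h => h1 (by simp [h])
    obtain ⟨ha, ha0, hzρ, hvn, hdz, hdv⟩ := hsol _ (hmem ht)
    have hd := hτ t (hβne (hmem ht) h0)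
    rw [hβin (hmem ht)] at hd
    obtain ⟨hQ, hP⟩ := hasDerivAt_physical hdz hdv hd ha0.ne' h0 hvn
    exact ⟨hQ, hP, physical_energy h0 hvn, physical_mem_KSetE hμ hρ₁.2 hL1 h0 hzρ hvn⟩

end PhysicalOrbit

section Pairs

theorem hasDerivAt_pair {f : ℝ → ℂ} {f' : ℂ} {t : ℝ} (h : HasDerivAt f f' t) :
    HasDerivAt (fun s => ((f s).re, (f s).im)) (f'.re, f'.im) t :=
  Complex.equivRealProdCLM.toContinuousLinearMap.hasFDerivAt.comp_hasDerivAt t h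

theorem continuous_pair : Continuous fun w : ℂ => (w.re, w.im) :=
  Complex.continuous_re.prodMk Complex.continuous_im

theorem pair_eq_iff {w : ℂ} : (w.re, w.im) = ((1, 0) : ℝ × ℝ) ↔ w = 1 := by
  rw [Prod.mk.injEq, Complex.ext_iff, Complex.one_re, Complex.one_im]

theorem SolvesAt.ne_zero {μ c : ℝ} {Q P : ℝ → ℂ} {t : ℝ} (h : SolvesAt μ c Q P t) : Q t ≠ 0 := by
  intro h0
  refine h.2.2.2.1.1 ?_
  simp [h0]

theorem SolvesAt.ne_one {μ c : ℝ} {Q P : ℝ → ℂ} {t : ℝ} (h : SolvesAt μ c Q P t) : Q t ≠ 1 :=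
  fun h1 => h.2.2.2.1.2.1 (pair_eq_iff.mpr h1)

theorem SolvesAt.equations {μ c : ℝ} {Q P : ℝ → ℂ} {t : ℝ} (h : SolvesAt μ c Q P t) :
    (-2 * Complex.I * P t - gradV μ (Q t)).re - 2 * (P t).im =
      -((fderiv ℝ (V μ) ((Q t).re, (Q t).im)) (1, 0)) ∧
    (-2 * Complex.I * P t - gradV μ (Q t)).im + 2 * (P t).re =
      -((fderiv ℝ (V μ) ((Q t).re, (Q t).im)) (0, 1)) := by
  rw [(hasFDerivAt_V μ h.ne_zero h.ne_one).fderiv]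
  constructor
  · simp
  · simp
    ring

theorem SolvesAt.continuousAt_acceleration {μ c : ℝ} {Q P : ℝ → ℂ} {t : ℝ}
    (h : SolvesAt μ c Q P t) :
    ContinuousAt (fun s => -2 * Complex.I * P s - gradV μ (Q s)) t := by
  have hP := h.2.1.continuousAt
  have hQ := h.1.continuousAt
  have h1 : ContinuousAt (fun s => μ / ‖Q s - 1‖ ^ 3) t :=
    continuousAt_const.div ((hQ.sub continuousAt_const).norm.pow 3)
      (pow_ne_zero 3 (norm_ne_zero_iff.mpr (sub_ne_zero.mpr h.ne_one)))
  have h2 : ContinuousAt (fun s => (1 - μ) / ‖Q s‖ ^ 3) t :=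
    continuousAt_const.div (hQ.norm.pow 3) (pow_ne_zero 3 (norm_ne_zero_iff.mpr h.ne_zero))
  unfold gradV
  exact (continuousAt_const.mul hP).sub (((hQ.sub continuousAt_const).neg.add
    (h1.smul (hQ.sub continuousAt_const))).add (h2.smul hQ))

theorem SolvesAt.comp_add_const {μ c : ℝ} {Q P : ℝ → ℂ} {t s : ℝ}
    (h : SolvesAt μ c Q P (t + s)) :
    SolvesAt μ c (fun x => Q (x + s)) (fun x => P (x + s)) t :=
  ⟨h.1.comp_add_const t s, h.2.1.comp_add_const t s, h.2.2⟩

theorem SolvesAt.congr {μ c : ℝ} {Q P Q₁ P₁ : ℝ → ℂ} {t : ℝ}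
    (h : SolvesAt μ c Q P t) (hQ : Q₁ =ᶠ[nhds t] Q) (hP : P₁ =ᶠ[nhds t] P) :
    SolvesAt μ c Q₁ P₁ t := by
  unfold SolvesAt
  rw [hQ.eq_of_nhds, hP.eq_of_nhds]
  exact ⟨h.1.congr_of_eventuallyEq hQ, h.2.1.congr_of_eventuallyEq hP, h.2.2⟩

theorem HasCollisionDirection.comp_add_const {Q : ℝ → ℂ} {t s : ℝ} {D : ℂ}
    (h : HasCollisionDirection Q (t + s) D) :
    HasCollisionDirection (fun x => Q (x + s)) t D := by
  refine ⟨h.1, h.2.comp (tendsto_nhdsWithin_iff.mpr ⟨?_, ?_⟩)⟩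
  · exact ((continuous_add_const s).tendsto t).mono_left nhdsWithin_le_nhds
  · filter_upwards [self_mem_nhdsWithin] with x hx
    exact fun h => hx (add_right_cancel h)

theorem HasCollisionDirection.eventually_ne {Q : ℝ → ℂ} {t : ℝ} {D : ℂ}
    (h : HasCollisionDirection Q t D) : ∀ᶠ s in nhdsWithin t {t}ᶜ, Q s ≠ 1 := by
  filter_upwards [h.2.eventually_ne h.1] with s hs h1
  simp [h1] at hs

end Pairs

section Consecutive

open Classical in
/-- The piece of `Q` on a time interval of length `l` starting at `s`, as an orbit in the plane. -/
noncomputable def arcPiece (Q : ℝ → ℂ) (s l t : ℝ) : ℝ × ℝ :=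
  if t ∈ Ioo 0 l then ((Q (t + s)).re, (Q (t + s)).im) else (1, 0)

theorem arcPiece_eventuallyEq (Q : ℝ → ℂ) {s l t : ℝ} (ht : t ∈ Ioo 0 l) :
    arcPiece Q s l =ᶠ[nhds t] fun t => ((Q (t + s)).re, (Q (t + s)).im) := by
  filter_upwards [isOpen_Ioo.mem_nhds ht] with x hx
  exact if_pos hx

theorem isCCOE_arcPiece {μ c T : ℝ} {Q P : ℝ → ℂ} (hQ : IsCollisionArc μ c T Q P) {s s' : ℝ}
    (hs : s ∈ Icc 0 T) (hs' : s' ∈ Icc 0 T) (hss : s < s') (h1 : Q s = 1) (h1' : Q s' = 1)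
    (hne : ∀ u ∈ Ioo s s', Q u ≠ 1) :
    IsCCOE μ c (s' - s) (arcPiece Q s (s' - s)) := by
  obtain ⟨hc, -, -, -, -, hsol⟩ := hQ
  have hl : 0 < s' - s := sub_pos.mpr hss
  have hS (t : ℝ) (ht : t ∈ Ioo 0 (s' - s)) :
      SolvesAt μ c (fun x => Q (x + s)) (fun x => P (x + s)) t :=
    SolvesAt.comp_add_const (hsol _ ⟨by linarith [hs.1, ht.1], by linarith [hs'.2, ht.2]⟩
      (hne _ ⟨by linarith [ht.1], by linarith [ht.2]⟩))
  have heq {t : ℝ} (ht : t ∈ Ioo 0 (s' - s)) :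
      arcPiece Q s (s' - s) t = ((Q (t + s)).re, (Q (t + s)).im) := if_pos ht
  have hlim {F : Filter ℝ} {x y : ℝ} (hy : y ∈ Icc 0 T) (hy1 : Q y = 1) (hxy : x + s = y)
      (hF : F ≤ nhds x) (hF' : ∀ᶠ t in F, t ∈ Ioo 0 (s' - s)) :
      Tendsto (arcPiece Q s (s' - s)) F (nhds (1, 0)) := by
    have h2 : Tendsto (fun t => t + s) F (nhdsWithin y (Icc 0 T)) := by
      refine tendsto_nhdsWithin_iff.mpr ⟨?_, hF'.mono fun t ht =>
        ⟨by linarith [hs.1, ht.1], by linarith [hs'.2, ht.2]⟩⟩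
      rw [← hxy]
      exact ((continuous_add_const s).tendsto x).mono_left hF
    have h3 := (continuous_pair.tendsto _).comp ((hc y hy).tendsto.comp h2)
    rw [hy1] at h3
    exact h3.congr' (hF'.mono fun t ht => (heq ht).symm)
  refine ⟨hl, fun t => ((P (t + s)).re, (P (t + s)).im),
    fun t => ((-2 * Complex.I * P (t + s) - gradV μ (Q (t + s))).re,
      (-2 * Complex.I * P (t + s) - gradV μ (Q (t + s))).im), fun t ht => ?_, fun t ht => ?_,
    fun t ht => ?_, fun t ht => ?_, fun t ht => ?_, fun t ht => ?_, ?_, ?_⟩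
  · exact (hasDerivAt_pair (hS t ht).1).congr_of_eventuallyEq (arcPiece_eventuallyEq Q ht)
  · exact hasDerivAt_pair (hS t ht).2.1
  · exact (continuous_pair.continuousAt.comp
      (hS t ht).continuousAt_acceleration).continuousWithinAt
  · rw [heq ht]
    exact (hS t ht).2.2.2
  · rw [heq ht]
    exact (hS t ht).equations
  · rw [heq ht, nrm_eq_norm]
    exact (hS t ht).2.2.1
  · exact hlim hs h1 (zero_add s) nhdsWithin_le_nhds (Ioo_mem_nhdsGT hl)
  · exact hlim hs' h1' (sub_add_cancel s' s) nhdsWithin_le_nhds (Ioo_mem_nhdsLT hl)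

theorem direction_eq_of_arcPiece_eq {Q : ℝ → ℂ} {s s' l : ℝ} {D D' : ℂ} (hl : 0 < l)
    (hD : HasCollisionDirection Q s D) (hD' : HasCollisionDirection Q s' D')
    (h : arcPiece Q s l = arcPiece Q s' l) : D = D' := by
  have hlim {s : ℝ} {D : ℂ} (hD : HasCollisionDirection Q s D) : Tendsto
      (fun t => ‖Q (t + s) - 1‖⁻¹ • (Q (t + s) - 1)) (nhdsWithin 0 (Ioi 0)) (nhds D) := by
    rw [← zero_add s] at hD
    exact hD.comp_add_const.2.mono_left (nhdsWithin_mono 0 fun x hx => (ne_of_gt hx))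
  refine tendsto_nhds_unique (hlim hD) ((hlim hD').congr' ?_)
  filter_upwards [Ioo_mem_nhdsGT hl] with t ht
  have h2 := congrFun h t
  rw [arcPiece, arcPiece, if_pos ht, if_pos ht, Prod.mk.injEq, ← Complex.ext_iff] at h2
  rw [h2]

end Consecutive

section Periodic

theorem isPCOE_of_direction_eq {μ c T : ℝ} {Q P : ℝ → ℂ} (hQ : IsCollisionArc μ c T Q P) {s s' : ℝ}
    (hs : s ∈ Icc 0 T) (hs' : s' ∈ Icc 0 T) (hss : s < s') (h1 : Q s = 1) (h1' : Q s' = 1)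
    {D : ℂ} (hD : HasCollisionDirection Q s D) (hD' : HasCollisionDirection Q s' D) :
    ∃ q : ℝ → ℝ × ℝ, IsPCOE μ c q := by
  obtain ⟨hc, -, -, -, hdir, hsol⟩ := hQ
  have hp : Fact (0 < s' - s) := ⟨sub_pos.mpr hss⟩
  have hadd : s + (s' - s) = s' := by ring
  have hIcc : Icc s s' ⊆ Icc 0 T := Icc_subset_Icc hs.1 hs'.2
  let lift (F : ℝ → ℂ) (t : ℝ) : ℂ := AddCircle.liftIco (s' - s) s F (t : AddCircle (s' - s))
  have hper (F : ℝ → ℂ) (t : ℝ) (k : ℤ) : lift F (t + k • (s' - s)) = lift F t := by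
    change AddCircle.liftIco _ _ _ _ = AddCircle.liftIco _ _ _ _
    rw [AddCircle.coe_add, AddCircle.coe_zsmul, AddCircle.coe_period, smul_zero, add_zero]
  have hin (F : ℝ → ℂ) {t : ℝ} (ht : t ∈ Ico s s') : lift F t = F t :=
    AddCircle.liftIco_coe_apply (by rwa [hadd])
  have hev (F : ℝ → ℂ) {t : ℝ} (ht : t ∈ Ioo s s') : lift F =ᶠ[nhds t] F := by
    filter_upwards [isOpen_Ioo.mem_nhds ht] with x hx
    exact hin F (Ioo_subset_Ico_self hx)
  have hrep (t : ℝ) : ∃ u ∈ Ico s s', ∃ k : ℤ, t + k • (s' - s) = u := by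
    obtain ⟨k, hk, -⟩ := existsUnique_add_zsmul_mem_Ico hp.out t s
    rw [hadd] at hk
    exact ⟨_, hk, k, rfl⟩
  have hcont : Continuous (lift Q) :=
    (AddCircle.liftIco_continuous (by rw [hadd, h1, h1']) (by
      rw [hadd]
      exact hc.mono hIcc)).comp (AddCircle.continuous_mk' _)
  have hshift (F : ℝ → ℂ) (k : ℤ) : (fun t => lift F (t + k • (s' - s))) = lift F :=
    funext fun t => hper F t k
  have hS (t : ℝ) (ht : lift Q t ≠ 1) : SolvesAt μ c (lift Q) (lift P) t := by
    obtain ⟨u, hu, k, hk⟩ := hrep t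
    rw [← hper Q t k, hk, hin Q hu] at ht
    have hu' : u ∈ Ioo s s' := ⟨lt_of_le_of_ne hu.1 fun h => ht (h ▸ h1), hu.2⟩
    have h2 := (hsol u (hIcc (Ioo_subset_Icc_self hu')) ht).congr (hev Q hu') (hev P hu')
    rw [← hk] at h2
    have h3 := h2.comp_add_const
    rwa [hshift, hshift] at h3
  have hDir (t : ℝ) (ht : lift Q t = 1) : ∃ D, HasCollisionDirection (lift Q) t D := by
    obtain ⟨u, hu, k, hk⟩ := hrep t
    rw [← hper Q t k, hk, hin Q hu] at ht
    have key : ∃ D, HasCollisionDirection (lift Q) u D := by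
      rcases eq_or_lt_of_le hu.1 with h | h
      · subst h
        refine ⟨D, hD.1, ?_⟩
        rw [← Iio_union_Ioi, nhdsWithin_union]
        refine Tendsto.sup ?_ ?_
        · have h4 := hD'.2
          have h5 : HasCollisionDirection Q (s + (s' - s)) D := by rwa [hadd]
          refine (h5.comp_add_const.2.mono_left
            (nhdsWithin_mono s fun x hx => (ne_of_lt hx))).congr' ?_
          filter_upwards [Ioo_mem_nhdsLT (show s - (s' - s) < s by linarith)] with x hx
          have h6 := hper Q x 1
          rw [one_smul, hin Q ⟨by linarith [hx.1], by linarith [hx.2]⟩] at h6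
          rw [h6]
        · refine (hD.2.mono_left (nhdsWithin_mono s fun x hx => (ne_of_gt hx))).congr' ?_
          filter_upwards [Ioo_mem_nhdsGT hss] with x hx
          rw [hin Q (Ioo_subset_Ico_self hx)]
      · obtain ⟨D₁, h2, h3⟩ := hdir u (hIcc (Ico_subset_Icc_self hu)) ht
        refine ⟨D₁, h2, h3.congr' ?_⟩
        filter_upwards [nhdsWithin_le_nhds (hev Q ⟨h, hu.2⟩)] with x hx
        rw [hx]
    obtain ⟨D₁, h2⟩ := key
    rw [← hk] at h2
    have h3 := h2.comp_add_const
    rw [hshift] at h3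
    exact ⟨D₁, h3⟩
  have hne {t : ℝ} : ((lift Q t).re, (lift Q t).im) ≠ ((1, 0) : ℝ × ℝ) ↔ lift Q t ≠ 1 :=
    pair_eq_iff.not
  refine ⟨fun t => ((lift Q t).re, (lift Q t).im), continuous_pair.comp hcont,
    ⟨s' - s, hp.out, fun t => ?_⟩, fun t => ?_, ⟨s, ?_⟩, fun t ht => ?_,
    ⟨fun t => ((lift P t).re, (lift P t).im),
      fun t => ((-2 * Complex.I * lift P t - gradV μ (lift Q t)).re,
        (-2 * Complex.I * lift P t - gradV μ (lift Q t)).im), fun t ht => ?_, fun t ht => ?_,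
      fun t ht => ?_⟩, fun t ht => ?_⟩
  · have := hper Q t 1
    rw [one_smul] at this
    beta_reduce
    rw [this]
  · by_cases h : lift Q t = 1
    · exact Or.inr (pair_eq_iff.mpr h)
    · exact Or.inl (hS t h).2.2.2
  · exact pair_eq_iff.mpr ((hin Q ⟨le_rfl, hss⟩).trans h1)
  · obtain ⟨D₁, h2⟩ := hDir t (pair_eq_iff.mp ht)
    obtain ⟨ε, hε, h3⟩ := Metric.mem_nhdsWithin_iff.mp h2.eventually_ne
    refine ⟨ε, hε, fun x hx hxt => ?_⟩
    by_contra hne'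
    exact h3 ⟨by rwa [Metric.mem_ball, Real.dist_eq], hne'⟩ (pair_eq_iff.mp hx)
  · exact ⟨hasDerivAt_pair (hS t (hne.mp ht)).1, hasDerivAt_pair (hS t (hne.mp ht)).2.1⟩
  · exact (continuous_pair.continuousAt.comp
      (hS t (hne.mp ht)).continuousAt_acceleration).continuousWithinAt
  · have h := hS t (hne.mp ht)
    refine ⟨h.equations.1, h.equations.2, ?_⟩
    rw [nrm_eq_norm]
    exact h.2.2.1
  · obtain ⟨D₁, -, h2⟩ := hDir t (pair_eq_iff.mp ht)
    refine ⟨(D₁.re, D₁.im), ((continuous_pair.tendsto D₁).comp h2).congr fun x => ?_⟩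
    have h3 : (((lift Q x).re, (lift Q x).im) - (1, 0) : ℝ × ℝ) =
        ((lift Q x - 1).re, (lift Q x - 1).im) := by simp
    rw [h3, nrm_eq_norm]
    simp

end Periodic

theorem finite_exists_next {S : Set ℝ} (hS : S.Finite) {T : ℝ} (hT : T ∈ S) {t : ℝ} (ht : t < T) :
    ∃ u ∈ S, t < u ∧ ∀ x ∈ Ioo t u, x ∉ S := by
  obtain ⟨u, hu, hmin⟩ := (hS.inter_of_left (Ioi t)).exists_minimalFor id _ ⟨T, hT, ht⟩
  refine ⟨u, hu.1, hu.2, fun x hx hxS => ?_⟩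
  exact absurd (hmin ⟨hxS, hx.1⟩ hx.2.le) (not_le.mpr hx.2)

/-- A finite subdivision covers the interval by its consecutive gaps. -/
theorem le_sum_gaps {S : Finset ℝ} {T : ℝ} (h0 : 0 ∈ S)
    {next : ℝ → ℝ} (hn : ∀ t ∈ S, t < T → next t ∈ S ∧ t < next t) :
    T ≤ ∑ t ∈ S.filter (· < T), (next t - t) := by
  have hcover : Ico 0 T ⊆ ⋃ t ∈ S.filter (· < T), Ico t (next t) := by
    intro u hu
    obtain ⟨t, ht, hmax⟩ := (S.filter (· ≤ u)).exists_max_image id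
      ⟨0, Finset.mem_filter.mpr ⟨h0, hu.1⟩⟩
    rw [Finset.mem_filter] at ht
    have htT : t < T := ht.2.trans_lt hu.2
    obtain ⟨h1, h2⟩ := hn t ht.1 htT
    simp only [mem_iUnion]
    refine ⟨t, Finset.mem_filter.mpr ⟨ht.1, htT⟩, ht.2, ?_⟩
    by_contra! hle
    exact absurd (hmax _ (Finset.mem_filter.mpr ⟨h1, hle⟩)) (not_le.mpr h2)
  have h1 := (MeasureTheory.measure_mono (μ := MeasureTheory.volume) hcover).trans
    (MeasureTheory.measure_biUnion_finset_le _ _)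
  simp only [Real.volume_Ico, sub_zero] at h1
  rw [← ENNReal.ofReal_sum_of_nonneg fun t ht => ?_] at h1
  · refine (ENNReal.ofReal_le_ofReal_iff (Finset.sum_nonneg fun t ht => ?_)).mp h1
    rw [Finset.mem_filter] at ht
    exact sub_nonneg.mpr (hn t ht.1 ht.2).2.le
  · rw [Finset.mem_filter] at ht
    exact sub_nonneg.mpr (hn t ht.1 ht.2).2.le

/-- Below the first critical value there is either a periodic collision orbit with `E`
or infinitely many consecutive collision orbits with `E` (normalized to equal `E`
outside `(0,τ)`). -/
theorem pcr3bp_periodic_collision_or_infinitely_many_consecutive_collision_orbits_with_E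
    (μ c : ℝ) (hμ : μ ∈ Ioo (0 : ℝ) 1) (hc : c < firstCriticalValue μ) :
    (∃ q : ℝ → ℝ × ℝ, IsPCOE μ c q) ∨
    {x : ℝ × (ℝ → ℝ × ℝ) |
      IsCCOE μ c x.1 x.2 ∧ ∀ t ∉ Ioo (0 : ℝ) x.1, x.2 t = (1, 0)}.Infinite := by
  classical
  by_contra! hcon
  obtain ⟨hno, hfin⟩ := hcon
  obtain ⟨T, Q, P, hTL, hT0, hQ⟩ := exists_collisionArc hμ hc (∑ x ∈ hfin.toFinset, x.1 + 1)
  obtain ⟨-, hQ0, hQT, hS, hdir, -⟩ := id hQ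
  have hnext (t : ℝ) (ht : t ∈ hS.toFinset) (htT : t < T) :
      ∃ u ∈ hS.toFinset, t < u ∧ ∀ x ∈ Ioo t u, x ∉ hS.toFinset := by
    obtain ⟨u, hu, h1, h2⟩ := finite_exists_next hS ⟨⟨hT0.le, le_rfl⟩, hQT⟩ htT
    exact ⟨u, hS.mem_toFinset.mpr hu, h1, fun x hx h => h2 x hx (hS.mem_toFinset.mp h)⟩
  choose! next hn1 hn2 hn3 using hnext
  have hle := le_sum_gaps (S := hS.toFinset) (T := T)
    (hS.mem_toFinset.mpr ⟨⟨le_rfl, hT0.le⟩, hQ0⟩)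
    (next := next) fun t ht htT => ⟨hn1 t ht htT, hn2 t ht htT⟩
  let φ : ℝ → ℝ × (ℝ → ℝ × ℝ) := fun t => (next t - t, arcPiece Q t (next t - t))
  have hmaps (t : ℝ) (ht : t ∈ hS.toFinset.filter (· < T)) : φ t ∈ hfin.toFinset := by
    rw [Finset.mem_filter] at ht
    have h1 := hS.mem_toFinset.mp ht.1
    have h2 := hS.mem_toFinset.mp (hn1 t ht.1 ht.2)
    refine hfin.mem_toFinset.mpr ⟨isCCOE_arcPiece hQ h1.1 h2.1 (hn2 t ht.1 ht.2) h1.2 h2.2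
      fun u hu hu1 => hn3 t ht.1 ht.2 u hu (hS.mem_toFinset.mpr
        ⟨⟨h1.1.1.trans hu.1.le, hu.2.le.trans h2.1.2⟩, hu1⟩), fun x hx => if_neg hx⟩
  have hinj : Set.InjOn φ (hS.toFinset.filter (· < T)) := by
    have hlt {t u : ℝ} (ht : t ∈ hS.toFinset.filter (· < T))
        (hu : u ∈ hS.toFinset.filter (· < T)) (htu : φ t = φ u) : ¬ t < u := by
      intro hlt
      rw [Finset.mem_filter] at ht hu
      have h1 := hS.mem_toFinset.mp ht.1
      have h2 := hS.mem_toFinset.mp hu.1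
      obtain ⟨D, hD⟩ := hdir t h1.1 h1.2
      obtain ⟨D', hD'⟩ := hdir u h2.1 h2.2
      have h3 := congrArg Prod.fst htu
      have h4 := congrArg Prod.snd htu
      simp only [φ] at h3 h4
      rw [← h3] at h4
      have h5 := direction_eq_of_arcPiece_eq (sub_pos.mpr (hn2 t ht.1 ht.2)) hD hD' h4
      subst h5
      obtain ⟨q, hq⟩ := isPCOE_of_direction_eq hQ h1.1 h2.1 hlt h1.2 h2.2 hD hD'
      exact hno q hq
    intro t ht u hu htu
    exact le_antisymm (not_lt.mp (hlt hu ht htu.symm)) (not_lt.mp (hlt ht hu htu))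
  have hsum : ∑ t ∈ hS.toFinset.filter (· < T), (next t - t) ≤ ∑ x ∈ hfin.toFinset, x.1 := by
    rw [show ∑ t ∈ hS.toFinset.filter (· < T), (next t - t) =
      ∑ t ∈ hS.toFinset.filter (· < T), (φ t).1 from rfl, ← Finset.sum_image (f := Prod.fst) hinj]
    refine Finset.sum_le_sum_of_subset_of_nonneg (Finset.image_subset_iff.mpr hmaps)
      fun x hx _ => ?_
    exact (hfin.mem_toFinset.mp hx).1.1.le
  linarith
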